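/- Let Ω ⊂ ℝ² be a bounded open set with smooth boundary. There exist constants C₃ = C₃(b₁, b₂, A₁, A₂, C₁, C₂, Ω) and C₄ = C₄(b₁, b₂, A₁, A₂, C₁, C₂, Ω) with the following property: for all V, W : Ω̄ → ℝ and u, v ∈ C²(Ω̄) satisfying -Δu = V e^{v} and -Δv = W e^{u} in Ω, u = 0 and v = 0 on ∂Ω, 0 ≤ V ≤ b₁ and 0 ≤ W ≤ b₂ on Ω, ‖∇V‖_{L^∞(Ω)} ≤ A₁ and ‖∇W‖_{L^∞(Ω)} ≤ A₂, and ∫_Ω e^{u} dx ≤ C₁ and ∫_Ω e^{v} dx ≤ C₂, one has ‖u‖_{L^∞(Ω)} ≤ C₃ and ‖v‖_{L^∞(Ω)} ≤ C₄. -/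

import Mathlib

open MeasureTheory Real Filter Topology Metric Set
open scoped RealInnerProductSpace ENNReal NNReal

noncomputable section

abbrev E2 : Type := EuclideanSpace ℝ (Fin 2)

/-- The Laplacian `Δ = ∂₁₁ + ∂₂₂` on `ℝ²`. -/
noncomputable def lap (u : E2 → ℝ) (x : E2) : ℝ :=
  ∑ i : Fin 2,
    fderiv ℝ (fun y => fderiv ℝ u y (EuclideanSpace.single i 1)) x (EuclideanSpace.single i 1)

/-- A planar set has smooth boundary: near each boundary point the set is the sublevel set
of a smooth local defining function with nonvanishing derivative. -/
def SmoothBoundary (Ω : Set E2) : Prop :=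
  ∀ x ∈ frontier Ω, ∃ (U : Set E2) (f : E2 → ℝ),
    IsOpen U ∧ x ∈ U ∧ ContDiff ℝ (⊤ : ℕ∞) f ∧ (∀ y ∈ U, fderiv ℝ f y ≠ 0) ∧
    Ω ∩ U = {y ∈ U | f y < 0} ∧ frontier Ω ∩ U = {y ∈ U | f y = 0}




/-! ### Partial derivatives -/

/-- Coordinate vector. -/
abbrev ee (i : Fin 2) : E2 := EuclideanSpace.single i 1

/-- Partial derivative. -/
def pd (i : Fin 2) (g : E2 → ℝ) (x : E2) : ℝ := fderiv ℝ g x (ee i)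

lemma lap_eq (u : E2 → ℝ) (x : E2) : lap u x = pd 0 (pd 0 u) x + pd 1 (pd 1 u) x := by
  simp [lap, pd, Fin.sum_univ_two]; rfl

lemma pd_mul {f g : E2 → ℝ} {x : E2} (i : Fin 2) (hf : DifferentiableAt ℝ f x)
    (hg : DifferentiableAt ℝ g x) :
    pd i (fun y => f y * g y) x = f x * pd i g x + g x * pd i f x := by
  unfold pd; rw [fderiv_fun_mul hf hg]; simp

lemma pd_add {f g : E2 → ℝ} {x : E2} (i : Fin 2) (hf : DifferentiableAt ℝ f x)
    (hg : DifferentiableAt ℝ g x) :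
    pd i (fun y => f y + g y) x = pd i f x + pd i g x := by
  unfold pd; rw [fderiv_fun_add hf hg]; simp

lemma pd_sub {f g : E2 → ℝ} {x : E2} (i : Fin 2) (hf : DifferentiableAt ℝ f x)
    (hg : DifferentiableAt ℝ g x) :
    pd i (fun y => f y - g y) x = pd i f x - pd i g x := by
  unfold pd; rw [fderiv_fun_sub hf hg]; simp

lemma pd_const_mul {f : E2 → ℝ} {x : E2} (i : Fin 2) (c : ℝ) (hf : DifferentiableAt ℝ f x) :
    pd i (fun y => c * f y) x = c * pd i f x := by
  unfold pd; rw [fderiv_const_mul hf]; simp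

lemma pd_comp {f : E2 → ℝ} {x : E2} (i : Fin 2) {φ : ℝ → ℝ} (hφ : DifferentiableAt ℝ φ (f x))
    (hf : DifferentiableAt ℝ f x) :
    pd i (fun y => φ (f y)) x = deriv φ (f x) * pd i f x := by
  unfold pd
  have := (hφ.hasDerivAt.comp_hasFDerivAt x hf.hasFDerivAt).fderiv
  simp only [Function.comp_def] at this
  rw [this]; simp

lemma pd_congr {f g : E2 → ℝ} {x : E2} (i : Fin 2) (h : f =ᶠ[𝓝 x] g) : pd i f x = pd i g x := by
  unfold pd; rw [h.fderiv_eq]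

lemma abs_pd_le (i : Fin 2) (g : E2 → ℝ) (x : E2) : |pd i g x| ≤ ‖fderiv ℝ g x‖ := by
  have := (fderiv ℝ g x).le_opNorm (ee i)
  simpa [pd, ee] using this

lemma E2_decomp (x : E2) : x = x 0 • ee 0 + x 1 • ee 1 := by
  ext i; fin_cases i <;> simp [ee]

lemma fderiv_eq_pd (g : E2 → ℝ) (x d : E2) : fderiv ℝ g x d = d 0 * pd 0 g x + d 1 * pd 1 g x := by
  conv_lhs => rw [E2_decomp d]
  simp only [map_add, map_smul, smul_eq_mul, pd]

lemma E2_norm_sq (x : E2) : ‖x‖ ^ 2 = x 0 ^ 2 + x 1 ^ 2 := by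
  rw [EuclideanSpace.norm_sq_eq]; simp [Fin.sum_univ_two]

lemma contDiffOn_pd {g : E2 → ℝ} {Ω : Set E2} (hΩ : IsOpen Ω) {n : WithTop ℕ∞} {m : WithTop ℕ∞}
    (hg : ContDiffOn ℝ n g Ω) (h : m + 1 ≤ n) (i : Fin 2) : ContDiffOn ℝ m (pd i g) Ω :=
  (hg.fderiv_of_isOpen hΩ h).clm_apply contDiffOn_const

lemma contDiff_pd {g : E2 → ℝ} {n : WithTop ℕ∞} {m : WithTop ℕ∞}
    (hg : ContDiff ℝ n g) (h : m + 1 ≤ n) (i : Fin 2) : ContDiff ℝ m (pd i g) :=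
  (hg.fderiv_right h).clm_apply contDiff_const

lemma continuousOn_pd {g : E2 → ℝ} {Ω : Set E2} (hΩ : IsOpen Ω)
    (hg : ContDiffOn ℝ 1 g Ω) (i : Fin 2) : ContinuousOn (pd i g) Ω :=
  (contDiffOn_pd hΩ hg (m := 0) (by simp) i).continuousOn

/-! ### Multiplying by compactly supported functions -/

lemma continuous_mul_of_tsupport {ψ h : E2 → ℝ} {Ω : Set E2} (hΩ : IsOpen Ω)
    (hψ : Continuous ψ) (hs : tsupport ψ ⊆ Ω) (hh : ContinuousOn h Ω) :
    Continuous (fun x => ψ x * h x) := by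
  rw [continuous_iff_continuousAt]
  intro x
  by_cases hx : x ∈ tsupport ψ
  · exact hψ.continuousAt.mul (hh.continuousAt (hΩ.mem_nhds (hs hx)))
  · have : (fun x => ψ x * h x) =ᶠ[𝓝 x] fun _ => 0 := by
      have h1 := (notMem_tsupport_iff_eventuallyEq.1 hx)
      filter_upwards [h1] with y hy
      simp [hy]
    exact (continuousAt_const).congr this.symm

lemma integrable_mul_of_tsupport {ψ h : E2 → ℝ} {Ω : Set E2} (hΩ : IsOpen Ω)
    (hψ : Continuous ψ) (hc : HasCompactSupport ψ) (hs : tsupport ψ ⊆ Ω)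
    (hh : ContinuousOn h Ω) : Integrable (fun x => ψ x * h x) :=
  (continuous_mul_of_tsupport hΩ hψ hs hh).integrable_of_hasCompactSupport hc.mul_right

lemma tsupport_pd_subset (i : Fin 2) (ψ : E2 → ℝ) : tsupport (pd i ψ) ⊆ tsupport ψ := by
  apply closure_minimal _ (isClosed_tsupport ψ)
  intro x hx
  by_contra h
  apply hx
  have h1 := (notMem_tsupport_iff_eventuallyEq.1 h)
  rw [pd_congr i h1]
  simp [pd]

lemma hasCompactSupport_pd (i : Fin 2) {ψ : E2 → ℝ} (h : HasCompactSupport ψ) :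
    HasCompactSupport (pd i ψ) :=
  h.of_isClosed_subset (isClosed_tsupport _) (tsupport_pd_subset i ψ)

/-- Integration by parts against a compactly supported function. -/
lemma ibp {ψ F : E2 → ℝ} {Ω : Set E2} (hΩ : IsOpen Ω) (hψ : ContDiff ℝ 1 ψ)
    (hc : HasCompactSupport ψ) (hs : tsupport ψ ⊆ Ω) (hF : ContDiffOn ℝ 1 F Ω) (i : Fin 2) :
    ∫ x, ψ x * pd i F x = - ∫ x, pd i ψ x * F x := by
  have hcp : Continuous (pd i ψ) := (contDiff_pd hψ (m := 0) (by simp) i).continuous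
  apply integral_mul_fderiv_eq_neg_fderiv_mul_of_integrable
  · exact integrable_mul_of_tsupport hΩ hcp (hasCompactSupport_pd i hc)
      ((tsupport_pd_subset i ψ).trans hs) hF.continuousOn
  · exact integrable_mul_of_tsupport hΩ hψ.continuous hc hs (continuousOn_pd hΩ hF i)
  · exact integrable_mul_of_tsupport hΩ hψ.continuous hc hs hF.continuousOn
  · intro x _; exact (hψ.differentiable (by simp)) x
  · intro x hx; exact (hF.differentiableOn (by simp)).differentiableAt (hΩ.mem_nhds (hs hx))

lemma integral_eq_setIntegral_of_tsupport {ψ h : E2 → ℝ} {Ω : Set E2}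
    (hs : tsupport ψ ⊆ Ω) : ∫ x, ψ x * h x = ∫ x in Ω, ψ x * h x := by
  rw [setIntegral_eq_integral_of_forall_compl_eq_zero]
  intro x hx
  have : ψ x = 0 := by
    by_contra h; exact hx (hs (subset_tsupport ψ h))
  simp [this]

/-! ### Domains with a global defining function -/

/-- `w` is a smooth global defining function of `Ω`. -/
structure GoodDom (Ω : Set E2) (w : E2 → ℝ) : Prop where
  smooth : ContDiff ℝ (⊤ : ℕ∞) w
  cpt : HasCompactSupport w
  pos : ∀ x, x ∈ Ω ↔ 0 < w x
  nz : ∀ x ∈ frontier Ω, fderiv ℝ w x ≠ 0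

namespace GoodDom
variable {Ω : Set E2} {w : E2 → ℝ}

lemma cont (G : GoodDom Ω w) : Continuous w := G.smooth.continuous

lemma smooth' (G : GoodDom Ω w) (n : ℕ) : ContDiff ℝ n w :=
  G.smooth.of_le (by exact_mod_cast le_top)

lemma isOpen (G : GoodDom Ω w) : IsOpen Ω := by
  have : Ω = {x | 0 < w x} := by ext x; exact G.pos x
  rw [this]; exact isOpen_lt continuous_const G.cont

lemma subset (G : GoodDom Ω w) : Ω ⊆ tsupport w := fun x hx =>
  subset_tsupport w (ne_of_gt ((G.pos x).1 hx))

lemma isCompact_closure (G : GoodDom Ω w) : IsCompact (closure Ω) :=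
  G.cpt.of_isClosed_subset isClosed_closure (closure_minimal G.subset (isClosed_tsupport w))

lemma bounded (G : GoodDom Ω w) : Bornology.IsBounded Ω :=
  G.isCompact_closure.isBounded.subset subset_closure

lemma isCompact_frontier (G : GoodDom Ω w) : IsCompact (frontier Ω) :=
  G.isCompact_closure.of_isClosed_subset isClosed_frontier frontier_subset_closure

lemma measurable (G : GoodDom Ω w) : MeasurableSet Ω := G.isOpen.measurableSet

lemma finite (G : GoodDom Ω w) : volume Ω < ⊤ := G.bounded.measure_lt_top

lemma frontier_zero (G : GoodDom Ω w) {x : E2} (hx : x ∈ frontier Ω) : w x = 0 := by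
  have h1 : x ∉ Ω := by
    rw [G.isOpen.frontier_eq] at hx; exact hx.2
  have h2 : 0 ≤ w x := by
    have : closure Ω ⊆ {x | 0 ≤ w x} :=
      closure_minimal (fun y hy => ((G.pos y).1 hy).le) (isClosed_le continuous_const G.cont)
    exact this (frontier_subset_closure hx)
  have h3 : ¬ 0 < w x := fun h => h1 ((G.pos x).2 h)
  linarith

lemma mem_or_frontier (G : GoodDom Ω w) {x : E2} (hx : x ∈ closure Ω) : x ∈ Ω ∨ x ∈ frontier Ω := by
  rw [G.isOpen.frontier_eq]
  by_cases h : x ∈ Ω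
  · exact Or.inl h
  · exact Or.inr ⟨hx, h⟩

/-- Near the boundary, `w` small in `Ω` forces closeness to the boundary. -/
lemma near (G : GoodDom Ω w) {O : Set E2} (hO : IsOpen O) (hf : frontier Ω ⊆ O) :
    ∃ δ > 0, ∀ x ∈ Ω, w x < δ → x ∈ O := by
  have hK : IsCompact (closure Ω \ O) := G.isCompact_closure.diff hO
  have hpos : ∀ x ∈ closure Ω \ O, 0 < w x := by
    rintro x ⟨hx, hxO⟩
    rcases G.mem_or_frontier hx with h | h
    · exact (G.pos x).1 h
    · exact absurd (hf h) hxO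
  rcases (closure Ω \ O).eq_empty_or_nonempty with he | hne
  · refine ⟨1, one_pos, fun x hx _ => ?_⟩
    by_contra h
    have : x ∈ closure Ω \ O := ⟨subset_closure hx, h⟩
    rw [he] at this; exact this
  · obtain ⟨x0, hx0, hmin⟩ := hK.exists_isMinOn hne G.cont.continuousOn
    refine ⟨w x0, hpos x0 hx0, fun x hx hlt => ?_⟩
    by_contra h
    have := hmin (show x ∈ closure Ω \ O from ⟨subset_closure hx, h⟩)
    simp only [mem_setOf_eq] at this
    linarith

/-- squared gradient of `w` -/
lemma grad_pos (G : GoodDom Ω w) {x : E2} (hx : x ∈ frontier Ω) :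
    0 < pd 0 w x ^ 2 + pd 1 w x ^ 2 := by
  have := G.nz x hx
  by_contra h
  have h0 : pd 0 w x = 0 := by nlinarith [sq_nonneg (pd 0 w x), sq_nonneg (pd 1 w x)]
  have h1 : pd 1 w x = 0 := by nlinarith [sq_nonneg (pd 0 w x), sq_nonneg (pd 1 w x)]
  apply this
  ext d
  rw [fderiv_eq_pd, h0, h1]; simp

lemma cont_pd (G : GoodDom Ω w) (i : Fin 2) : Continuous (pd i w) :=
  (contDiff_pd (G.smooth' 1) (m := 0) (by simp) i).continuous

lemma exists_grad_lower (G : GoodDom Ω w) :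
    ∃ c > 0, ∀ x ∈ frontier Ω, c ≤ pd 0 w x ^ 2 + pd 1 w x ^ 2 := by
  rcases (frontier Ω).eq_empty_or_nonempty with he | hne
  · exact ⟨1, one_pos, by simp [he]⟩
  · obtain ⟨x0, hx0, hmin⟩ := G.isCompact_frontier.exists_isMinOn hne
      (f := fun x => pd 0 w x ^ 2 + pd 1 w x ^ 2)
      (((G.cont_pd 0).pow 2).add ((G.cont_pd 1).pow 2)).continuousOn
    exact ⟨_, G.grad_pos hx0, fun x hx => hmin hx⟩

end GoodDom



/-! ### Cutoffs and the divergence theorem -/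

/-- cutoff -/
def cutψ (w : E2 → ℝ) (k : ℕ) (x : E2) : ℝ := Real.smoothTransition (k * w x - 1)

/-- density of the gradient of the cutoff -/
def cutg (w : E2 → ℝ) (k : ℕ) (x : E2) : ℝ := k * deriv Real.smoothTransition (k * w x - 1)

lemma sT_deriv_nonneg (s : ℝ) : 0 ≤ deriv Real.smoothTransition s :=
  Real.smoothTransition.monotone.deriv_nonneg

lemma sT_deriv_zero_of_neg {s : ℝ} (hs : s < 0) : deriv Real.smoothTransition s = 0 := by
  have : Real.smoothTransition =ᶠ[𝓝 s] fun _ => 0 := by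
    filter_upwards [Iio_mem_nhds hs] with y hy
    exact Real.smoothTransition.zero_of_nonpos (le_of_lt hy)
  rw [this.deriv_eq]; simp

lemma sT_deriv_zero_of_gt {s : ℝ} (hs : 1 < s) : deriv Real.smoothTransition s = 0 := by
  have : Real.smoothTransition =ᶠ[𝓝 s] fun _ => 1 := by
    filter_upwards [Ioi_mem_nhds hs] with y hy
    exact Real.smoothTransition.one_of_one_le (le_of_lt hy)
  rw [this.deriv_eq]; simp

lemma sT_contDiff (n : WithTop ℕ∞) (hn : n ≤ (⊤ : ℕ∞)) : ContDiff ℝ n Real.smoothTransition :=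
  Real.smoothTransition.contDiff.of_le hn

lemma sT_deriv_cont : Continuous (deriv Real.smoothTransition) :=
  (Real.smoothTransition.contDiff (n := 1)).continuous_deriv le_rfl

namespace GoodDom
variable {Ω : Set E2} {w : E2 → ℝ}

lemma cutψ_contDiff (G : GoodDom Ω w) (k n : ℕ) : ContDiff ℝ n (cutψ w k) := by
  unfold cutψ
  exact (Real.smoothTransition.contDiff (n := n)).comp
    ((contDiff_const.mul (G.smooth' n)).sub contDiff_const)

lemma cutg_cont (G : GoodDom Ω w) (k : ℕ) : Continuous (cutg w k) := by
  unfold cutg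
  exact continuous_const.mul (sT_deriv_cont.comp ((continuous_const.mul G.cont).sub continuous_const))

lemma cutg_nonneg (k : ℕ) (x : E2) : 0 ≤ cutg w k x :=
  mul_nonneg (Nat.cast_nonneg k) (sT_deriv_nonneg _)

lemma cutψ_nonneg (k : ℕ) (x : E2) : 0 ≤ cutψ w k x := Real.smoothTransition.nonneg _
lemma cutψ_le_one (k : ℕ) (x : E2) : cutψ w k x ≤ 1 := Real.smoothTransition.le_one _

lemma cut_aux (G : GoodDom Ω w) (k : ℕ) : IsCompact {x | 1 ≤ k * w x} := by
  apply G.cpt.of_isClosed_subset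
    (isClosed_le continuous_const (continuous_const.mul G.cont))
  intro x hx
  apply subset_tsupport w
  intro h
  have hx' : 1 ≤ (k : ℝ) * w x := hx
  rw [h, mul_zero] at hx'
  linarith

lemma cut_aux2 (G : GoodDom Ω w) (k : ℕ) : {x | 1 ≤ k * w x} ⊆ Ω := by
  intro x hx
  rw [G.pos]
  by_contra h
  have : (k : ℝ) * w x ≤ 0 := mul_nonpos_of_nonneg_of_nonpos (Nat.cast_nonneg k) (not_lt.1 h)
  simp only [Set.mem_ofPred_eq] at hx
  linarith

lemma cutψ_tsupport' (G : GoodDom Ω w) (k : ℕ) : tsupport (cutψ w k) ⊆ {x | 1 ≤ k * w x} := by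
  apply closure_minimal _ (G.cut_aux k).isClosed
  intro x hx
  by_contra h
  apply hx
  simp only [Set.mem_ofPred_eq, not_le] at h
  exact Real.smoothTransition.zero_of_nonpos (by linarith)

lemma cutg_tsupport' (G : GoodDom Ω w) (k : ℕ) : tsupport (cutg w k) ⊆ {x | 1 ≤ k * w x} := by
  apply closure_minimal _ (G.cut_aux k).isClosed
  intro x hx
  by_contra h
  apply hx
  simp only [Set.mem_ofPred_eq, not_le] at h
  unfold cutg
  rw [sT_deriv_zero_of_neg (by linarith), mul_zero]

lemma cutψ_tsupport (G : GoodDom Ω w) (k : ℕ) : tsupport (cutψ w k) ⊆ Ω :=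
  (G.cutψ_tsupport' k).trans (G.cut_aux2 k)
lemma cutg_tsupport (G : GoodDom Ω w) (k : ℕ) : tsupport (cutg w k) ⊆ Ω :=
  (G.cutg_tsupport' k).trans (G.cut_aux2 k)
lemma cutψ_cpt (G : GoodDom Ω w) (k : ℕ) : HasCompactSupport (cutψ w k) :=
  (G.cut_aux k).of_isClosed_subset (isClosed_tsupport _) (G.cutψ_tsupport' k)
lemma cutg_cpt (G : GoodDom Ω w) (k : ℕ) : HasCompactSupport (cutg w k) :=
  (G.cut_aux k).of_isClosed_subset (isClosed_tsupport _) (G.cutg_tsupport' k)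

lemma cut_pd (G : GoodDom Ω w) (k : ℕ) (i : Fin 2) (x : E2) :
    pd i (cutψ w k) x = cutg w k x * pd i w x := by
  have hw : DifferentiableAt ℝ w x := (G.smooth' 1).differentiable (by simp) x
  unfold cutψ cutg
  rw [pd_comp i (φ := Real.smoothTransition) (f := fun x => k * w x - 1)
    ((Real.smoothTransition.contDiff (n := 1)).differentiable (by simp) _)
    ((hw.const_mul _).sub_const _)]
  rw [pd_sub i (hw.const_mul _) (by fun_prop), pd_const_mul i _ hw]
  simp [pd]; ring

lemma cutψ_eventually (G : GoodDom Ω w) {x : E2} (hx : x ∈ Ω) : ∀ᶠ k in atTop, cutψ w k x = 1 := by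
  have hpos := (G.pos x).1 hx
  have : Tendsto (fun k : ℕ => (k : ℝ) * w x) atTop atTop :=
    tendsto_natCast_atTop_atTop.atTop_mul_const hpos
  filter_upwards [this.eventually_ge_atTop 2] with k hk
  exact Real.smoothTransition.one_of_one_le (by linarith)

lemma cutg_eventually (G : GoodDom Ω w) {O : Set E2} (hO : IsOpen O) (hf : frontier Ω ⊆ O) :
    ∀ᶠ k in atTop, ∀ x, cutg w k x ≠ 0 → x ∈ O ∧ x ∈ Ω := by
  obtain ⟨δ, hδ, h⟩ := G.near hO hf
  have : Tendsto (fun k : ℕ => (k : ℝ) * δ) atTop atTop :=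
    tendsto_natCast_atTop_atTop.atTop_mul_const hδ
  filter_upwards [this.eventually_gt_atTop 2, eventually_gt_atTop 0] with k hk hk0 x hx
  have hxΩ : x ∈ Ω := G.cutg_tsupport k (subset_tsupport _ hx)
  refine ⟨h x hxΩ ?_, hxΩ⟩
  by_contra hlt
  apply hx
  unfold cutg
  have hk0' : (0:ℝ) < k := by exact_mod_cast hk0
  rw [sT_deriv_zero_of_gt, mul_zero]
  nlinarith

lemma cutg_integrable (G : GoodDom Ω w) (k : ℕ) : Integrable (cutg w k) :=
  (G.cutg_cont k).integrable_of_hasCompactSupport (G.cutg_cpt k)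

lemma cutg_bound (G : GoodDom Ω w) : ∃ C : ℝ, 0 < C ∧ ∀ᶠ k in atTop, ∫ x, cutg w k x ≤ C := by
  obtain ⟨c, hc, hlow⟩ := G.exists_grad_lower
  set q : E2 → ℝ := fun x => pd 0 w x ^ 2 + pd 1 w x ^ 2 with hq
  have hqc : Continuous q := ((G.cont_pd 0).pow 2).add ((G.cont_pd 1).pow 2)
  set O : Set E2 := {x | c / 2 < q x} with hOdef
  have hO : IsOpen O := isOpen_lt continuous_const hqc
  have hfO : frontier Ω ⊆ O := fun x hx => by
    have := hlow x hx
    show c / 2 < q x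
    simp only [hq]; linarith
  have hw1 : ∀ i, ContDiff ℝ 1 (pd i w) := fun i => contDiff_pd (G.smooth' 2) (by norm_num) i
  have hlapc : ∀ i, Continuous (pd i (pd i w)) := fun i =>
    (contDiff_pd (hw1 i) (m := 0) (by simp) i).continuous
  have hIntg : ∀ i, Integrable (pd i (pd i w)) := fun i =>
    (hlapc i).integrable_of_hasCompactSupport (hasCompactSupport_pd i (hasCompactSupport_pd i G.cpt))
  set M : ℝ := ∫ x, (|pd 0 (pd 0 w) x| + |pd 1 (pd 1 w) x|) with hM
  have hM0 : 0 ≤ M := integral_nonneg fun x => by positivity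
  refine ⟨(M + 1) / (c / 2), by positivity, ?_⟩
  filter_upwards [G.cutg_eventually hO hfO] with k hk
  rw [le_div_iff₀ (by positivity)]
  have e1 : ∀ i, ∫ x, cutg w k x * pd i w x ^ 2 = - ∫ x, cutψ w k x * pd i (pd i w) x := by
    intro i
    rw [ibp isOpen_univ (G.cutψ_contDiff k 1) (G.cutψ_cpt k) (subset_univ _)
      (hw1 i).contDiffOn i, neg_neg]
    congr 1; ext x; rw [G.cut_pd]; ring
  have i1 : ∀ i, Integrable (fun x => cutg w k x * pd i w x ^ 2) := fun i =>
    integrable_mul_of_tsupport isOpen_univ (G.cutg_cont k) (G.cutg_cpt k) (subset_univ _)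
      ((G.cont_pd i).pow 2).continuousOn
  have i2 : ∀ i, Integrable (fun x => cutψ w k x * pd i (pd i w) x) := fun i =>
    integrable_mul_of_tsupport isOpen_univ (G.cutψ_contDiff k 1).continuous (G.cutψ_cpt k)
      (subset_univ _) (hlapc i).continuousOn
  calc (∫ x, cutg w k x) * (c / 2) = ∫ x, cutg w k x * (c / 2) := (integral_mul_const _ _).symm
    _ ≤ ∫ x, (cutg w k x * pd 0 w x ^ 2 + cutg w k x * pd 1 w x ^ 2) := by
        apply integral_mono ((G.cutg_integrable k).mul_const _) ((i1 0).add (i1 1))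
        intro x
        by_cases h0 : cutg w k x = 0
        · simp [h0]
        · have h2 : c / 2 < q x := (hk x h0).1
          have := mul_le_mul_of_nonneg_left h2.le (cutg_nonneg (w := w) k x)
          simp only [hq] at this
          simp only [Pi.add_apply]; linarith
    _ = - ∫ x, (cutψ w k x * pd 0 (pd 0 w) x + cutψ w k x * pd 1 (pd 1 w) x) := by
        rw [integral_add (i1 0) (i1 1), integral_add (i2 0) (i2 1), e1, e1]; ring
    _ ≤ M := by
        rw [← integral_neg]
        apply integral_mono ((i2 0).add (i2 1)).neg ((hIntg 0).abs.add (hIntg 1).abs)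
        intro x
        have a : ∀ i, -(cutψ w k x * pd i (pd i w) x) ≤ |pd i (pd i w) x| := by
          intro i
          calc -(cutψ w k x * pd i (pd i w) x) ≤ |cutψ w k x * pd i (pd i w) x| := neg_le_abs _
            _ = cutψ w k x * |pd i (pd i w) x| := by rw [abs_mul, abs_of_nonneg (cutψ_nonneg k x)]
            _ ≤ _ := by
              have := mul_le_mul_of_nonneg_right (cutψ_le_one (w := w) k x) (abs_nonneg (pd i (pd i w) x))
              linarith
        have := a 0; have := a 1
        simp only [Pi.neg_apply, Pi.add_apply]; linarith
    _ ≤ M + 1 := by linarith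

lemma integrableOn_of_bounded (G : GoodDom Ω w) {h : E2 → ℝ} (hc : ContinuousOn h Ω) {M : ℝ}
    (hb : ∀ x ∈ Ω, |h x| ≤ M) : IntegrableOn h Ω := by
  apply IntegrableOn.of_bound G.finite (hc.aestronglyMeasurable G.measurable) M
  exact (ae_restrict_iff' G.measurable).2 (Eventually.of_forall hb)

lemma cut_tendsto (G : GoodDom Ω w) {h : E2 → ℝ} (hi : IntegrableOn h Ω) :
    Tendsto (fun k => ∫ x in Ω, cutψ w k x * h x) atTop (𝓝 (∫ x in Ω, h x)) := by
  apply tendsto_integral_of_dominated_convergence (fun x => |h x|)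
  · intro k
    exact (G.cutψ_contDiff k 1).continuous.aestronglyMeasurable.mul hi.aestronglyMeasurable
  · exact hi.abs
  · intro k
    refine Eventually.of_forall fun x => ?_
    rw [Real.norm_eq_abs, abs_mul, abs_of_nonneg (cutψ_nonneg k x)]
    have := mul_le_mul_of_nonneg_right (cutψ_le_one (w := w) k x) (abs_nonneg (h x))
    linarith
  · refine (ae_restrict_iff' G.measurable).2 (Eventually.of_forall fun x hx => ?_)
    apply tendsto_const_nhds.congr'
    filter_upwards [G.cutψ_eventually hx] with k hk
    rw [hk, one_mul]

/-- A condition at each boundary point holds in a neighbourhood of the boundary. -/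
lemma exists_nhd {P : E2 → Prop} (h : ∀ x0 ∈ frontier Ω, ∀ᶠ x in 𝓝[Ω] x0, P x) :
    ∃ O, IsOpen O ∧ frontier Ω ⊆ O ∧ ∀ x ∈ O, x ∈ Ω → P x := by
  choose! U hU using fun x0 hx0 => (mem_nhdsWithin.1 (h x0 hx0))
  refine ⟨⋃ x0 ∈ frontier Ω, U x0, ?_, ?_, ?_⟩
  · exact isOpen_biUnion fun x hx => (hU x hx).1
  · intro x hx; exact mem_biUnion hx (hU x hx).2.1
  · intro x hx hxΩ
    simp only [mem_iUnion] at hx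
    obtain ⟨x0, hx0, hxU⟩ := hx
    exact (hU x0 hx0).2.2 ⟨hxU, hxΩ⟩

/-- One-sided divergence theorem. -/
lemma div_le (G : GoodDom Ω w) {F0 F1 : E2 → ℝ} (h0 : ContDiffOn ℝ 1 F0 Ω)
    (h1 : ContDiffOn ℝ 1 F1 Ω) {M : ℝ} (hM : ∀ x ∈ Ω, |pd 0 F0 x + pd 1 F1 x| ≤ M)
    (hb : ∀ x0 ∈ frontier Ω, ∀ ε > 0, ∀ᶠ x in 𝓝[Ω] x0, -ε ≤ F0 x * pd 0 w x + F1 x * pd 1 w x) :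
    ∫ x in Ω, (pd 0 F0 x + pd 1 F1 x) ≤ 0 := by
  have hO := G.isOpen
  have hcd : ContinuousOn (fun x => pd 0 F0 x + pd 1 F1 x) Ω :=
    (continuousOn_pd hO h0 0).add (continuousOn_pd hO h1 1)
  have hlim := G.cut_tendsto (G.integrableOn_of_bounded hcd hM)
  obtain ⟨C, hC, hgC⟩ := G.cutg_bound
  apply le_of_forall_pos_le_add
  intro ε hε
  obtain ⟨O, hOo, hfO, hOP⟩ := exists_nhd (fun x0 hx0 => hb x0 hx0 (ε / C) (by positivity))
  apply le_of_tendsto hlim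
  filter_upwards [hgC, G.cutg_eventually hOo hfO] with k hk hk2
  have i0 := integrable_mul_of_tsupport hO (G.cutψ_contDiff k 1).continuous (G.cutψ_cpt k)
    (G.cutψ_tsupport k) (continuousOn_pd hO h0 0)
  have i1 := integrable_mul_of_tsupport hO (G.cutψ_contDiff k 1).continuous (G.cutψ_cpt k)
    (G.cutψ_tsupport k) (continuousOn_pd hO h1 1)
  have cw : ∀ {F : E2 → ℝ}, ContDiffOn ℝ 1 F Ω → ∀ i, Integrable (fun x => cutg w k x * (F x * pd i w x)) :=
    fun hF i => integrable_mul_of_tsupport hO (G.cutg_cont k) (G.cutg_cpt k)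
    (G.cutg_tsupport k) (hF.continuousOn.mul (G.cont_pd i).continuousOn)
  rw [← integral_eq_setIntegral_of_tsupport (G.cutψ_tsupport k)]
  have e : ∀ {F : E2 → ℝ}, ContDiffOn ℝ 1 F Ω → ∀ i,
      ∫ x, cutψ w k x * pd i F x = - ∫ x, cutg w k x * (F x * pd i w x) := by
    intro F hF i
    rw [ibp hO (G.cutψ_contDiff k 1) (G.cutψ_cpt k) (G.cutψ_tsupport k) hF i]
    congr 2; ext x; rw [G.cut_pd]; ring
  calc ∫ x, cutψ w k x * (pd 0 F0 x + pd 1 F1 x)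
      = ∫ x, (cutψ w k x * pd 0 F0 x + cutψ w k x * pd 1 F1 x) := by congr 1; ext x; ring
    _ = - ∫ x, (cutg w k x * (F0 x * pd 0 w x) + cutg w k x * (F1 x * pd 1 w x)) := by
      rw [integral_add i0 i1, integral_add (cw h0 0) (cw h1 1), e h0, e h1]; ring
    _ ≤ ∫ x, cutg w k x * (ε / C) := by
      rw [← integral_neg]
      apply integral_mono ((cw h0 0).add (cw h1 1)).neg ((G.cutg_integrable k).mul_const _)
      intro x
      simp only [Pi.neg_apply, Pi.add_apply]
      by_cases hg : cutg w k x = 0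
      · simp [hg]
      · have := hOP x (hk2 x hg).1 (hk2 x hg).2
        have := mul_le_mul_of_nonneg_left this (cutg_nonneg (w := w) k x)
        linarith
    _ ≤ C * (ε / C) := by
      rw [integral_mul_const]; gcongr
    _ = 0 + ε := by field_simp; ring

lemma _root_.contDiff_mul_of_tsupport {ψ h : E2 → ℝ} {Ω : Set E2} {n : WithTop ℕ∞} (hΩ : IsOpen Ω)
    (hψ : ContDiff ℝ n ψ) (hs : tsupport ψ ⊆ Ω) (hh : ContDiffOn ℝ n h Ω) :
    ContDiff ℝ n (fun x => ψ x * h x) := by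
  rw [contDiff_iff_contDiffAt]
  intro x
  by_cases hx : x ∈ tsupport ψ
  · exact hψ.contDiffAt.mul (hh.contDiffAt (hΩ.mem_nhds (hs hx)))
  · have : (fun x => ψ x * h x) =ᶠ[𝓝 x] fun _ => 0 := by
      have h1 := (notMem_tsupport_iff_eventuallyEq.1 hx)
      filter_upwards [h1] with y hy
      simp [hy]
    exact (contDiffAt_const).congr_of_eventuallyEq this

lemma _root_.lip_ibp {A : ℝ≥0} {V : E2 → ℝ} (hV : LipschitzWith A V) {f : E2 → ℝ}
    (hf : ContDiff ℝ 1 f) (hc : HasCompactSupport f) (i : Fin 2) :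
    |∫ x, V x * pd i f x| ≤ A * ∫ x, |f x| := by
  obtain ⟨C, hC⟩ := hf.lipschitzWith_of_hasCompactSupport hc (by simp)
  have h := hV.integral_lineDeriv_mul_eq (μ := volume) hC hc (ee i)
  have e1 : ∀ x, lineDeriv ℝ f x (-ee i) = - pd i f x := by
    intro x
    rw [lineDeriv_neg, (hf.differentiable (by simp) x).lineDeriv_eq_fderiv]; rfl
  have e2 : ∫ x, V x * pd i f x = - ∫ x, lineDeriv ℝ V x (ee i) * f x := by
    rw [h, ← integral_neg]; congr 1; ext x; rw [e1]; ring
  rw [e2, abs_neg, ← integral_const_mul]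
  refine (abs_integral_le_integral_abs).trans ?_
  apply integral_mono_of_nonneg (Eventually.of_forall fun x => abs_nonneg _)
  · exact ((hf.continuous.integrable_of_hasCompactSupport hc).abs).const_mul _
  · refine Eventually.of_forall fun x => ?_
    simp only [abs_mul]
    gcongr
    have := norm_lineDeriv_le_of_lipschitz ℝ hV (x₀ := x) (v := ee i)
    simpa using this

/-- Integration by parts against a Lipschitz potential. -/
lemma lip_div (G : GoodDom Ω w) {A : ℝ≥0} {V : E2 → ℝ} (hV : LipschitzOnWith A V (closure Ω))
    {b : ℝ} (hVb : ∀ x ∈ Ω, |V x| ≤ b) {Z0 Z1 : E2 → ℝ} (h0 : ContDiffOn ℝ 1 Z0 Ω)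
    (h1 : ContDiffOn ℝ 1 Z1 Ω) {M : ℝ} (hZ0 : ∀ x ∈ Ω, |Z0 x| ≤ M) (hZ1 : ∀ x ∈ Ω, |Z1 x| ≤ M)
    (hM : ∀ x ∈ Ω, |pd 0 Z0 x + pd 1 Z1 x| ≤ M)
    (hb : ∀ x0 ∈ frontier Ω, ∀ ε > 0, ∀ᶠ x in 𝓝[Ω] x0, |Z0 x * pd 0 w x + Z1 x * pd 1 w x| ≤ ε) :
    |∫ x in Ω, V x * (pd 0 Z0 x + pd 1 Z1 x)| ≤ A * ∫ x in Ω, (|Z0 x| + |Z1 x|) := by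
  have hO := G.isOpen
  obtain ⟨V', hV', hVV'⟩ := hV.extend_real
  have hVV : ∀ x ∈ Ω, V x = V' x := fun x hx => hVV' (subset_closure hx)
  have eV : ∫ x in Ω, V x * (pd 0 Z0 x + pd 1 Z1 x) = ∫ x in Ω, V' x * (pd 0 Z0 x + pd 1 Z1 x) :=
    setIntegral_congr_fun G.measurable fun x hx => by simp only [hVV x hx]
  rw [eV]
  have hV'b : ∀ x ∈ Ω, |V' x| ≤ b := fun x hx => by rw [← hVV x hx]; exact hVb x hx
  have hcd : ContinuousOn (fun x => pd 0 Z0 x + pd 1 Z1 x) Ω :=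
    (continuousOn_pd hO h0 0).add (continuousOn_pd hO h1 1)
  have hIntg : IntegrableOn (fun x => V' x * (pd 0 Z0 x + pd 1 Z1 x)) Ω := by
    apply G.integrableOn_of_bounded (hV'.continuous.continuousOn.mul hcd) (M := b * M)
    intro x hx
    rw [Pi.mul_apply, abs_mul]
    exact mul_le_mul (hV'b x hx) (hM x hx) (abs_nonneg _) ((abs_nonneg _).trans (hV'b x hx))
  have iZ0 : IntegrableOn (fun x => |Z0 x|) Ω :=
    (G.integrableOn_of_bounded h0.continuousOn hZ0).abs
  have iZ1 : IntegrableOn (fun x => |Z1 x|) Ω :=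
    (G.integrableOn_of_bounded h1.continuousOn hZ1).abs
  have hlim := (G.cut_tendsto hIntg).abs
  obtain ⟨C, hC, hgC⟩ := G.cutg_bound
  apply le_of_forall_pos_le_add
  intro ε hε
  obtain ⟨O, hOo, hfO, hOP⟩ := exists_nhd (fun x0 hx0 => hb x0 hx0 (ε / (C * (|b| + 1)))
    (by positivity))
  apply le_of_tendsto hlim
  filter_upwards [hgC, G.cutg_eventually hOo hfO] with k hk hk2
  have hψc := (G.cutψ_contDiff k 1)
  rw [← integral_eq_setIntegral_of_tsupport (G.cutψ_tsupport k)]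
  have key : ∀ {Z : E2 → ℝ}, ContDiffOn ℝ 1 Z Ω → IntegrableOn (fun x => |Z x|) Ω → ∀ i,
      |∫ x, V' x * pd i (fun y => cutψ w k y * Z y) x| ≤ A * ∫ x in Ω, |Z x| := by
    intro Z hZ iZ i
    refine (lip_ibp hV' (contDiff_mul_of_tsupport hO hψc (G.cutψ_tsupport k) hZ)
      ((G.cutψ_cpt k).mul_right) i).trans ?_
    gcongr
    have : ∀ x, |cutψ w k x * Z x| = cutψ w k x * |Z x| := fun x => by
      rw [abs_mul, abs_of_nonneg (cutψ_nonneg k x)]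
    simp_rw [this]
    rw [integral_eq_setIntegral_of_tsupport (G.cutψ_tsupport k)]
    apply setIntegral_mono_on _ iZ G.measurable
    · intro x _
      have := mul_le_mul_of_nonneg_right (cutψ_le_one (w := w) k x) (abs_nonneg (Z x))
      linarith
    · exact (integrable_mul_of_tsupport hO hψc.continuous (G.cutψ_cpt k)
        (G.cutψ_tsupport k) hZ.continuousOn.abs).integrableOn
  have pde : ∀ {Z : E2 → ℝ}, ContDiffOn ℝ 1 Z Ω → ∀ i x,
      pd i (fun y => cutψ w k y * Z y) x = cutψ w k x * pd i Z x + cutg w k x * (Z x * pd i w x) := by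
    intro Z hZ i x
    by_cases hx : x ∈ tsupport (cutψ w k)
    · rw [pd_mul i (hψc.differentiable (by simp) x)
        ((hZ.differentiableOn (by simp)).differentiableAt (hO.mem_nhds (G.cutψ_tsupport k hx))),
        G.cut_pd]; ring
    · have h1 := (notMem_tsupport_iff_eventuallyEq.1 hx)
      have h2 : (fun y => cutψ w k y * Z y) =ᶠ[𝓝 x] fun _ => 0 := by
        filter_upwards [h1] with y hy; simp [hy]
      have h3 : cutg w k x * pd i w x = 0 := by
        rw [← G.cut_pd, pd_congr i h1]; simp [pd]
      rw [pd_congr i h2, h1.self_of_nhds]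
      have h4 : cutg w k x * (Z x * pd i w x) = 0 := by
        rw [mul_left_comm, h3, mul_zero]
      rw [h4]; simp [pd]
  have i1 : ∀ {Z : E2 → ℝ}, ContDiffOn ℝ 1 Z Ω → ∀ i,
      Integrable (fun x => cutψ w k x * (V' x * pd i Z x)) := fun hZ i =>
    integrable_mul_of_tsupport hO hψc.continuous (G.cutψ_cpt k)
        (G.cutψ_tsupport k) (hV'.continuous.continuousOn.mul (continuousOn_pd hO hZ i))
  have i2 : ∀ {Z : E2 → ℝ}, ContDiffOn ℝ 1 Z Ω → ∀ i,
      Integrable (fun x => cutg w k x * (V' x * (Z x * pd i w x))) := fun hZ i =>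
    integrable_mul_of_tsupport hO (G.cutg_cont k) (G.cutg_cpt k)
        (G.cutg_tsupport k) (hV'.continuous.continuousOn.mul
          (hZ.continuousOn.mul (G.cont_pd i).continuousOn))
  have split : ∀ {Z : E2 → ℝ}, ContDiffOn ℝ 1 Z Ω → ∀ i,
      ∫ x, V' x * pd i (fun y => cutψ w k y * Z y) x =
      (∫ x, cutψ w k x * (V' x * pd i Z x)) + ∫ x, cutg w k x * (V' x * (Z x * pd i w x)) := by
    intro Z hZ i
    rw [← integral_add (i1 hZ i) (i2 hZ i)]
    congr 1; ext x; rw [pde hZ]; ring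
  have small : |(∫ x, cutg w k x * (V' x * (Z0 x * pd 0 w x))) +
      ∫ x, cutg w k x * (V' x * (Z1 x * pd 1 w x))| ≤ ε := by
    rw [← integral_add (i2 h0 0) (i2 h1 1)]
    refine (abs_integral_le_integral_abs).trans ?_
    calc _ ≤ ∫ x, cutg w k x * (ε / C) := by
          apply integral_mono_of_nonneg (Eventually.of_forall fun x => abs_nonneg _)
            ((G.cutg_integrable k).mul_const _)
          refine Eventually.of_forall fun x => ?_
          simp only
          by_cases hg : cutg w k x = 0
          · simp [hg]
          · obtain ⟨a1, a2⟩ := hk2 x hg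
            have a3 := hOP x a1 a2
            have a4 := hV'b x a2
            have : cutg w k x * (V' x * (Z0 x * pd 0 w x)) + cutg w k x * (V' x * (Z1 x * pd 1 w x))
              = cutg w k x * (V' x * (Z0 x * pd 0 w x + Z1 x * pd 1 w x)) := by ring
            rw [this, abs_mul, abs_mul, abs_of_nonneg (cutg_nonneg k x)]
            apply mul_le_mul_of_nonneg_left _ (cutg_nonneg k x)
            calc |V' x| * |Z0 x * pd 0 w x + Z1 x * pd 1 w x|
                ≤ (|b| + 1) * (ε / (C * (|b| + 1))) := by
                  apply mul_le_mul _ a3 (abs_nonneg _) (by positivity)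
                  have := le_abs_self b; linarith
              _ = ε / C := by field_simp
      _ ≤ C * (ε / C) := by rw [integral_mul_const]; gcongr
      _ = ε := by field_simp
  have e : ∫ x, cutψ w k x * (V' x * (pd 0 Z0 x + pd 1 Z1 x)) =
      (∫ x, V' x * pd 0 (fun y => cutψ w k y * Z0 y) x) +
      (∫ x, V' x * pd 1 (fun y => cutψ w k y * Z1 y) x) -
      ((∫ x, cutg w k x * (V' x * (Z0 x * pd 0 w x))) +
      ∫ x, cutg w k x * (V' x * (Z1 x * pd 1 w x))) := by
    rw [split h0, split h1]
    have : ∫ x, cutψ w k x * (V' x * (pd 0 Z0 x + pd 1 Z1 x)) =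
      (∫ x, cutψ w k x * (V' x * pd 0 Z0 x)) + ∫ x, cutψ w k x * (V' x * pd 1 Z1 x) := by
      rw [← integral_add (i1 h0 0) (i1 h1 1)]; congr 1; ext x; ring
    rw [this]; ring
  rw [e, integral_add iZ0 iZ1, mul_add]
  have k0 := abs_le.1 (key h0 iZ0 0)
  have k1 := abs_le.1 (key h1 iZ1 1)
  have k2 := abs_le.1 small
  rw [abs_le]; constructor <;> linarith [k0.1, k0.2, k1.1, k1.2, k2.1, k2.2]

/-- Green's identity against compactly supported functions. -/
lemma _root_.green {φ u : E2 → ℝ} {Ω : Set E2} (hΩ : IsOpen Ω) (hφ : ContDiff ℝ 2 φ)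
    (hc : HasCompactSupport φ) (hs : tsupport φ ⊆ Ω) (hu : ContDiffOn ℝ 2 u Ω) (i : Fin 2) :
    ∫ x, φ x * pd i (pd i u) x = ∫ x, pd i (pd i φ) x * u x := by
  rw [ibp hΩ (hφ.of_le (by norm_num)) hc hs (contDiffOn_pd hΩ hu (by norm_num) i) i]
  rw [ibp hΩ (contDiff_pd hφ (by norm_num) i) (hasCompactSupport_pd i hc)
    ((tsupport_pd_subset i φ).trans hs) (hu.of_le (by norm_num)) i, neg_neg]

end GoodDom



/-! ### Global defining function -/

lemma eventually_neg_of_fderiv_neg {f : E2 → ℝ} {L : E2 →L[ℝ] ℝ} {x d : E2}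
    (hf : HasFDerivAt f L x) (h0 : f x = 0) (hd : L d < 0) :
    ∀ᶠ s : ℝ in 𝓝[>] 0, f (x + s • d) < 0 := by
  have h1 : HasDerivAt (fun s : ℝ => f (x + s • d)) (L d) 0 := by
    have h2 : HasDerivAt (fun s : ℝ => x + s • d) d 0 := by
      simpa using ((hasDerivAt_id (0 : ℝ)).smul_const d).const_add x
    have h3 : HasFDerivAt f L (x + (0 : ℝ) • d) := by simpa using hf
    exact h3.comp_hasDerivAt (0 : ℝ) h2
  have h2 := h1.tendsto_slope_zero_right
  have h3 := h2.eventually (gt_mem_nhds hd)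
  filter_upwards [h3, self_mem_nhdsWithin] with s hs hs0
  have hs0' : (0 : ℝ) < s := hs0
  simp only [zero_add, zero_smul, add_zero, h0, sub_zero, smul_eq_mul] at hs
  by_contra h
  have : 0 ≤ s⁻¹ * f (x + s • d) := mul_nonneg (by positivity) (not_lt.1 h)
  linarith

lemma fderiv_zero_of_nonneg {g : E2 → ℝ} {x : E2} (h : ∀ y, 0 ≤ g y) (h0 : g x = 0) :
    fderiv ℝ g x = 0 := by
  apply IsLocalMin.fderiv_eq_zero
  exact Eventually.of_forall fun y => by rw [h0]; exact h y

lemma exists_goodDom {Ω : Set E2} (hO : IsOpen Ω) (hb : Bornology.IsBounded Ω)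
    (hs : SmoothBoundary Ω) : ∃ w, GoodDom Ω w := by
  choose! U f hU hxU hf hnz hlt heq using hs
  have hK : IsCompact (frontier Ω) :=
    hb.isCompact_closure.of_isClosed_subset isClosed_frontier frontier_subset_closure
  obtain ⟨t, htf, htc⟩ := hK.elim_nhds_subcover U (fun x hx => (hU x hx).mem_nhds (hxU x hx))
  have hχ : ∀ x ∈ frontier Ω, ∃ χ : E2 → ℝ, Function.support χ = U x ∧ ContDiff ℝ (⊤ : ℕ∞) χ ∧
      range χ ⊆ Icc 0 1 := fun x hx => (hU x hx).exists_contDiff_support_eq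
  choose! χ hχs hχc hχr using hχ
  obtain ⟨g, hgs, hgc, hgr⟩ := hO.exists_contDiff_support_eq (n := (⊤ : ℕ∞))
  have hg0 : ∀ x, 0 ≤ g x := fun x => (hgr (mem_range_self x)).1
  have hχ0 : ∀ i ∈ frontier Ω, ∀ x, 0 ≤ χ i x := fun i hi x => (hχr i hi (mem_range_self x)).1
  obtain ⟨R, hR⟩ := hb.subset_closedBall 0
  set b : ContDiffBump (0 : E2) := ⟨|R| + 1, |R| + 2, by positivity, by linarith⟩ with hbdef
  have hb1 : ∀ x ∈ closure Ω, ∀ᶠ y in 𝓝 x, b y = 1 := by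
    intro x hx
    have hx1 : x ∈ closedBall (0 : E2) R := closure_minimal hR isClosed_closedBall hx
    have hx2 : x ∈ ball (0 : E2) (|R| + 1) := by
      rw [mem_closedBall] at hx1; rw [mem_ball]
      have := le_abs_self R; linarith
    filter_upwards [isOpen_ball.mem_nhds hx2] with y hy
    exact b.one_of_mem_closedBall (ball_subset_closedBall hy)
  set p : E2 → ℝ := fun x => g x + ∑ i ∈ t, χ i x * (- f i x) with hp
  have hpc : ContDiff ℝ (⊤ : ℕ∞) p := by
    apply hgc.add
    apply ContDiff.sum
    intro i hi
    exact (hχc i (htf i hi)).mul (hf i (htf i hi)).neg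
  refine ⟨fun x => b x * p x, ?_, ?_, ?_, ?_⟩
  · exact b.contDiff.mul hpc
  · exact b.hasCompactSupport.mul_right
  · intro x
    constructor
    · intro hx
      have h1 := (hb1 x (subset_closure hx)).self_of_nhds
      have h2 : 0 < g x := lt_of_le_of_ne (hg0 x) (by
        have : x ∈ Function.support g := by rw [hgs]; exact hx
        exact (Ne.symm this))
      simp only [h1, one_mul, hp]
      apply add_pos_of_pos_of_nonneg h2
      apply Finset.sum_nonneg
      intro i hi
      have hi' := htf i hi
      by_cases hx2 : x ∈ U i
      · have : x ∈ {y ∈ U i | f i y < 0} := by rw [← hlt i hi']; exact ⟨hx, hx2⟩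
        exact mul_nonneg (hχ0 i hi' x) (by linarith [this.2])
      · rw [← hχs i hi', Function.notMem_support] at hx2
        simp [hx2]
    · intro h
      by_contra hx
      have h2 : g x = 0 := by rwa [← Function.notMem_support, hgs]
      have : p x ≤ 0 := by
        simp only [hp, h2, zero_add]
        apply Finset.sum_nonpos
        intro i hi
        have hi' := htf i hi
        by_cases hx2 : x ∈ U i
        · have : ¬ f i x < 0 := fun hh => by
            have : x ∈ Ω ∩ U i := by rw [hlt i hi']; exact ⟨hx2, hh⟩
            exact hx this.1
          exact mul_nonpos_of_nonneg_of_nonpos (hχ0 i hi' x) (by linarith)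
        · rw [← hχs i hi', Function.notMem_support] at hx2
          simp [hx2]
      have := mul_nonpos_of_nonneg_of_nonpos (b.nonneg' x) this
      linarith
  · intro x hx
    have e1 : (fun x => b x * p x) =ᶠ[𝓝 x] p := by
      filter_upwards [hb1 x (frontier_subset_closure hx)] with y hy
      rw [hy, one_mul]
    rw [e1.fderiv_eq]
    have hxΩ : x ∉ Ω := by rw [hO.frontier_eq] at hx; exact hx.2
    have hgx : g x = 0 := by rwa [← Function.notMem_support, hgs]
    have hgd : DifferentiableAt ℝ g x := hgc.differentiable (by simp) x
    have hfd : ∀ i ∈ t, DifferentiableAt ℝ (f i) x := fun i hi =>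
      (hf i (htf i hi)).differentiable (by simp) x
    have hχd : ∀ i ∈ t, DifferentiableAt ℝ (χ i) x := fun i hi =>
      (hχc i (htf i hi)).differentiable (by simp) x
    have e2 : fderiv ℝ p x = - ∑ i ∈ t, χ i x • fderiv ℝ (f i) x := by
      have h1 : HasFDerivAt p (0 + ∑ i ∈ t, (-(χ i x • fderiv ℝ (f i) x))) x := by
        apply HasFDerivAt.add
        · rw [← fderiv_zero_of_nonneg hg0 hgx]; exact hgd.hasFDerivAt
        · apply HasFDerivAt.fun_sum
          intro i hi
          have h3 := (hχd i hi).hasFDerivAt.mul (hfd i hi).hasFDerivAt.neg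
          have : (-f i x) • fderiv ℝ (χ i) x = 0 := by
            by_cases hx2 : x ∈ U i
            · have : x ∈ {y ∈ U i | f i y = 0} := by rw [← heq i (htf i hi)]; exact ⟨hx, hx2⟩
              rw [this.2]; simp
            · rw [← hχs i (htf i hi), Function.notMem_support] at hx2
              rw [fderiv_zero_of_nonneg (hχ0 i (htf i hi)) hx2]; simp
          have e4 : (-f i) x = -f i x := rfl
          rw [e4, this, add_zero, smul_neg] at h3
          exact h3
      rw [h1.fderiv]; simp
    rw [e2]
    obtain ⟨i0, hi0, hxi0⟩ : ∃ i ∈ t, x ∈ U i := by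
      have := htc hx; simpa using this
    have hn0 := hnz i0 (htf i0 hi0) x hxi0
    obtain ⟨d, hd⟩ : ∃ d, fderiv ℝ (f i0) x d < 0 := by
      obtain ⟨d, hd⟩ : ∃ d, fderiv ℝ (f i0) x d ≠ 0 := by
        by_contra hh; push Not at hh
        exact hn0 (ContinuousLinearMap.ext hh)
      rcases lt_or_gt_of_ne hd with h | h
      · exact ⟨d, h⟩
      · exact ⟨-d, by simpa using h⟩
    have fz : ∀ i ∈ t, x ∈ U i → f i x = 0 := fun i hi hx2 => by
      have : x ∈ {y ∈ U i | f i y = 0} := by rw [← heq i (htf i hi)]; exact ⟨hx, hx2⟩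
      exact this.2
    have hnhd : ∀ i ∈ t, x ∈ U i → ∀ᶠ s : ℝ in 𝓝[>] 0, x + s • d ∈ U i := by
      intro i hi hx2
      have hc : Tendsto (fun s : ℝ => x + s • d) (𝓝[>] 0) (𝓝 x) := by
        have : Continuous (fun s : ℝ => x + s • d) := by fun_prop
        have := (this.tendsto 0).mono_left (nhdsWithin_le_nhds (s := Ioi 0))
        simpa using this
      exact hc.eventually ((hU i (htf i hi)).mem_nhds hx2)
    have hle : ∀ i ∈ t, x ∈ U i → fderiv ℝ (f i) x d ≤ 0 := by
      intro i hi hx2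
      by_contra hpos
      have h1 := eventually_neg_of_fderiv_neg (hfd i0 hi0).hasFDerivAt (fz i0 hi0 hxi0) hd
      have h2 := eventually_neg_of_fderiv_neg (hfd i hi).hasFDerivAt.neg (d := d)
        (by simp [fz i hi hx2]) (by simpa using hpos)
      obtain ⟨s, a1, a2, a3, a4⟩ := (h1.and (h2.and ((hnhd i0 hi0 hxi0).and (hnhd i hi hx2)))).exists
      have b1 : x + s • d ∈ Ω ∩ U i0 := by rw [hlt i0 (htf i0 hi0)]; exact ⟨a3, a1⟩
      have b2 : x + s • d ∈ {y ∈ U i | f i y < 0} := by rw [← hlt i (htf i hi)]; exact ⟨b1.1, a4⟩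
      have := b2.2
      simp only [Pi.neg_apply] at a2
      linarith
    intro hzero
    have h5 : ∑ i ∈ t, χ i x * fderiv ℝ (f i) x d = 0 := by
      have := congrArg (fun L : E2 →L[ℝ] ℝ => L d) hzero
      simpa using this
    have h6 : ∑ i ∈ t, χ i x * fderiv ℝ (f i) x d < 0 := by
      apply Finset.sum_neg' 
      · intro i hi
        by_cases hx2 : x ∈ U i
        · exact mul_nonpos_of_nonneg_of_nonpos (hχ0 i (htf i hi) x) (hle i hi hx2)
        · rw [← hχs i (htf i hi), Function.notMem_support] at hx2
          simp [hx2]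
      · refine ⟨i0, hi0, ?_⟩
        apply mul_neg_of_pos_of_neg _ hd
        apply lt_of_le_of_ne (hχ0 i0 (htf i0 hi0) x)
        rw [← hχs i0 (htf i0 hi0)] at hxi0
        exact (Ne.symm hxi0)
    linarith



/-! ### Regularity up to the boundary -/

lemma reg_aux {Ω : Set E2} (hO : IsOpen Ω) {u : E2 → ℝ} (hu : ContDiffOn ℝ 2 u (closure Ω))
    {x0 : E2} (hx : x0 ∈ closure Ω) :
    ∃ L : E2 →L[ℝ] ℝ, Tendsto (fderiv ℝ u) (𝓝[Ω] x0) (𝓝 L) ∧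
      HasFDerivWithinAt u L (closure Ω) x0 := by
  have h := hu x0 hx
  rw [show (2 : WithTop ℕ∞) = 1 + 1 by norm_num,
    contDiffWithinAt_succ_iff_hasFDerivWithinAt (by simp)] at h
  obtain ⟨s, hs, -, f', hf', hc⟩ := h
  rw [insert_eq_of_mem hx] at hs
  obtain ⟨O, hOo, hxO, hOs⟩ := mem_nhdsWithin.1 hs
  have hx0s : x0 ∈ s := hOs ⟨hxO, hx⟩
  refine ⟨f' x0, ?_, ?_⟩
  · have hcont : Tendsto f' (𝓝[s] x0) (𝓝 (f' x0)) := hc.continuousWithinAt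
    have hsub : O ∩ Ω ⊆ s := fun y hy => hOs ⟨hy.1, subset_closure hy.2⟩
    have h1 : 𝓝[Ω] x0 = 𝓝[O ∩ Ω] x0 := by
      rw [inter_comm, nhdsWithin_inter_of_mem' ]
      exact mem_nhdsWithin_of_mem_nhds (hOo.mem_nhds hxO)
    rw [h1]
    apply (hcont.mono_left (nhdsWithin_mono _ hsub)).congr'
    filter_upwards [self_mem_nhdsWithin] with y hy
    have : s ∈ 𝓝 y := mem_of_superset ((hOo.inter hO).mem_nhds hy) hsub
    exact ((hf' y (hsub hy)).hasFDerivAt this).fderiv.symm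
  · exact (hf' x0 hx0s).mono_of_mem_nhdsWithin hs

lemma grad_bdd_aux {Ω : Set E2} (hO : IsOpen Ω) (hK : IsCompact (closure Ω)) {u : E2 → ℝ}
    (hu : ContDiffOn ℝ 2 u (closure Ω)) : ∃ M, ∀ x ∈ Ω, ‖fderiv ℝ u x‖ ≤ M := by
  have := hK.induction_on (p := fun s => ∃ M, ∀ x ∈ s, x ∈ Ω → ‖fderiv ℝ u x‖ ≤ M)
    ⟨0, by simp⟩ (fun s t hst ⟨M, hM⟩ => ⟨M, fun x hx => hM x (hst hx)⟩)
    (fun s t ⟨M, hM⟩ ⟨M', hM'⟩ => ⟨max M M', fun x hx hxΩ => by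
      rcases hx with h | h
      · exact (hM x h hxΩ).trans (le_max_left _ _)
      · exact (hM' x h hxΩ).trans (le_max_right _ _)⟩)
    (fun x hx => by
      obtain ⟨L, hL, -⟩ := reg_aux hO hu hx
      have h1 := hL.norm.eventually (Iio_mem_nhds (lt_add_one ‖L‖))
      obtain ⟨O, hOo, hxO, hOs⟩ := mem_nhdsWithin.1 h1
      refine ⟨O, mem_nhdsWithin_of_mem_nhds (hOo.mem_nhds hxO), ‖L‖ + 1, fun y hy hyΩ => ?_⟩
      exact (hOs ⟨hy, hyΩ⟩ : ‖fderiv ℝ u y‖ < _).le)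
  obtain ⟨M, hM⟩ := this
  exact ⟨M, fun x hx => hM x (subset_closure hx) hx⟩

/-! ### Maximum principle -/

lemma hasDerivAt_line {h : E2 → ℝ} {x : E2} {s : ℝ} (i : Fin 2)
    (hd : DifferentiableAt ℝ h (x + s • ee i)) :
    HasDerivAt (fun s : ℝ => h (x + s • ee i)) (pd i h (x + s • ee i)) s := by
  have h2 : HasDerivAt (fun s : ℝ => x + s • ee i) (ee i) s := by
    simpa using ((hasDerivAt_id s).smul_const (ee i)).const_add x
  exact hd.hasFDerivAt.comp_hasDerivAt s h2

lemma pd_pd_nonneg_of_isLocalMin {Ω : Set E2} (hO : IsOpen Ω) {h : E2 → ℝ}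
    (hh : ContDiffOn ℝ 2 h Ω) {x : E2} (hx : x ∈ Ω) (hmin : IsLocalMin h x) (i : Fin 2) :
    0 ≤ pd i (pd i h) x := by
  by_contra hneg
  push Not at hneg
  set g : ℝ → ℝ := fun s => h (x + s • ee i) with hg
  have hcl : Continuous (fun s : ℝ => x + s • ee i) := by fun_prop
  have htx : Tendsto (fun s : ℝ => x + s • ee i) (𝓝 0) (𝓝 x) := by
    have := hcl.tendsto 0; simpa using this
  have hd1 : ∀ y ∈ Ω, DifferentiableAt ℝ h y := fun y hy =>
    (hh.differentiableOn (by simp)).differentiableAt (hO.mem_nhds hy)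
  have hd2 : ∀ y ∈ Ω, DifferentiableAt ℝ (pd i h) y := fun y hy =>
    ((contDiffOn_pd hO hh (m := 1) (by norm_num) i).differentiableOn (by simp)).differentiableAt
      (hO.mem_nhds hy)
  have e1 : deriv g =ᶠ[𝓝 0] fun s => pd i h (x + s • ee i) := by
    filter_upwards [htx.eventually (hO.mem_nhds hx)] with s hs
    exact (hasDerivAt_line i (hd1 _ hs)).deriv
  have hx0 : x + (0 : ℝ) • ee i = x := by simp
  have e2 : deriv (deriv g) 0 = pd i (pd i h) x := by
    rw [e1.deriv_eq, (hasDerivAt_line (s := 0) i (by rw [hx0]; exact hd2 x hx)).deriv, hx0]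
  have gmin : IsLocalMin g 0 := by
    have : ∀ᶠ s in 𝓝 (0 : ℝ), h x ≤ h (x + s • ee i) := htx.eventually hmin
    filter_upwards [this] with s hs
    simpa [hg] using hs
  have gmax : IsLocalMax g 0 := by
    apply isLocalMax_of_deriv_deriv_neg
    · rw [e2]; exact hneg
    · exact gmin.deriv_eq_zero
    · exact (hasDerivAt_line (s := 0) i (by rw [hx0]; exact hd1 x hx)).continuousAt
  have gc : g =ᶠ[𝓝 0] fun _ => g 0 := by
    filter_upwards [gmin, gmax] with s h1 h2
    exact le_antisymm h2 h1
  have e3 : deriv g =ᶠ[𝓝 0] fun _ => 0 := by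
    filter_upwards [gc.eventuallyEq_nhds] with s hs
    rw [hs.deriv_eq]; simp
  have : deriv (deriv g) 0 = 0 := by rw [e3.deriv_eq]; simp
  linarith

lemma pd_coord (i j : Fin 2) (x : E2) : pd i (fun y : E2 => y j) x = if i = j then 1 else 0 := by
  have : HasFDerivAt (fun y : E2 => y j) (EuclideanSpace.proj j : E2 →L[ℝ] ℝ) x :=
    (EuclideanSpace.proj j : E2 →L[ℝ] ℝ).hasFDerivAt
  unfold pd; rw [this.fderiv]
  simp [ee, eq_comm]

lemma contDiff_coord {n : WithTop ℕ∞} (j : Fin 2) : ContDiff ℝ n (fun y : E2 => y j) :=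
  (EuclideanSpace.proj j : E2 →L[ℝ] ℝ).contDiff

lemma diff_coord (j : Fin 2) (x : E2) : DifferentiableAt ℝ (fun y : E2 => y j) x :=
  (contDiff_coord (n := 1) j).differentiable (by simp) x

lemma superharm_nonneg {Ω : Set E2} (hO : IsOpen Ω) (hK : IsCompact (closure Ω)) {u : E2 → ℝ}
    (hu : ContDiffOn ℝ 2 u (closure Ω)) (hl : ∀ x ∈ Ω, lap u x ≤ 0)
    (hb : ∀ x ∈ frontier Ω, u x = 0) : ∀ x ∈ closure Ω, 0 ≤ u x := by
  intro x hx
  by_contra hneg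
  push Not at hneg
  obtain ⟨R, hR⟩ := hK.isBounded.subset_closedBall 0
  set ε : ℝ := (-u x) / 2 / (R ^ 2 + 1) with hε
  have hε0 : 0 < ε := by apply div_pos (by linarith) (by positivity)
  have hεR : ε * R ^ 2 < -u x := by
    have : ε * (R ^ 2 + 1) = (-u x) / 2 := by rw [hε]; field_simp
    nlinarith
  set h : E2 → ℝ := fun y => u y - ε * (y 0 * y 0 + y 1 * y 1) with hh
  have hN : ContDiff ℝ 2 (fun y : E2 => ε * (y 0 * y 0 + y 1 * y 1)) :=
    contDiff_const.mul (((contDiff_coord 0).mul (contDiff_coord 0)).add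
      ((contDiff_coord 1).mul (contDiff_coord 1)))
  have hhc : ContDiffOn ℝ 2 h (closure Ω) := hu.sub hN.contDiffOn
  obtain ⟨z, hz, hzmin⟩ := hK.exists_isMinOn ⟨x, hx⟩ hhc.continuousOn
  have hzx : h z ≤ h x := hzmin hx
  have hzΩ : z ∈ Ω := by
    by_contra hzn
    have hzf : z ∈ frontier Ω := by rw [hO.frontier_eq]; exact ⟨hz, hzn⟩
    have h1 : u z = 0 := hb z hzf
    have h2 : ‖z‖ ≤ R := by simpa using hR hz
    have h3 : z 0 * z 0 + z 1 * z 1 ≤ R ^ 2 := by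
      have := E2_norm_sq z
      have : ‖z‖ ^ 2 ≤ R ^ 2 := by gcongr
      nlinarith
    have h4 : h x ≤ u x := by
      simp only [hh]
      have : 0 ≤ ε * (x 0 * x 0 + x 1 * x 1) :=
        mul_nonneg hε0.le (by nlinarith [sq_nonneg (x 0), sq_nonneg (x 1)])
      linarith
    have h5 : - (ε * R ^ 2) ≤ h z := by
      simp only [hh, h1]
      have := mul_le_mul_of_nonneg_left h3 hε0.le
      linarith
    linarith
  have hhΩ : ContDiffOn ℝ 2 h Ω := hhc.mono subset_closure
  have huΩ : ContDiffOn ℝ 2 u Ω := hu.mono subset_closure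
  have hloc : IsLocalMin h z := by
    filter_upwards [hO.mem_nhds hzΩ] with y hy
    exact hzmin (subset_closure hy)
  have key : ∀ i, pd i (pd i h) z = pd i (pd i u) z - 2 * ε := by
    intro i
    have e1 : pd i h =ᶠ[𝓝 z] fun y => pd i u y - (2 * ε) * y i := by
      filter_upwards [hO.mem_nhds hzΩ] with y hy
      simp only [hh]
      rw [pd_sub i ((huΩ.differentiableOn (by simp)).differentiableAt (hO.mem_nhds hy))
        (hN.differentiable (by simp) y)]
      rw [pd_const_mul i ε (((contDiff_coord 0).mul (contDiff_coord 0)).add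
      ((contDiff_coord 1).mul (contDiff_coord 1)) |>.differentiable (n := 1) (by simp) y)]
      rw [pd_add (f := fun y : E2 => y 0 * y 0) (g := fun y : E2 => y 1 * y 1) i
          ((diff_coord 0 y).mul (diff_coord 0 y)) ((diff_coord 1 y).mul (diff_coord 1 y)),
        pd_mul i (diff_coord 0 y) (diff_coord 0 y), pd_mul i (diff_coord 1 y) (diff_coord 1 y),
        pd_coord, pd_coord]
      fin_cases i <;> simp <;> ring
    rw [pd_congr i e1, pd_sub i _ ((diff_coord i z).const_mul _), pd_const_mul i _ (diff_coord i z),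
      pd_coord]
    · simp
    · exact ((contDiffOn_pd hO huΩ (m := 1) (by norm_num) i).differentiableOn
        (by simp)).differentiableAt (hO.mem_nhds hzΩ)
  have k0 := pd_pd_nonneg_of_isLocalMin hO hhΩ hzΩ hloc 0
  have k1 := pd_pd_nonneg_of_isLocalMin hO hhΩ hzΩ hloc 1
  rw [key] at k0 k1
  have := hl z hzΩ
  rw [lap_eq] at this
  linarith

/-! ### Nonnegative functions vanishing on the boundary -/

/-- The properties of each component of the solution which are used below. -/
structure Fn (Ω : Set E2) (w u : E2 → ℝ) : Prop where
  C2 : ContDiffOn ℝ 2 u Ω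
  cont : ContinuousOn u (closure Ω)
  zero : ∀ x ∈ frontier Ω, u x = 0
  nonneg : ∀ x ∈ closure Ω, 0 ≤ u x
  grad : ∃ M, ∀ x ∈ Ω, ∀ i, |pd i u x| ≤ M
  tend : ∀ x0 ∈ frontier Ω, ∃ l ≥ 0, ∀ i, Tendsto (pd i u) (𝓝[Ω] x0) (𝓝 (l * pd i w x0))

lemma GoodDom.fn {Ω : Set E2} {w : E2 → ℝ} (G : GoodDom Ω w) {u : E2 → ℝ}
    (hu : ContDiffOn ℝ 2 u (closure Ω)) (hl : ∀ x ∈ Ω, lap u x ≤ 0)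
    (hb : ∀ x ∈ frontier Ω, u x = 0) : Fn Ω w u := by
  have hO := G.isOpen
  have hnn := superharm_nonneg hO G.isCompact_closure hu hl hb
  refine ⟨hu.mono subset_closure, hu.continuousOn, hb, hnn, ?_, ?_⟩
  · obtain ⟨M, hM⟩ := grad_bdd_aux hO G.isCompact_closure hu
    exact ⟨M, fun x hx i => (abs_pd_le i u x).trans (hM x hx)⟩
  · intro x0 hx0
    obtain ⟨L, hL, hL2⟩ := reg_aux hO hu (frontier_subset_closure hx0)
    have hdir : ∀ d, 0 < fderiv ℝ w x0 d → 0 ≤ L d := by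
      intro d hd
      have hw : HasFDerivAt w (fderiv ℝ w x0) x0 :=
        ((G.smooth' 1).differentiable (by simp) x0).hasFDerivAt
      have h1 := eventually_neg_of_fderiv_neg hw.neg (d := d)
        (by simp [G.frontier_zero hx0]) (by simpa using hd)
      have hin : ∀ᶠ s : ℝ in 𝓝[>] 0, x0 + s • d ∈ closure Ω := by
        filter_upwards [h1] with s hs
        apply subset_closure
        rw [G.pos]; simpa using hs
      have h2 := hL2.lim (l := 𝓝[>] (0 : ℝ)) (c := fun s => s⁻¹) (d := fun s => s • d) (v := d)
        (by
          have h3 : Continuous fun s : ℝ => s • d := by fun_prop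
          have := (h3.tendsto 0).mono_left (nhdsWithin_le_nhds (s := Ioi 0))
          simpa using this) hin
        (by
          apply tendsto_const_nhds.congr'
          filter_upwards [self_mem_nhdsWithin] with s hs
          have hs' : (0 : ℝ) < s := hs
          simp only [smul_smul]; rw [inv_mul_cancel₀ hs'.ne', one_smul])
      apply ge_of_tendsto h2
      filter_upwards [hin, self_mem_nhdsWithin] with s hs hs0
      have hs' : (0 : ℝ) < s := hs0
      rw [hb x0 hx0, sub_zero, smul_eq_mul]
      exact mul_nonneg (by positivity) (hnn _ hs)
    set a0 := pd 0 w x0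
    set a1 := pd 1 w x0
    have ha : 0 < a0 ^ 2 + a1 ^ 2 := G.grad_pos hx0
    set L0 := L (ee 0)
    set L1 := L (ee 1)
    have hLd : ∀ d, L d = d 0 * L0 + d 1 * L1 := by
      intro d
      conv_lhs => rw [E2_decomp d]
      simp only [map_add, map_smul, smul_eq_mul]; rfl
    have hdir2 : ∀ p q : ℝ, 0 < p * a0 + q * a1 → 0 ≤ p * L0 + q * L1 := by
      intro p q h
      have := hdir (!₂[p, q]) (by rw [fderiv_eq_pd]; simpa using h)
      rw [hLd] at this
      simpa using this
    have hk := hdir2 a0 a1 (by nlinarith)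
    have ht1 : 0 ≤ -a1 * L0 + a0 * L1 := by
      apply le_of_forall_pos_le_add
      intro ε hε
      set η := ε / (a0 * L0 + a1 * L1 + 1)
      have hη : 0 < η := by positivity
      have := hdir2 (-a1 + η * a0) (a0 + η * a1) (by nlinarith [mul_pos hη ha])
      have h3 : η * (a0 * L0 + a1 * L1 + 1) = ε := by simp only [η]; field_simp
      nlinarith
    have ht2 : 0 ≤ a1 * L0 - a0 * L1 := by
      apply le_of_forall_pos_le_add
      intro ε hε
      set η := ε / (a0 * L0 + a1 * L1 + 1)
      have hη : 0 < η := by positivity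
      have := hdir2 (a1 + η * a0) (-a0 + η * a1) (by nlinarith [mul_pos hη ha])
      have h3 : η * (a0 * L0 + a1 * L1 + 1) = ε := by simp only [η]; field_simp
      nlinarith
    have ht : a1 * L0 = a0 * L1 := by linarith
    refine ⟨(a0 * L0 + a1 * L1) / (a0 ^ 2 + a1 ^ 2), by positivity, ?_⟩
    have hT : ∀ i, Tendsto (pd i u) (𝓝[Ω] x0) (𝓝 (L (ee i))) := by
      intro i
      have : Continuous fun L : E2 →L[ℝ] ℝ => L (ee i) := by fun_prop
      exact (this.tendsto L).comp hL
    intro i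
    convert hT i using 2
    fin_cases i
    · show (a0 * L0 + a1 * L1) / (a0 ^ 2 + a1 ^ 2) * a0 = L0
      field_simp; linear_combination (-a1) * ht
    · show (a0 * L0 + a1 * L1) / (a0 ^ 2 + a1 ^ 2) * a1 = L1
      field_simp; linear_combination a0 * ht



/-! ### Regularized logarithmic kernel -/

/-- smooth cutoff of `1/(2σ)` -/
def kap (s : ℝ) : ℝ := Real.smoothTransition (2 * s - 1) / (2 * s)

/-- primitive of `kap` -/
def Kf (s : ℝ) : ℝ := ∫ r in (1 : ℝ)..s, kap r

lemma kap_zero {s : ℝ} (hs : s ≤ 1 / 2) : kap s = 0 := by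
  unfold kap; rw [Real.smoothTransition.zero_of_nonpos (by linarith), zero_div]

lemma kap_one {s : ℝ} (hs : 1 ≤ s) : kap s = 1 / (2 * s) := by
  unfold kap; rw [Real.smoothTransition.one_of_one_le (by linarith)]

lemma kap_nonneg (s : ℝ) : 0 ≤ kap s := by
  by_cases h : s ≤ 1 / 2
  · rw [kap_zero h]
  · exact div_nonneg (Real.smoothTransition.nonneg _) (by linarith)

lemma kap_le {s : ℝ} (hs : 0 < s) : kap s ≤ 1 / (2 * s) := by
  unfold kap; gcongr; exact Real.smoothTransition.le_one _

lemma mul_kap (s : ℝ) : s * kap s = Real.smoothTransition (2 * s - 1) / 2 := by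
  by_cases h : s = 0
  · subst h; rw [Real.smoothTransition.zero_of_nonpos (by norm_num)]; simp
  · unfold kap; field_simp

lemma kap_contDiff (n : ℕ) : ContDiff ℝ n kap := by
  rw [contDiff_iff_contDiffAt]
  intro s
  by_cases h : s < 1 / 2
  · have : kap =ᶠ[𝓝 s] fun _ => 0 := by
      filter_upwards [Iio_mem_nhds h] with y hy
      exact kap_zero (le_of_lt hy)
    exact contDiffAt_const.congr_of_eventuallyEq this
  · unfold kap
    apply ContDiffAt.div
    · exact (Real.smoothTransition.contDiff.comp
        ((contDiff_const.mul contDiff_id).sub contDiff_const)).contDiffAt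
    · exact (contDiff_const.mul contDiff_id).contDiffAt
    · simp; linarith

lemma kap_cont : Continuous kap := (kap_contDiff 0).continuous

lemma Kf_hasDerivAt (s : ℝ) : HasDerivAt Kf (kap s) s :=
  intervalIntegral.integral_hasDerivAt_right (kap_cont.intervalIntegrable _ _)
    kap_cont.aestronglyMeasurable.stronglyMeasurableAtFilter kap_cont.continuousAt

lemma Kf_deriv : deriv Kf = kap := funext fun s => (Kf_hasDerivAt s).deriv

lemma Kf_contDiff : ContDiff ℝ 2 Kf := by
  rw [show (2 : WithTop ℕ∞) = 1 + 1 by norm_num, contDiff_succ_iff_deriv]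
  refine ⟨fun s => (Kf_hasDerivAt s).differentiableAt, by simp, ?_⟩
  rw [Kf_deriv]; exact kap_contDiff 1

lemma Kf_mono : Monotone Kf := by
  apply monotone_of_deriv_nonneg (fun s => (Kf_hasDerivAt s).differentiableAt)
  intro s; rw [Kf_deriv]; exact kap_nonneg s

lemma Kf_one : Kf 1 = 0 := by simp [Kf]

lemma Kf_const {s : ℝ} (hs : s ≤ 1 / 2) : Kf s = Kf (1 / 2) := by
  have h : Kf (1/2) - Kf s = ∫ r in s..(1/2), kap r := by
    unfold Kf
    exact intervalIntegral.integral_interval_sub_left (kap_cont.intervalIntegrable _ _)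
      (kap_cont.intervalIntegrable _ _)
  have h2 : ∫ r in s..(1/2), kap r = 0 := by
    rw [intervalIntegral.integral_congr (g := fun _ => (0:ℝ))]
    · simp
    · intro r hr
      rw [uIcc_of_le hs] at hr
      exact kap_zero hr.2
  linarith

/-- `½ log s - K(s)` is monotone -/
lemma Jf_mono : MonotoneOn (fun s => Real.log s / 2 - Kf s) (Ioi 0) := by
  have hd : ∀ s ∈ Ioi (0:ℝ), HasDerivAt (fun s => Real.log s / 2 - Kf s) (s⁻¹ / 2 - kap s) s :=
    fun s hs => ((Real.hasDerivAt_log (ne_of_gt hs)).div_const 2).sub (Kf_hasDerivAt s)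
  apply monotoneOn_of_deriv_nonneg (convex_Ioi 0)
  · exact fun s hs => (hd s hs).continuousAt.continuousWithinAt
  · rw [interior_Ioi]; exact fun s hs => (hd s hs).differentiableAt.differentiableWithinAt
  · rw [interior_Ioi]; intro s hs
    rw [(hd s hs).deriv]
    have h1 := kap_le hs
    have : 1 / (2 * s) = s⁻¹ / 2 := by
      have : s ≠ 0 := ne_of_gt hs
      field_simp
    linarith

lemma Kf_log {s : ℝ} (hs : 1 ≤ s) : Kf s = Real.log s / 2 := by
  have h1 : ∀ r ∈ Ioi (1:ℝ), HasDerivAt (fun s => Real.log s / 2 - Kf s) 0 r := by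
    intro r hr
    have hr1 : (1:ℝ) < r := hr
    have h0 : r ≠ 0 := by linarith
    have := ((Real.hasDerivAt_log h0).div_const 2).sub (Kf_hasDerivAt r)
    rw [kap_one hr1.le] at this
    have e : r⁻¹ / 2 - 1 / (2 * r) = 0 := by field_simp; ring
    rw [e] at this; exact this
  have hcd : ContinuousOn (fun s => Real.log s / 2 - Kf s) (Ici 1) := by
    intro r hr
    have hr1 : (1:ℝ) ≤ r := hr
    exact (((Real.hasDerivAt_log (by linarith)).div_const 2).sub
      (Kf_hasDerivAt r)).continuousAt.continuousWithinAt
  have anti : AntitoneOn (fun s => Real.log s / 2 - Kf s) (Ici 1) := by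
    apply antitoneOn_of_deriv_nonpos (convex_Ici 1) hcd
    · rw [interior_Ici]; exact fun s hs => (h1 s hs).differentiableAt.differentiableWithinAt
    · rw [interior_Ici]; intro s hs; rw [(h1 s hs).deriv]
  have a := anti self_mem_Ici hs hs
  have b := Jf_mono (show (1:ℝ) ∈ Ioi 0 by simp) (show s ∈ Ioi 0 from lt_of_lt_of_le one_pos hs) hs
  simp only [Kf_one, Real.log_one] at a b
  linarith

lemma Kf_ge_log {s : ℝ} (hs : 0 < s) : Real.log s / 2 ≤ Kf s := by
  rcases le_total s 1 with h | h
  · have := Jf_mono (show s ∈ Ioi 0 from hs) (show (1:ℝ) ∈ Ioi 0 by simp) h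
    simp only [Kf_one, Real.log_one] at this
    linarith
  · rw [Kf_log h]

/-- the squared norm, as a polynomial -/
def nsq (y : E2) : ℝ := y 0 * y 0 + y 1 * y 1

lemma nsq_eq (y : E2) : nsq y = ‖y‖ ^ 2 := by rw [E2_norm_sq]; unfold nsq; ring

lemma nsq_contDiff {n : WithTop ℕ∞} : ContDiff ℝ n nsq :=
  ((contDiff_coord 0).mul (contDiff_coord 0)).add ((contDiff_coord 1).mul (contDiff_coord 1))

lemma nsq_diff (y : E2) : DifferentiableAt ℝ nsq y :=
  (nsq_contDiff (n := 1)).differentiable (by simp) y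

lemma pd_nsq (i : Fin 2) (y : E2) : pd i nsq y = 2 * y i := by
  unfold nsq
  rw [pd_add (f := fun y : E2 => y 0 * y 0) (g := fun y : E2 => y 1 * y 1) i
      ((diff_coord 0 y).mul (diff_coord 0 y)) ((diff_coord 1 y).mul (diff_coord 1 y)),
    pd_mul i (diff_coord 0 y) (diff_coord 0 y), pd_mul i (diff_coord 1 y) (diff_coord 1 y),
    pd_coord, pd_coord]
  fin_cases i <;> simp <;> ring

/-- regularized logarithm -/
def lam (t : ℝ) (y : E2) : ℝ := Real.log t + Kf (nsq y / t ^ 2)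

/-- Laplacian of the regularized logarithm -/
def qt (t : ℝ) (y : E2) : ℝ := 4 / t ^ 2 * deriv Real.smoothTransition (2 * (nsq y / t ^ 2) - 1)

lemma lam_contDiff (t : ℝ) : ContDiff ℝ 2 (lam t) := by
  unfold lam
  exact contDiff_const.add (Kf_contDiff.comp (nsq_contDiff.div_const _))

lemma pd_div_const {f : E2 → ℝ} {x : E2} (i : Fin 2) (c : ℝ) (hf : DifferentiableAt ℝ f x) :
    pd i (fun y => f y / c) x = pd i f x / c := by
  simp_rw [div_eq_inv_mul]; exact pd_const_mul i _ hf

lemma pd_lam (t : ℝ) (i : Fin 2) (y : E2) : pd i (lam t) y = 2 / t ^ 2 * (y i * kap (nsq y / t ^ 2)) := by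
  unfold lam
  have hd : DifferentiableAt ℝ (fun y => nsq y / t ^ 2) y := by
    simp_rw [div_eq_mul_inv]; exact (nsq_diff y).mul_const _
  have hkk : DifferentiableAt ℝ (fun y => Kf (nsq y / t ^ 2)) y :=
    DifferentiableAt.fun_comp' (g := Kf) y (Kf_hasDerivAt _).differentiableAt hd
  rw [pd_add i (by fun_prop) hkk,
    pd_comp i (Kf_hasDerivAt _).differentiableAt hd, pd_div_const i _ (nsq_diff y), pd_nsq, Kf_deriv]
  simp [pd]; ring

lemma kap_deriv (s : ℝ) : kap s + s * deriv kap s = deriv Real.smoothTransition (2 * s - 1) := by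
  have hk : HasDerivAt kap (deriv kap s) s :=
    ((kap_contDiff 1).differentiable (by simp) s).hasDerivAt
  have h1 : HasDerivAt (fun s => s * kap s) (1 * kap s + s * deriv kap s) s :=
    (hasDerivAt_id s).mul hk
  have h2 : HasDerivAt (fun s => Real.smoothTransition (2 * s - 1) / 2)
      (deriv Real.smoothTransition (2 * s - 1) * 2 / 2) s := by
    have h3 : HasDerivAt (fun s : ℝ => 2 * s - 1) 2 s := by
      simpa using ((hasDerivAt_id s).const_mul 2).sub_const 1
    have h4 : HasDerivAt Real.smoothTransition (deriv Real.smoothTransition (2 * s - 1)) (2 * s - 1) :=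
      ((Real.smoothTransition.contDiff (n := 1)).differentiable (by simp) _).hasDerivAt
    exact (h4.comp s h3).div_const 2
  have h5 : (fun s => s * kap s) = fun s => Real.smoothTransition (2 * s - 1) / 2 :=
    funext mul_kap
  rw [h5] at h1
  have := h1.unique h2
  linarith

lemma pd_pd_lam (t : ℝ) (i : Fin 2) (y : E2) : pd i (pd i (lam t)) y =
    2 / t ^ 2 * (kap (nsq y / t ^ 2) + y i * (deriv kap (nsq y / t ^ 2) * (2 * y i / t ^ 2))) := by
  have e : pd i (lam t) = fun y => 2 / t ^ 2 * (y i * kap (nsq y / t ^ 2)) :=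
    funext fun y => pd_lam t i y
  have hd : DifferentiableAt ℝ (fun y => nsq y / t ^ 2) y := by
    simp_rw [div_eq_mul_inv]; exact (nsq_diff y).mul_const _
  have hk : DifferentiableAt ℝ kap (nsq y / t ^ 2) := (kap_contDiff 1).differentiable (by simp) _
  have hkc : DifferentiableAt ℝ (fun y => kap (nsq y / t ^ 2)) y :=
    DifferentiableAt.fun_comp' (g := kap) y hk hd
  rw [e, pd_const_mul i _ ((diff_coord i y).fun_mul hkc), pd_mul i (diff_coord i y) hkc, pd_comp i hk hd,
    pd_div_const i _ (nsq_diff y), pd_nsq, pd_coord]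
  simp; left; ring

lemma lap_lam {t : ℝ} (y : E2) :
    pd 0 (pd 0 (lam t)) y + pd 1 (pd 1 (lam t)) y = qt t y := by
  rw [pd_pd_lam, pd_pd_lam]; unfold qt
  rw [← kap_deriv]
  have : nsq y = y 0 * y 0 + y 1 * y 1 := rfl
  rw [this]; ring

lemma qt_nonneg (t : ℝ) (y : E2) : 0 ≤ qt t y :=
  mul_nonneg (by positivity) (sT_deriv_nonneg _)

lemma qt_cont (t : ℝ) : Continuous (qt t) := by
  unfold qt
  have := (nsq_contDiff (n := 0)).continuous
  exact continuous_const.mul (sT_deriv_cont.comp (by fun_prop))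

lemma qt_zero_of_gt {t : ℝ} (ht : 0 < t) {y : E2} (h : t < ‖y‖) : qt t y = 0 := by
  unfold qt
  rw [sT_deriv_zero_of_gt, mul_zero]
  rw [nsq_eq]
  have : 1 < ‖y‖ ^ 2 / t ^ 2 := by
    rw [one_lt_div (by positivity)]; gcongr
  linarith

lemma qt_zero_of_lt {t : ℝ} (ht : 0 < t) {y : E2} (h : 2 * ‖y‖ ^ 2 < t ^ 2) : qt t y = 0 := by
  unfold qt
  rw [sT_deriv_zero_of_neg, mul_zero]
  rw [nsq_eq]
  have : ‖y‖ ^ 2 / t ^ 2 < 1 / 2 := by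
    rw [div_lt_iff₀ (by positivity)]; linarith
  linarith

lemma qt_tsupport {t : ℝ} (ht : 0 < t) : tsupport (qt t) ⊆ closedBall 0 t := by
  apply closure_minimal _ isClosed_closedBall
  intro y hy
  by_contra h
  rw [mem_closedBall, dist_zero_right, not_le] at h
  exact hy (qt_zero_of_gt ht h)

lemma qt_cpt {t : ℝ} (ht : 0 < t) : HasCompactSupport (qt t) :=
  (isCompact_closedBall 0 t).of_isClosed_subset (isClosed_tsupport _) (qt_tsupport ht)

lemma qt_integrable {t : ℝ} (ht : 0 < t) : Integrable (qt t) :=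
  (qt_cont t).integrable_of_hasCompactSupport (qt_cpt ht)

lemma sT_deriv_bdd : ∃ M > 0, ∀ s, deriv Real.smoothTransition s ≤ M := by
  obtain ⟨M, hM⟩ := isCompact_Icc.exists_bound_of_continuousOn (s := Icc (0:ℝ) 1)
    sT_deriv_cont.continuousOn
  refine ⟨|M| + 1, by positivity, fun s => ?_⟩
  by_cases h : s ∈ Icc (0:ℝ) 1
  · have := hM s h
    rw [Real.norm_eq_abs] at this
    have := le_abs_self (deriv Real.smoothTransition s)
    have := le_abs_self M
    linarith
  · have : deriv Real.smoothTransition s = 0 := by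
      rw [mem_Icc, not_and_or, not_le, not_le] at h
      rcases h with h | h
      · exact sT_deriv_zero_of_neg h
      · exact sT_deriv_zero_of_gt h
    rw [this]; positivity

lemma vol_real_ball : (volume : Measure E2).real (ball 0 1) = π := by
  rw [measureReal_def, EuclideanSpace.volume_ball_fin_two]
  simp [pi_pos.le]

/-- radial integral -/
lemma radial_integral (f : ℝ → ℝ) : ∫ x : E2, f ‖x‖ = 2 * π * ∫ r in Ioi (0:ℝ), r * f r := by
  have := integral_fun_norm_addHaar (volume : Measure E2) f
  rw [this, vol_real_ball]
  simp [mul_assoc]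

lemma radial_integrable {f : ℝ → ℝ} :
    Integrable (fun x : E2 => f ‖x‖) ↔ IntegrableOn (fun r => r * f r) (Ioi 0) := by
  have := integrable_fun_norm_addHaar (volume : Measure E2) (f := f)
  rw [this]; simp

lemma qt_integral {t : ℝ} (ht : 0 < t) : ∫ y, qt t y = 2 * π := by
  set f : ℝ → ℝ := fun r => 4 / t ^ 2 * deriv Real.smoothTransition (2 * (r ^ 2 / t ^ 2) - 1) with hf
  have e : ∀ y, qt t y = f ‖y‖ := fun y => by unfold qt; rw [nsq_eq]
  simp_rw [e]
  rw [radial_integral]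
  have hd : ∀ r : ℝ, HasDerivAt (fun r : ℝ => Real.smoothTransition (2 * (r ^ 2 / t ^ 2) - 1))
      (r * f r) r := by
    intro r
    have h3 : HasDerivAt (fun r : ℝ => 2 * (r ^ 2 / t ^ 2) - 1) (2 * (2 * r / t ^ 2)) r := by
      have := ((((hasDerivAt_id r).pow 2).div_const (t ^ 2)).const_mul 2).sub_const 1
      simpa using this
    have h4 : HasDerivAt Real.smoothTransition
        (deriv Real.smoothTransition (2 * (r ^ 2 / t ^ 2) - 1)) (2 * (r ^ 2 / t ^ 2) - 1) :=
      ((Real.smoothTransition.contDiff (n := 1)).differentiable (by simp) _).hasDerivAt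
    have h5 := h4.comp r h3
    have e5 : deriv Real.smoothTransition (2 * (r ^ 2 / t ^ 2) - 1) * (2 * (2 * r / t ^ 2)) = r * f r := by
      simp only [hf]; ring
    rw [e5] at h5; exact h5
  have hlim : Tendsto (fun r : ℝ => Real.smoothTransition (2 * (r ^ 2 / t ^ 2) - 1)) atTop (𝓝 1) := by
    apply tendsto_const_nhds.congr'
    filter_upwards [eventually_ge_atTop t] with r hr
    symm
    apply Real.smoothTransition.one_of_one_le
    have : 1 ≤ r ^ 2 / t ^ 2 := by rw [one_le_div (by positivity)]; gcongr
    linarith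
  rw [integral_Ioi_of_hasDerivAt_of_nonneg' (a := 0) (fun r _ => hd r) _ hlim]
  · rw [Real.smoothTransition.zero_of_nonpos (by simp)]; ring
  · intro r hr
    have hr' : (0:ℝ) < r := hr
    have := sT_deriv_nonneg (2 * (r ^ 2 / t ^ 2) - 1)
    simp only [hf]; positivity

lemma lam_ge_log {t : ℝ} (ht : 0 < t) {y : E2} (hy : y ≠ 0) : Real.log ‖y‖ ≤ lam t y := by
  unfold lam
  have hn : 0 < ‖y‖ := norm_pos_iff.2 hy
  rw [nsq_eq]
  have := Kf_ge_log (s := ‖y‖ ^ 2 / t ^ 2) (by positivity)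
  rw [Real.log_div (by positivity) (by positivity), Real.log_pow, Real.log_pow] at this
  push_cast at this
  linarith

lemma lam_eq_log {t : ℝ} (ht : 0 < t) {y : E2} (hy : t ≤ ‖y‖) : lam t y = Real.log ‖y‖ := by
  unfold lam
  have hn : 0 < ‖y‖ := by linarith
  rw [nsq_eq, Kf_log (by rw [one_le_div (by positivity)]; gcongr),
    Real.log_div (by positivity) (by positivity), Real.log_pow, Real.log_pow]
  push_cast; ring

lemma lam_le {t R : ℝ} (ht : 0 < t) (htR : t ≤ R) {y : E2} (hy : ‖y‖ ≤ R) : lam t y ≤ Real.log R := by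
  unfold lam
  have h1 : Kf (nsq y / t ^ 2) ≤ Kf (R ^ 2 / t ^ 2) := by
    apply Kf_mono; rw [nsq_eq]; gcongr
  have hR : 0 < R := by linarith
  rw [Kf_log (s := R ^ 2 / t ^ 2) (by rw [one_le_div (by positivity)]; gcongr),
    Real.log_div (by positivity) (by positivity), Real.log_pow, Real.log_pow] at h1
  push_cast at h1; linarith

lemma lam_mono {t r : ℝ} (ht : 0 < t) (htr : t ≤ r) (y : E2) : lam t y ≤ lam r y := by
  have hr : 0 < r := by linarith
  by_cases hy : y = 0
  · subst hy
    unfold lam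
    have : nsq 0 = 0 := by simp [nsq]
    rw [this]; simp
    exact Real.log_le_log ht htr
  · have hn : 0 < ‖y‖ := norm_pos_iff.2 hy
    have h := Jf_mono (show ‖y‖ ^ 2 / r ^ 2 ∈ Ioi (0:ℝ) by rw [mem_Ioi]; positivity)
      (show ‖y‖ ^ 2 / t ^ 2 ∈ Ioi (0:ℝ) by rw [mem_Ioi]; positivity) (by gcongr)
    simp only at h
    rw [Real.log_div (by positivity) (by positivity), Real.log_div (by positivity) (by positivity),
      Real.log_pow, Real.log_pow, Real.log_pow] at h
    unfold lam
    rw [nsq_eq]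
    push_cast at h; linarith

lemma lam_inner {t r : ℝ} (ht : 0 < t) (htr : t ≤ r) {y : E2} (hy : 2 * ‖y‖ ^ 2 ≤ t ^ 2) :
    lam r y - lam t y = Real.log (r / t) := by
  have hr : 0 < r := by linarith
  have h1 : nsq y / t ^ 2 ≤ 1 / 2 := by
    rw [nsq_eq, div_le_iff₀ (by positivity)]; linarith
  have h2 : nsq y / r ^ 2 ≤ 1 / 2 := by
    rw [nsq_eq, div_le_iff₀ (by positivity)]
    have : t ^ 2 ≤ r ^ 2 := by gcongr
    linarith
  unfold lam
  rw [Kf_const h1, Kf_const h2, Real.log_div (by positivity) (by positivity)]; ring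

lemma abs_pd_lam_le {t : ℝ} (ht : 0 < t) (i : Fin 2) (y : E2) : |pd i (lam t) y| ≤ ‖y‖⁻¹ := by
  rw [pd_lam]
  by_cases hy : y = 0
  · subst hy; simp
  have hn : 0 < ‖y‖ := norm_pos_iff.2 hy
  have h1 : |y i| ≤ ‖y‖ := by
    have := PiLp.norm_apply_le y i; simpa using this
  have h2 := kap_le (s := nsq y / t ^ 2) (by rw [nsq_eq]; positivity)
  have h3 := kap_nonneg (nsq y / t ^ 2)
  rw [abs_mul, abs_mul, abs_of_nonneg h3, abs_of_nonneg (by positivity)]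
  calc 2 / t ^ 2 * (|y i| * kap (nsq y / t ^ 2)) ≤ 2 / t ^ 2 * (‖y‖ * (1 / (2 * (nsq y / t ^ 2)))) := by
        gcongr
    _ = ‖y‖⁻¹ := by rw [nsq_eq]; field_simp

lemma pd_lam_eq {t : ℝ} (ht : 0 < t) (i : Fin 2) {y : E2} (hy : t ≤ ‖y‖) :
    pd i (lam t) y = y i / ‖y‖ ^ 2 := by
  rw [pd_lam, nsq_eq, kap_one (by rw [one_le_div (by positivity)]; gcongr)]
  have : 0 < ‖y‖ := by linarith
  field_simp

lemma pd_translate (i : Fin 2) (f : E2 → ℝ) (x y : E2) : pd i (fun z => f (z - x)) y = pd i f (y - x) := by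
  unfold pd; rw [fderiv_comp_sub]



/-! ### Single equation: potential estimate and interior mass -/

/-- one equation of the system -/
structure Sol1 (Ω : Set E2) (w u f : E2 → ℝ) : Prop extends Fn Ω w u where
  eq : ∀ x ∈ Ω, lap u x = - f x
  fc : ContinuousOn f Ω
  f0 : ∀ x ∈ Ω, 0 ≤ f x
  fb : ∃ M, ∀ x ∈ Ω, f x ≤ M

lemma Fn.bdd {Ω : Set E2} {w u : E2 → ℝ} (G : GoodDom Ω w) (S : Fn Ω w u) :
    ∃ M, ∀ x ∈ Ω, |u x| ≤ M := by
  obtain ⟨M, hM⟩ := G.isCompact_closure.exists_bound_of_continuousOn S.cont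
  exact ⟨M, fun x hx => hM x (subset_closure hx)⟩

lemma Fn.tend0 {Ω : Set E2} {w u : E2 → ℝ} (S : Fn Ω w u) {x0 : E2} (hx : x0 ∈ frontier Ω) :
    Tendsto u (𝓝[Ω] x0) (𝓝 0) := by
  have := (S.cont x0 (frontier_subset_closure hx)).tendsto
  rw [S.zero x0 hx] at this
  exact this.mono_left (nhdsWithin_mono _ subset_closure)

lemma Sol1.f_bdd {Ω : Set E2} {w u f : E2 → ℝ} (S : Sol1 Ω w u f) : ∃ M, ∀ x ∈ Ω, |f x| ≤ M := by
  obtain ⟨M, hM⟩ := S.fb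
  exact ⟨M, fun x hx => by rw [abs_of_nonneg (S.f0 x hx)]; exact hM x hx⟩

lemma Sol1.f_int {Ω : Set E2} {w u f : E2 → ℝ} (G : GoodDom Ω w) (S : Sol1 Ω w u f) :
    IntegrableOn f Ω := by
  obtain ⟨M, hM⟩ := S.f_bdd
  exact G.integrableOn_of_bounded S.fc hM

lemma Sol1.exp_int {Ω : Set E2} {w u : E2 → ℝ} (G : GoodDom Ω w) (S : Fn Ω w u) (p : ℝ) :
    IntegrableOn (fun x => Real.exp (p * u x)) Ω := by
  obtain ⟨M, hM⟩ := S.bdd G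
  apply G.integrableOn_of_bounded (M := Real.exp (|p| * M))
  · exact Real.continuous_exp.comp_continuousOn (continuousOn_const.mul (S.cont.mono subset_closure))
  · intro x hx
    rw [abs_of_nonneg (Real.exp_pos _).le, Real.exp_le_exp]
    calc p * u x ≤ |p * u x| := le_abs_self _
      _ = |p| * |u x| := abs_mul _ _
      _ ≤ |p| * M := by gcongr; exact hM x hx

/-- Integrability of powers. -/
lemma rpow_integral {a R : ℝ} (ha : a < 2) (hR : 0 < R) :
    IntegrableOn (fun y : E2 => ‖y‖ ^ (-a)) (ball 0 R) ∧
    ∫ y in ball (0:E2) R, ‖y‖ ^ (-a) = 2 * π * (R ^ (2 - a) / (2 - a)) := by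
  set f : ℝ → ℝ := (Iio R).indicator (fun r => r ^ (-a)) with hf
  have e : (fun y : E2 => f ‖y‖) = (ball (0:E2) R).indicator (fun y => ‖y‖ ^ (-a)) := by
    ext y
    simp only [hf, indicator, mem_Iio, mem_ball, dist_zero_right]
  have e2 : ∀ r ∈ Ioi (0:ℝ), r * f r = (Iio R).indicator (fun r => r ^ (1 - a)) r := by
    intro r hr
    have hr' : (0:ℝ) < r := hr
    simp only [hf, indicator]
    split_ifs
    · rw [sub_eq_add_neg, Real.rpow_add hr', Real.rpow_one]
    · simp
  have hI : IntervalIntegrable (fun r : ℝ => r ^ (1 - a)) volume 0 R :=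
    intervalIntegral.intervalIntegrable_rpow' (by linarith)
  have hI2 : IntegrableOn (fun r : ℝ => r ^ (1 - a)) (Ioo 0 R) :=
    ((intervalIntegrable_iff_integrableOn_Ioc_of_le hR.le).1 hI).mono_set Ioo_subset_Ioc_self
  have h1 : IntegrableOn (fun r => r * f r) (Ioi 0) := by
    rw [integrableOn_congr_fun e2 measurableSet_Ioi, IntegrableOn, integrable_indicator_iff measurableSet_Iio,
      IntegrableOn, Measure.restrict_restrict measurableSet_Iio]
    have : Iio R ∩ Ioi 0 = Ioo 0 R := by ext; simp [and_comm]
    rw [this]; exact hI2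
  constructor
  · rw [← integrable_indicator_iff measurableSet_ball, ← e]
    exact radial_integrable.2 h1
  · rw [← integral_indicator measurableSet_ball, ← e, radial_integral,
      setIntegral_congr_fun measurableSet_Ioi e2, setIntegral_indicator measurableSet_Iio]
    have : Ioi 0 ∩ Iio R = Ioo 0 R := rfl
    rw [this, ← integral_Ioc_eq_integral_Ioo, ← intervalIntegral.integral_of_le hR.le,
      integral_rpow (Or.inl (by linarith)), Real.zero_rpow (by linarith)]
    have : 1 - a + 1 = 2 - a := by ring
    rw [this, sub_zero]

lemma rpow_integral' {a R : ℝ} (ha : a < 2) (hR : 0 < R) (x : E2) :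
    IntegrableOn (fun y : E2 => ‖y - x‖ ^ (-a)) (ball x R) ∧
    ∫ y in ball x R, ‖y - x‖ ^ (-a) = 2 * π * (R ^ (2 - a) / (2 - a)) := by
  obtain ⟨h1, h2⟩ := rpow_integral ha hR
  have e : (fun y : E2 => (ball x R).indicator (fun y => ‖y - x‖ ^ (-a)) y) =
      fun y => (ball (0:E2) R).indicator (fun y => ‖y‖ ^ (-a)) (y - x) := by
    ext y
    simp only [indicator, mem_ball, dist_eq_norm, sub_zero]
  constructor
  · rw [← integrable_indicator_iff measurableSet_ball]
    rw [← integrable_indicator_iff measurableSet_ball] at h1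
    have := h1.comp_sub_right x
    have e' : (ball x R).indicator (fun y => ‖y - x‖ ^ (-a)) =
      fun y => (ball (0:E2) R).indicator (fun y => ‖y‖ ^ (-a)) (y - x) := e
    rw [e']; exact this
  · rw [← h2, ← integral_indicator measurableSet_ball, ← integral_indicator measurableSet_ball]
    have := integral_sub_right_eq_self (μ := volume)
      ((ball (0:E2) R).indicator (fun y : E2 => ‖y‖ ^ (-a))) x
    rw [← this]; exact congrArg _ e

/-- pointwise control of the logarithm by a power -/
lemma log_bound {R r : ℝ} (hR : 0 < R) (hr : 0 < r) (hrR : r ≤ R) :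
    0 ≤ Real.log (R / r) ∧ Real.log (R / r) ≤ R * r ^ (-1 : ℝ) := by
  have h1 : 1 ≤ R / r := by rw [one_le_div hr]; exact hrR
  refine ⟨Real.log_nonneg h1, ?_⟩
  rw [Real.rpow_neg_one, ← div_eq_mul_inv]
  have := Real.log_le_sub_one_of_pos (show 0 < R / r by positivity)
  linarith

lemma ae_ne' (x : E2) : ∀ᵐ y : E2, y ≠ x := by
  have : (volume : Measure E2) {x} = 0 := measure_singleton x
  exact measure_eq_zero_iff_ae_notMem.1 this

lemma log_int {Ω : Set E2} {w f : E2 → ℝ} (G : GoodDom Ω w) {R : ℝ} (hR : 0 < R) {x : E2}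
    (hxR : ∀ y ∈ Ω, ‖y - x‖ ≤ R) (hf : ContinuousOn f Ω) {M : ℝ} (hM : ∀ y ∈ Ω, |f y| ≤ M) :
    IntegrableOn (fun y => Real.log (R / ‖y - x‖) * f y) Ω := by
  have hsub : Ω ⊆ ball x (R + 1) := fun y hy => by
    rw [mem_ball, dist_eq_norm]; linarith [hxR y hy]
  have h1 := ((rpow_integral' (a := 1) (by norm_num) (show 0 < R + 1 by linarith) x).1.mono_set hsub)
  have h2 := (h1.const_mul R).mul_const (|M|)
  apply Integrable.mono' h2
  · apply AEStronglyMeasurable.mul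
    · apply Measurable.aestronglyMeasurable
      fun_prop
    · exact hf.aestronglyMeasurable G.measurable
  · have := ae_restrict_of_ae (s := Ω) (ae_ne' x)
    filter_upwards [ae_restrict_mem G.measurable, this] with y hy hne
    have hp : 0 < ‖y - x‖ := norm_pos_iff.2 (sub_ne_zero.2 hne)
    obtain ⟨a, b⟩ := log_bound hR hp (hxR y hy)
    rw [norm_mul, Real.norm_of_nonneg a, Real.norm_eq_abs]
    apply mul_le_mul b ((hM y hy).trans (le_abs_self M)) (abs_nonneg _) (a.trans b)

lemma pot_aux {Ω : Set E2} {w u f : E2 → ℝ} (G : GoodDom Ω w) (S : Sol1 Ω w u f)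
    {φ : E2 → ℝ} (hφ : ContDiff ℝ 2 φ) (h0 : ∀ y ∈ closure Ω, 0 ≤ φ y) :
    ∫ x in Ω, -(u x * (pd 0 (pd 0 φ) x + pd 1 (pd 1 φ) x)) ≤ ∫ x in Ω, φ x * f x := by
  have hO := G.isOpen
  obtain ⟨Mu, hMu⟩ := S.bdd G
  obtain ⟨Mf, hMf⟩ := S.f_bdd
  have hp1 : ∀ i, ContDiff ℝ 1 (pd i φ) := fun i => contDiff_pd hφ (by norm_num) i
  have hlc : Continuous (fun x => pd 0 (pd 0 φ) x + pd 1 (pd 1 φ) x) :=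
    ((contDiff_pd (hp1 0) (m := 0) (by simp) 0).continuous).add
      ((contDiff_pd (hp1 1) (m := 0) (by simp) 1).continuous)
  obtain ⟨Ml, hMl⟩ := G.isCompact_closure.exists_bound_of_continuousOn hlc.continuousOn
  obtain ⟨Mφ, hMφ⟩ := G.isCompact_closure.exists_bound_of_continuousOn hφ.continuous.continuousOn
  have hu1 : ContDiffOn ℝ 1 u Ω := S.C2.of_le (by norm_num)
  have hpu : ∀ i, ContDiffOn ℝ 1 (pd i u) Ω := fun i => contDiffOn_pd hO S.C2 (by norm_num) i
  have hφ1 : ContDiff ℝ 1 φ := hφ.of_le (by norm_num)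
  have hF : ∀ i, ContDiffOn ℝ 1 (fun x => φ x * pd i u x - u x * pd i φ x) Ω := fun i =>
    (hφ1.contDiffOn.mul (hpu i)).sub (hu1.mul (hp1 i).contDiffOn)
  have hdF : ∀ i, ∀ x ∈ Ω, pd i (fun x => φ x * pd i u x - u x * pd i φ x) x =
      φ x * pd i (pd i u) x - u x * pd i (pd i φ) x := by
    intro i x hx
    have d1 : DifferentiableAt ℝ φ x := hφ1.differentiable (by simp) x
    have d2 : DifferentiableAt ℝ (pd i φ) x := (hp1 i).differentiable (by simp) x
    have d3 : DifferentiableAt ℝ u x := (hu1.differentiableOn (by simp)).differentiableAt (hO.mem_nhds hx)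
    have d4 : DifferentiableAt ℝ (pd i u) x :=
      ((hpu i).differentiableOn (by simp)).differentiableAt (hO.mem_nhds hx)
    rw [pd_sub i (d1.fun_mul d4) (d3.fun_mul d2), pd_mul i d1 d4, pd_mul i d3 d2]; ring
  have hdiv : ∀ x ∈ Ω, pd 0 (fun x => φ x * pd 0 u x - u x * pd 0 φ x) x +
      pd 1 (fun x => φ x * pd 1 u x - u x * pd 1 φ x) x =
      -(u x * (pd 0 (pd 0 φ) x + pd 1 (pd 1 φ) x)) - φ x * f x := by
    intro x hx
    rw [hdF 0 x hx, hdF 1 x hx]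
    have := S.eq x hx
    rw [lap_eq] at this
    linear_combination (φ x) * this
  have b1 : ∀ x ∈ Ω, |-(u x * (pd 0 (pd 0 φ) x + pd 1 (pd 1 φ) x))| ≤ Mu * Ml := fun x hx => by
    rw [abs_neg, abs_mul]
    exact mul_le_mul (hMu x hx) (hMl x (subset_closure hx)) (abs_nonneg _)
      ((abs_nonneg _).trans (hMu x hx))
  have b2 : ∀ x ∈ Ω, |φ x * f x| ≤ Mφ * Mf := fun x hx => by
    rw [abs_mul]
    exact mul_le_mul (hMφ x (subset_closure hx)) (hMf x hx) (abs_nonneg _)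
      ((abs_nonneg _).trans (hMφ x (subset_closure hx)))
  have key := G.div_le (hF 0) (hF 1) (M := Mu * Ml + Mφ * Mf) (by
    intro x hx
    rw [hdiv x hx]
    exact (abs_sub _ _).trans (add_le_add (b1 x hx) (b2 x hx))) (by
    intro x0 hx0 ε hε
    obtain ⟨l, hl, hlt⟩ := S.tend x0 hx0
    have hu0 := S.tend0 hx0
    have cw : ∀ {h : E2 → ℝ}, Continuous h → Tendsto h (𝓝[Ω] x0) (𝓝 (h x0)) := fun hh =>
      (hh.tendsto x0).mono_left nhdsWithin_le_nhds
    have hl := (((cw hφ.continuous).mul (hlt 0)).sub (hu0.mul (cw (hp1 0).continuous))).mul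
      (cw (G.cont_pd 0)) |>.add ((((cw hφ.continuous).mul (hlt 1)).sub
      (hu0.mul (cw (hp1 1).continuous))).mul (cw (G.cont_pd 1)))
    apply hl.eventually_const_le
    have := h0 x0 (frontier_subset_closure hx0)
    have h3 : 0 ≤ φ x0 * l * (pd 0 w x0 ^ 2 + pd 1 w x0 ^ 2) := by positivity
    nlinarith)
  rw [setIntegral_congr_fun G.measurable hdiv, integral_sub] at key
  · linarith
  · apply G.integrableOn_of_bounded _ b1
    exact ((S.cont.mono subset_closure).mul hlc.continuousOn).neg
  · apply G.integrableOn_of_bounded _ b2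
    exact hφ.continuous.continuousOn.mul S.fc

lemma lamx_contDiff (t : ℝ) (x : E2) : ContDiff ℝ 2 (fun y => lam t (y - x)) :=
  (lam_contDiff t).comp (contDiff_id.sub contDiff_const)

lemma pd_pd_lamx (t : ℝ) (x : E2) (i : Fin 2) (y : E2) :
    pd i (pd i (fun y => lam t (y - x))) y = pd i (pd i (lam t)) (y - x) := by
  have : pd i (fun y => lam t (y - x)) = fun y => pd i (lam t) (y - x) :=
    funext fun y => pd_translate i _ x y
  rw [this, pd_translate]

lemma qtx_integral {t : ℝ} (ht : 0 < t) (x : E2) : ∫ y, qt t (y - x) = 2 * π := by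
  rw [integral_sub_right_eq_self (qt t) x, qt_integral ht]

lemma qtx_integrable {t : ℝ} (ht : 0 < t) (x : E2) : Integrable (fun y => qt t (y - x)) :=
  (qt_integrable ht).comp_sub_right x

/-- integrals against `q_t` over a set containing the ball -/
lemma qtx_mul_integrable {t : ℝ} (ht : 0 < t) (x : E2) {Ω : Set E2} (hO : IsOpen Ω)
    (hB : closedBall x t ⊆ Ω) {h : E2 → ℝ} (hh : ContinuousOn h Ω) :
    Integrable (fun y => qt t (y - x) * h y) ∧
    ∫ y, qt t (y - x) * h y = ∫ y in Ω, qt t (y - x) * h y := by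
  have hs : tsupport (fun y => qt t (y - x)) ⊆ closedBall x t := by
    apply closure_minimal _ isClosed_closedBall
    intro y hy
    by_contra hc
    rw [mem_closedBall, dist_eq_norm, not_le] at hc
    exact hy (qt_zero_of_gt ht hc)
  refine ⟨integrable_mul_of_tsupport hO ((qt_cont t).comp (continuous_id.sub continuous_const))
    ((isCompact_closedBall x t).of_isClosed_subset (isClosed_tsupport _) hs) (hs.trans hB) hh, ?_⟩
  exact integral_eq_setIntegral_of_tsupport (hs.trans hB)

/-- Upper potential estimate. -/
lemma Sol1.pot {Ω : Set E2} {w u f : E2 → ℝ} (G : GoodDom Ω w) (S : Sol1 Ω w u f) {R : ℝ}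
    (hR : 0 < R) (hd : ∀ x ∈ Ω, ∀ y ∈ closure Ω, ‖y - x‖ ≤ R) {x : E2} (hx : x ∈ Ω) :
    2 * π * u x ≤ ∫ y in Ω, Real.log (R / ‖y - x‖) * f y := by
  have hO := G.isOpen
  obtain ⟨Mf, hMf⟩ := S.f_bdd
  have hIntg := log_int G hR (x := x) (fun y hy => hd x hx y (subset_closure hy)) S.fc hMf
  apply le_of_forall_pos_le_add
  intro ε hε
  have hcx : ContinuousAt u x := (S.cont.mono subset_closure).continuousAt (hO.mem_nhds hx)
  have h1 : ∀ᶠ y in 𝓝 x, u x - ε / (2 * π) < u y :=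
    hcx.eventually (lt_mem_nhds (by have : 0 < ε / (2 * π) := by positivity
                                    linarith))
  obtain ⟨δ, hδ, hδ2⟩ := Metric.eventually_nhds_iff_ball.1 (h1.and (hO.mem_nhds hx))
  set t := min (δ / 2) R with ht
  have ht0 : 0 < t := lt_min (by linarith) hR
  have htR : t ≤ R := min_le_right _ _
  have htδ : t < δ := lt_of_le_of_lt (min_le_left _ _) (by linarith)
  have hB : closedBall x t ⊆ Ω := fun y hy => (hδ2 y (closedBall_subset_ball htδ hy)).2
  have hφ : ContDiff ℝ 2 (fun y => Real.log R - lam t (y - x)) :=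
    contDiff_const.sub (lamx_contDiff t x)
  have hlapφ : ∀ y, -(u y * (pd 0 (pd 0 (fun y => Real.log R - lam t (y - x))) y +
      pd 1 (pd 1 (fun y => Real.log R - lam t (y - x))) y)) = qt t (y - x) * u y := by
    intro y
    have e : ∀ i, pd i (pd i (fun y => Real.log R - lam t (y - x))) y =
        - pd i (pd i (lam t)) (y - x) := by
      intro i
      have e1 : pd i (fun y => Real.log R - lam t (y - x)) =
          fun y => (-1) * pd i (fun y => lam t (y - x)) y := by
        ext z
        rw [pd_sub i (by fun_prop) ((lamx_contDiff t x).differentiable (by simp) z)]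
        simp [pd]
      rw [e1, pd_const_mul i _ ((contDiff_pd (lamx_contDiff t x) (m := 1) (by norm_num) i).differentiable
        (by simp) y), pd_pd_lamx]; ring
    rw [e, e, ← lap_lam]; ring
  have key := pot_aux G S hφ (fun y hy => by
    have := lam_le ht0 htR (hd x hx y hy); linarith)
  simp_rw [hlapφ] at key
  obtain ⟨iq, eq⟩ := qtx_mul_integrable ht0 x hO hB (S.cont.mono subset_closure)
  rw [← eq] at key
  have low : 2 * π * u x - ε ≤ ∫ y, qt t (y - x) * u y := by
    calc 2 * π * u x - ε = ∫ y, qt t (y - x) * (u x - ε / (2 * π)) := by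
          rw [integral_mul_const, qtx_integral ht0]; field_simp
      _ ≤ _ := by
          apply integral_mono ((qtx_integrable ht0 x).mul_const _) iq
          intro y
          simp only
          by_cases hy : ‖y - x‖ ≤ t
          · apply mul_le_mul_of_nonneg_left _ (qt_nonneg _ _)
            exact (hδ2 y (by rw [mem_ball, dist_eq_norm]; linarith)).1.le
          · rw [qt_zero_of_gt ht0 (not_le.1 hy)]; simp
  have up : ∫ y in Ω, (Real.log R - lam t (y - x)) * f y ≤ ∫ y in Ω, Real.log (R / ‖y - x‖) * f y := by
    apply setIntegral_mono_on_ae _ hIntg G.measurable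
    · filter_upwards [ae_ne' x] with y hne hy
      have hp : 0 < ‖y - x‖ := norm_pos_iff.2 (sub_ne_zero.2 hne)
      apply mul_le_mul_of_nonneg_right _ (S.f0 y hy)
      rw [Real.log_div hR.ne' hp.ne']
      have := lam_ge_log ht0 (sub_ne_zero.2 hne)
      linarith
    · obtain ⟨Mφ, hMφ⟩ := G.isCompact_closure.exists_bound_of_continuousOn hφ.continuous.continuousOn
      apply G.integrableOn_of_bounded (hφ.continuous.continuousOn.mul S.fc) (M := Mφ * Mf)
      intro y hy
      rw [Pi.mul_apply, abs_mul]
      exact mul_le_mul (hMφ y (subset_closure hy)) (hMf y hy) (abs_nonneg _)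
        ((abs_nonneg _).trans (hMφ y (subset_closure hy)))
  linarith



/-! ### Interior mass bound -/

lemma int_pot {Ω : Set E2} {w u f : E2 → ℝ} (G : GoodDom Ω w) (S : Sol1 Ω w u f) {x0 : E2}
    {ρ t s : ℝ} (hB : closedBall x0 ρ ⊆ Ω) (ht : 0 < t) (htρ : t ≤ ρ) (hs : 0 < s)
    (hst : 2 * s ^ 2 ≤ t ^ 2) :
    Real.log (ρ / t) * (∫ y in ball x0 s, f y) ≤ ∫ y, qt t (y - x0) * u y := by
  have hO := G.isOpen
  have hρ : 0 < ρ := by linarith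
  have hsρ : s ≤ ρ := by nlinarith
  set φ : E2 → ℝ := fun y => lam ρ (y - x0) - lam t (y - x0) with hφd
  have hφ : ContDiff ℝ 2 φ := (lamx_contDiff ρ x0).sub (lamx_contDiff t x0)
  have hφ0 : ∀ y, 0 ≤ φ y := fun y => by
    have := lam_mono ht htρ (y - x0); simp only [hφd]; linarith
  have hts : tsupport φ ⊆ closedBall x0 ρ := by
    apply closure_minimal _ isClosed_closedBall
    intro y hy
    by_contra hc
    rw [mem_closedBall, dist_eq_norm, not_le] at hc
    apply hy
    simp only [hφd]
    rw [lam_eq_log hρ hc.le, lam_eq_log ht (by linarith), sub_self]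
  have hcs : HasCompactSupport φ :=
    (isCompact_closedBall x0 ρ).of_isClosed_subset (isClosed_tsupport _) hts
  have hg := fun i => green hO hφ hcs (hts.trans hB) S.C2 i
  have ppd : ∀ i, ContDiffOn ℝ 0 (pd i (pd i u)) Ω := fun i =>
    contDiffOn_pd hO (contDiffOn_pd hO S.C2 (m := 1) (by norm_num) i) (by norm_num) i
  have ppφ : ∀ i, ContDiff ℝ 0 (pd i (pd i φ)) := fun i =>
    contDiff_pd (contDiff_pd hφ (m := 1) (by norm_num) i) (by norm_num) i
  have hd1 : ∀ i y, pd i (pd i φ) y = pd i (pd i (lam ρ)) (y - x0) - pd i (pd i (lam t)) (y - x0) := by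
    intro i y
    have e1 : pd i φ = fun y => pd i (fun y => lam ρ (y - x0)) y - pd i (fun y => lam t (y - x0)) y := by
      ext z
      exact pd_sub i ((lamx_contDiff ρ x0).differentiable (by simp) z)
        ((lamx_contDiff t x0).differentiable (by simp) z)
    rw [e1, pd_sub i ((contDiff_pd (lamx_contDiff ρ x0) (m := 1) (by norm_num) i).differentiable
        (by simp) y) ((contDiff_pd (lamx_contDiff t x0) (m := 1) (by norm_num) i).differentiable
        (by simp) y), pd_pd_lamx, pd_pd_lamx]
  have I1 : ∀ i, Integrable (fun y => φ y * pd i (pd i u) y) := fun i =>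
    integrable_mul_of_tsupport hO hφ.continuous hcs (hts.trans hB) (ppd i).continuousOn
  have I2 : ∀ i, Integrable (fun y => pd i (pd i φ) y * u y) := fun i =>
    integrable_mul_of_tsupport hO (ppφ i).continuous
      (hasCompactSupport_pd i (hasCompactSupport_pd i hcs))
      (((tsupport_pd_subset i _).trans (tsupport_pd_subset i _)).trans (hts.trans hB))
      (S.cont.mono subset_closure)
  have If : Integrable (fun y => φ y * f y) :=
    integrable_mul_of_tsupport hO hφ.continuous hcs (hts.trans hB) S.fc
  obtain ⟨Iρ, -⟩ := qtx_mul_integrable hρ x0 hO hB (S.cont.mono subset_closure)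
  obtain ⟨It, -⟩ := qtx_mul_integrable ht x0 hO ((closedBall_subset_closedBall htρ).trans hB)
    (S.cont.mono subset_closure)
  have key : ∫ y, qt t (y - x0) * u y = (∫ y, qt ρ (y - x0) * u y) + ∫ y, φ y * f y := by
    have a1 : ∫ y, (φ y * pd 0 (pd 0 u) y + φ y * pd 1 (pd 1 u) y) = ∫ y, -(φ y * f y) := by
      congr 1; ext y
      by_cases hy : y ∈ Ω
      · have := S.eq y hy
        rw [lap_eq] at this
        rw [← mul_add, this]; ring
      · have : φ y = 0 := by
          by_contra h; exact hy (hB (hts (subset_tsupport φ h)))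
        simp [this]
    have a2 : ∫ y, (pd 0 (pd 0 φ) y * u y + pd 1 (pd 1 φ) y * u y) =
        ∫ y, (qt ρ (y - x0) * u y - qt t (y - x0) * u y) := by
      congr 1; ext y
      rw [hd1, hd1, ← lap_lam, ← lap_lam]; ring
    rw [integral_add (I1 0) (I1 1), hg 0, hg 1, ← integral_add (I2 0) (I2 1), a2,
      integral_sub Iρ It, integral_neg] at a1
    linarith
  have u0 : ∀ y ∈ Ω, 0 ≤ u y := fun y hy => S.nonneg y (subset_closure hy)
  have p1 : 0 ≤ ∫ y, qt ρ (y - x0) * u y := by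
    apply integral_nonneg
    intro y
    by_cases hy : y ∈ Ω
    · exact mul_nonneg (qt_nonneg _ _) (u0 y hy)
    · have : ρ < ‖y - x0‖ := by
        by_contra hc
        apply hy; apply hB; rw [mem_closedBall, dist_eq_norm]; linarith
      simp [qt_zero_of_gt hρ this]
  have p2 : Real.log (ρ / t) * (∫ y in ball x0 s, f y) ≤ ∫ y, φ y * f y := by
    rw [← integral_const_mul]
    have e : ∫ y in ball x0 s, Real.log (ρ / t) * f y = ∫ y in ball x0 s, φ y * f y := by
      apply setIntegral_congr_fun measurableSet_ball
      intro y hy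
      simp only [hφd]
      rw [mem_ball, dist_eq_norm] at hy
      rw [lam_inner ht htρ]
      nlinarith [norm_nonneg (y - x0)]
    rw [e]
    apply setIntegral_le_integral If
    filter_upwards with y
    by_cases hy : y ∈ Ω
    · exact mul_nonneg (hφ0 y) (S.f0 y hy)
    · have : φ y = 0 := by
        by_contra h; exact hy (hB (hts (subset_tsupport φ h)))
      simp [this]
  linarith

lemma int_exp {Ω : Set E2} {w u : E2 → ℝ} (G : GoodDom Ω w) (S : Fn Ω w u) {x0 : E2}
    {t a : ℝ} (hB : closedBall x0 t ⊆ Ω) (ht : 0 < t)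
    (ha : 2 * π * a ≤ ∫ y, qt t (y - x0) * u y) :
    2 * π * Real.exp a ≤ ∫ y, qt t (y - x0) * Real.exp (u y) := by
  have hO := G.isOpen
  have hc : ContinuousOn u Ω := S.cont.mono subset_closure
  obtain ⟨It, -⟩ := qtx_mul_integrable ht x0 hO hB hc
  obtain ⟨Ie, -⟩ := qtx_mul_integrable ht x0 hO hB (Real.continuous_exp.comp_continuousOn hc)
  have Iq := qtx_integrable ht x0
  have h1 : ∫ y, (Real.exp a * (1 - a) * qt t (y - x0) + Real.exp a * (qt t (y - x0) * u y)) ≤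
      ∫ y, qt t (y - x0) * Real.exp (u y) := by
    apply integral_mono ((Iq.const_mul _).add (It.const_mul _)) Ie
    intro y
    simp only
    have h2 : Real.exp a * (1 + (u y - a)) ≤ Real.exp (u y) := by
      calc Real.exp a * (1 + (u y - a)) ≤ Real.exp a * Real.exp (u y - a) := by
            gcongr; linarith [Real.add_one_le_exp (u y - a)]
        _ = Real.exp (u y) := by rw [← Real.exp_add]; congr 1; ring
    have := mul_le_mul_of_nonneg_left h2 (qt_nonneg t (y - x0))
    simp only [Pi.add_apply, Function.comp_apply]
    linarith
  rw [integral_add (Iq.const_mul _) (It.const_mul _), integral_const_mul, integral_const_mul,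
    qtx_integral ht] at h1
  nlinarith [mul_le_mul_of_nonneg_left ha (Real.exp_pos a).le]

lemma qt_sum_le {M : ℝ} (hM : 0 < M) (hMb : ∀ s, deriv Real.smoothTransition s ≤ M) {ρ : ℝ}
    (hρ : 0 < ρ) (n : ℕ) (y : E2) :
    ∑ j ∈ Finset.range n, (ρ / 2 ^ j) ^ 2 * qt (ρ / 2 ^ j) y ≤ 4 * M := by
  have one : ∀ j : ℕ, (ρ / 2 ^ j) ^ 2 * qt (ρ / 2 ^ j) y ≤ 4 * M := by
    intro j
    have hp : (0:ℝ) < (ρ / 2 ^ j) ^ 2 := by positivity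
    unfold qt
    rw [← mul_assoc, mul_div_cancel₀ _ hp.ne']
    exact mul_le_mul_of_nonneg_left (hMb _) (by norm_num)
  have dis : ∀ i j : ℕ, i < j → qt (ρ / 2 ^ i) y ≠ 0 → qt (ρ / 2 ^ j) y = 0 := by
    intro i j hij hi
    by_contra hj
    have h1 : ‖y‖ ≤ ρ / 2 ^ j := by
      by_contra h; exact hj (qt_zero_of_gt (by positivity) (not_le.1 h))
    have h2 : (ρ / 2 ^ i) ^ 2 ≤ 2 * ‖y‖ ^ 2 := by
      by_contra h; exact hi (qt_zero_of_lt (by positivity) (not_le.1 h))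
    have h3 : ρ / 2 ^ j ≤ ρ / 2 ^ i / 2 := by
      rw [div_div, ← pow_succ]
      apply div_le_div_of_nonneg_left hρ.le (by positivity)
      exact pow_le_pow_right₀ (by norm_num) hij
    have h4 : (0:ℝ) < ρ / 2 ^ i := by positivity
    nlinarith [norm_nonneg y]
  by_cases h : ∃ j ∈ Finset.range n, qt (ρ / 2 ^ j) y ≠ 0
  · obtain ⟨j, hj, hjn⟩ := h
    rw [Finset.sum_eq_single_of_mem j hj]
    · exact one j
    · intro i _ hij
      rcases lt_or_gt_of_ne hij with h | h
      · have : qt (ρ / 2 ^ i) y = 0 := by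
          by_contra hi; exact hjn (dis i j h hi)
        simp [this]
      · simp [dis j i h hjn]
  · push Not at h
    rw [Finset.sum_eq_zero]
    · linarith
    · intro j hj; simp [h j hj]

theorem interior_mass (C : ℝ) {ρ : ℝ} (hρ : 0 < ρ) : ∃ s α : ℝ, 0 < s ∧ s ≤ ρ ∧ 0 < α ∧ α < 2 ∧
    ∀ (Ω : Set E2) (w u f : E2 → ℝ), GoodDom Ω w → Sol1 Ω w u f → ∀ x0, closedBall x0 ρ ⊆ Ω →
      ∫ x in Ω, Real.exp (u x) ≤ C → ∫ y in ball x0 s, f y ≤ 2 * π * α := by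
  obtain ⟨M, hM, hMb⟩ := sT_deriv_bdd
  obtain ⟨n, hn⟩ := exists_nat_gt (max 1 (4 * M * C / (π * ρ ^ 2)))
  have hn1 : (1:ℝ) < n := lt_of_le_of_lt (le_max_left _ _) hn
  have hn2 : 4 * M * C < n * (π * ρ ^ 2) := by
    rw [← div_lt_iff₀ (by positivity)]; exact lt_of_le_of_lt (le_max_right _ _) hn
  have hn0 : (0:ℝ) < n := by linarith
  have hinv : 1 / (n:ℝ) < 1 := by rw [div_lt_one hn0]; exact hn1
  have hinv0 : 0 < 1 / (n:ℝ) := by positivity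
  refine ⟨ρ / 2 ^ n, 2 - 1 / n, by positivity, ?_, by linarith, by linarith, ?_⟩
  · exact div_le_self hρ.le (one_le_pow₀ (by norm_num))
  intro Ω w u f G S x0 hB hC
  by_contra hcon
  push Not at hcon
  have hO := G.isOpen
  have hcu : ContinuousOn u Ω := S.cont.mono subset_closure
  have tle : ∀ j : ℕ, ρ / 2 ^ j ≤ ρ := fun j => div_le_self hρ.le (one_le_pow₀ (by norm_num))
  have hBj : ∀ j : ℕ, closedBall x0 (ρ / 2 ^ j) ⊆ Ω := fun j =>
    (closedBall_subset_closedBall (tle j)).trans hB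
  have step : ∀ j ∈ Finset.range n, π * ρ ^ 2 ≤
      (ρ / 2 ^ j) ^ 2 * ∫ y, qt (ρ / 2 ^ j) (y - x0) * Real.exp (u y) := by
    intro j hj
    have hjn : j < n := Finset.mem_range.1 hj
    have h2s : 2 * (ρ / 2 ^ n) ^ 2 ≤ (ρ / 2 ^ j) ^ 2 := by
      have : ρ / 2 ^ n ≤ ρ / 2 ^ j / 2 := by
        rw [div_div, ← pow_succ]
        apply div_le_div_of_nonneg_left hρ.le (by positivity)
        exact pow_le_pow_right₀ (by norm_num) hjn
      have h4 : (0:ℝ) < ρ / 2 ^ n := by positivity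
      nlinarith
    have h1 := int_pot G S hB (t := ρ / 2 ^ j) (s := ρ / 2 ^ n) (by positivity) (tle j)
      (by positivity) h2s
    have hlog : Real.log (ρ / (ρ / 2 ^ j)) = j * Real.log 2 := by
      rw [div_div_cancel₀ hρ.ne', Real.log_pow]
    rw [hlog] at h1
    have hl2 : 0 < Real.log 2 := Real.log_pos (by norm_num)
    have h3 : 2 * π * ((2 - 1 / n) * (j * Real.log 2)) ≤ ∫ y, qt (ρ / 2 ^ j) (y - x0) * u y := by
      refine le_trans ?_ h1
      have := mul_le_mul_of_nonneg_left hcon.le (show 0 ≤ j * Real.log 2 by positivity)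
      linarith
    have h4 := int_exp G S.toFn (hBj j) (by positivity) h3
    have h5 : 1 / 2 * 4 ^ j ≤ Real.exp ((2 - 1 / n) * (j * Real.log 2)) := by
      have e1 : (1:ℝ) / 2 * 4 ^ j = Real.exp (2 * (j * Real.log 2) - Real.log 2) := by
        rw [Real.exp_sub, Real.exp_log (by norm_num), ← mul_assoc, mul_comm (2:ℝ) (j:ℝ), mul_assoc,
          Real.exp_nat_mul, mul_comm (2:ℝ), Real.exp_mul, Real.exp_log (by norm_num)]
        norm_num
        ring
      rw [e1, Real.exp_le_exp]
      have : 1 / (n:ℝ) * j ≤ 1 := by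
        rw [one_div, inv_mul_le_iff₀ hn0, mul_one]; exact_mod_cast hjn.le
      nlinarith
    have e2 : (ρ / 2 ^ j) ^ 2 * 4 ^ j = ρ ^ 2 := by
      rw [div_pow, ← pow_mul, mul_comm j 2, pow_mul]; norm_num
    calc π * ρ ^ 2 = (ρ / 2 ^ j) ^ 2 * (2 * π * (1 / 2 * 4 ^ j)) := by rw [← e2]; ring
      _ ≤ (ρ / 2 ^ j) ^ 2 * (2 * π * Real.exp ((2 - 1 / n) * (j * Real.log 2))) := by gcongr
      _ ≤ _ := by gcongr
  have hsum := Finset.sum_le_sum step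
  rw [Finset.sum_const, Finset.card_range, nsmul_eq_mul] at hsum
  have Ij : ∀ j ∈ Finset.range n, IntegrableOn
      (fun y => (ρ / 2 ^ j) ^ 2 * (qt (ρ / 2 ^ j) (y - x0) * Real.exp (u y))) Ω := fun j _ =>
    ((qtx_mul_integrable (by positivity) x0 hO (hBj j)
      (Real.continuous_exp.comp_continuousOn hcu)).1.const_mul _).integrableOn
  have e3 : ∑ j ∈ Finset.range n, (ρ / 2 ^ j) ^ 2 * ∫ y, qt (ρ / 2 ^ j) (y - x0) * Real.exp (u y) =
      ∫ y in Ω, ∑ j ∈ Finset.range n, (ρ / 2 ^ j) ^ 2 * (qt (ρ / 2 ^ j) (y - x0) * Real.exp (u y)) := by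
    rw [integral_finsetSum _ Ij]
    apply Finset.sum_congr rfl
    intro j _
    rw [integral_const_mul]
    exact congrArg _ (qtx_mul_integrable (by positivity) x0 hO (hBj j)
      (Real.continuous_exp.comp_continuousOn hcu)).2
  have Ie : IntegrableOn (fun y => Real.exp (u y)) Ω := by
    simpa using Sol1.exp_int G S.toFn 1
  have h6 : ∫ y in Ω, ∑ j ∈ Finset.range n, (ρ / 2 ^ j) ^ 2 * (qt (ρ / 2 ^ j) (y - x0) * Real.exp (u y)) ≤
      ∫ y in Ω, 4 * M * Real.exp (u y) := by
    apply integral_mono (integrable_finsetSum _ Ij) (Ie.const_mul _)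
    intro y
    simp only
    calc _ = (∑ j ∈ Finset.range n, (ρ / 2 ^ j) ^ 2 * qt (ρ / 2 ^ j) (y - x0)) * Real.exp (u y) := by
          rw [Finset.sum_mul]; apply Finset.sum_congr rfl; intros; ring
      _ ≤ _ := by gcongr; exact qt_sum_le hM hMb hρ n _
  rw [integral_const_mul] at h6
  have : 4 * M * ∫ x in Ω, Real.exp (u x) ≤ 4 * M * C := by gcongr
  linarith



/-! ### Brezis–Merle type estimates -/

/-- the kernel `(R/|y-x|)^a` -/
def kr (R a : ℝ) (x y : E2) : ℝ := Real.exp (a * Real.log (R / ‖y - x‖))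

lemma kr_symm (R a : ℝ) (x y : E2) : kr R a x y = kr R a y x := by
  unfold kr; rw [norm_sub_rev]

lemma kr_nonneg (R a : ℝ) (x y : E2) : 0 ≤ kr R a x y := (Real.exp_pos _).le

lemma kr_meas (R a : ℝ) : Measurable (fun z : E2 × E2 => kr R a z.1 z.2) := by
  unfold kr
  exact Real.measurable_exp.comp ((Real.measurable_log.comp
    ((measurable_const).div (measurable_snd.sub measurable_fst).norm)).const_mul a)

lemma kr_int {R a : ℝ} (hR : 0 < R) (ha : a < 2) (x : E2) :
    IntegrableOn (fun y => kr R a x y) (ball x (2 * R)) ∧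
    ∫ y in ball x (2 * R), kr R a x y = R ^ a * (2 * π * ((2 * R) ^ (2 - a) / (2 - a))) := by
  obtain ⟨h1, h2⟩ := rpow_integral' ha (show 0 < 2 * R by linarith) x
  have hae : (fun y => R ^ a * ‖y - x‖ ^ (-a)) =ᵐ[volume.restrict (ball x (2 * R))] fun y => kr R a x y := by
    apply ae_restrict_of_ae
    filter_upwards [ae_ne' x] with y hy
    have hp : 0 < ‖y - x‖ := norm_pos_iff.2 (sub_ne_zero.2 hy)
    unfold kr
    rw [mul_comm a, Real.exp_mul, Real.exp_log (by positivity), Real.div_rpow hR.le hp.le,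
      Real.rpow_neg hp.le, div_eq_mul_inv]
  constructor
  · exact (h1.const_mul _).congr hae
  · rw [← integral_congr_ae hae, integral_const_mul, h2]

lemma jensen_aux {T r X : ℝ} (hr : r ≤ 1) (hr0 : 0 ≤ r)
    (h : Real.exp T * ((1 - T) * r + T) ≤ X) : Real.exp T ≤ 1 + X := by
  have he := Real.exp_pos T
  rcases le_total T 1 with h1 | h1
  · have h2 : 1 - T ≤ Real.exp (-T) := by linarith [Real.add_one_le_exp (-T)]
    have h3 : Real.exp T * Real.exp (-T) = 1 := by rw [← Real.exp_add]; simp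
    have h4 : 0 ≤ Real.exp T * ((1 - T) * r) := mul_nonneg he.le (mul_nonneg (by linarith) hr0)
    nlinarith
  · have h4 : 0 ≤ Real.exp T * ((T - 1) * (1 - r)) :=
      mul_nonneg he.le (mul_nonneg (by linarith) (by linarith))
    nlinarith

/-- splitting the potential -/
lemma pot_split {Ω : Set E2} {w u f : E2 → ℝ} (G : GoodDom Ω w) (S : Sol1 Ω w u f) {R s B : ℝ}
    (hR : 0 < R) (hs : 0 < s) (hd : ∀ x ∈ Ω, ∀ y ∈ closure Ω, ‖y - x‖ ≤ R)
    (hB : ∫ x in Ω, f x ≤ B) {x0 x : E2} (hx : x ∈ Ω) (hx0 : x ∈ ball x0 (s / 2)) :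
    2 * π * u x ≤ (∫ y in Ω ∩ ball x0 s, Real.log (R / ‖y - x‖) * f y) + |Real.log (2 * R / s)| * B := by
  obtain ⟨Mf, hMf⟩ := S.f_bdd
  have hIntg := log_int G hR (x := x) (fun y hy => hd x hx y (subset_closure hy)) S.fc hMf
  have hp := S.pot G hR hd hx
  rw [← integral_inter_add_sdiff (measurableSet_ball (x := x0) (ε := s)) hIntg] at hp
  have h2 : ∫ y in Ω \ ball x0 s, Real.log (R / ‖y - x‖) * f y ≤ |Real.log (2 * R / s)| * B := by
    calc _ ≤ ∫ y in Ω \ ball x0 s, |Real.log (2 * R / s)| * f y := by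
          apply setIntegral_mono_on (hIntg.mono_set sdiff_subset)
            (((S.f_int G).mono_set sdiff_subset).const_mul _) (G.measurable.diff measurableSet_ball)
          intro y hy
          apply mul_le_mul_of_nonneg_right _ (S.f0 y hy.1)
          refine le_trans ?_ (le_abs_self _)
          have hyx : s / 2 ≤ ‖y - x‖ := by
            have h1 : s ≤ dist y x0 := not_lt.1 hy.2
            have h3 : dist x x0 < s / 2 := hx0
            have h4 := dist_triangle y x x0
            rw [← dist_eq_norm]; linarith
          apply Real.log_le_log (by apply div_pos hR; linarith)
          rw [div_le_div_iff₀ (by linarith) hs]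
          nlinarith
      _ ≤ |Real.log (2 * R / s)| * B := by
          rw [integral_const_mul]
          apply mul_le_mul_of_nonneg_left _ (abs_nonneg _)
          refine le_trans ?_ hB
          exact setIntegral_mono_set (S.f_int G)
            ((ae_restrict_iff' G.measurable).2 (ae_of_all _ S.f0)) (ae_of_all _ (fun y hy => hy.1))
  linarith

lemma bm_exp {R s α B p : ℝ} (hR : 0 < R) (hs : 0 < s) (hα : 0 < α) (hp : 0 < p) (hpα : p * α < 2) :
    ∃ K : ℝ, ∀ (Ω : Set E2) (w u f : E2 → ℝ), GoodDom Ω w → Sol1 Ω w u f →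
      (∀ x ∈ Ω, ∀ y ∈ closure Ω, ‖y - x‖ ≤ R) → ∫ x in Ω, f x ≤ B → ∀ x0,
      ∫ y in Ω ∩ ball x0 s, f y ≤ 2 * π * α →
      ∫ x in Ω ∩ ball x0 (s / 2), Real.exp (p * u x) ≤ K := by
  set a := p * α with ha
  have ha0 : 0 < a := by positivity
  set c := |Real.log (2 * R / s)| * B / (2 * π) with hc
  set m := 2 * π * α with hm
  have hm0 : 0 < m := by positivity
  set Ka := R ^ a * (2 * π * ((2 * R) ^ (2 - a) / (2 - a))) with hKa
  have hKa0 : 0 ≤ Ka := by have : 0 < 2 - a := by linarith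
                           positivity
  refine ⟨Real.exp (p * c) * ((volume (ball (0:E2) (s / 2))).toReal + Ka), ?_⟩
  intro Ω w u f G S hd hB x0 hmass
  set E := Ω ∩ ball x0 s with hE
  set D := Ω ∩ ball x0 (s / 2) with hD
  have hEm : MeasurableSet E := G.measurable.inter measurableSet_ball
  have hDm : MeasurableSet D := G.measurable.inter measurableSet_ball
  obtain ⟨Mf, hMf⟩ := S.f_bdd
  have fE : IntegrableOn f E := (S.f_int G).mono_set inter_subset_left
  have hsub : ∀ x ∈ Ω, Ω ⊆ ball x (2 * R) := fun x hx y hy => by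
    rw [mem_ball, dist_eq_norm]
    have := hd x hx y (subset_closure hy); linarith
  have kf : ∀ x ∈ Ω, IntegrableOn (fun y => kr R a x y * f y) E := by
    intro x hx
    have h1 : IntegrableOn (fun y => kr R a x y) E :=
      (kr_int hR hpα x).1.mono_set (inter_subset_left.trans (hsub x hx))
    apply Integrable.mul_bdd (c := Mf) h1 fE.aestronglyMeasurable
    rw [ae_restrict_iff' hEm]
    exact ae_of_all _ fun y hy => hMf y hy.1
  -- pointwise bound
  have hpt : ∀ x ∈ D, Real.exp (p * u x) ≤
      Real.exp (p * c) * (1 + 1 / m * ∫ y in E, kr R a x y * f y) := by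
    intro x hx
    have h1 := pot_split G S hR hs hd hB hx.1 hx.2
    have hIntg : IntegrableOn (fun y => Real.log (R / ‖y - x‖) * f y) E :=
      (log_int G hR (x := x) (fun y hy => hd x hx.1 y (subset_closure hy)) S.fc hMf).mono_set
        inter_subset_left
    set T := p / (2 * π) * ∫ y in E, Real.log (R / ‖y - x‖) * f y with hT
    have h2 : p * u x ≤ p * c + T := by
      have : u x ≤ c + 1 / (2 * π) * ∫ y in E, Real.log (R / ‖y - x‖) * f y := by
        rw [hc, one_div, inv_mul_eq_div, ← add_div, le_div_iff₀ (by positivity)]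
        linarith
      have := mul_le_mul_of_nonneg_left this hp.le
      rw [hT]
      calc _ ≤ _ := this
        _ = _ := by ring
    have h3 : Real.exp T ≤ 1 + 1 / m * ∫ y in E, kr R a x y * f y := by
      apply jensen_aux (r := (∫ y in E, f y) / m)
      · rw [div_le_one hm0]; exact hmass
      · apply div_nonneg _ hm0.le
        exact setIntegral_nonneg hEm fun y hy => S.f0 y hy.1
      · have h4 : ∫ y in E, (Real.exp T * (1 - T) * f y + Real.exp T * a * (Real.log (R / ‖y - x‖) * f y)) ≤
            ∫ y in E, kr R a x y * f y := by
          apply setIntegral_mono_on ((fE.const_mul _).add (hIntg.const_mul _)) (kf x hx.1) hEm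
          intro y hy
          have h5 : Real.exp T * (1 + (a * Real.log (R / ‖y - x‖) - T)) ≤ kr R a x y := by
            calc _ ≤ Real.exp T * Real.exp (a * Real.log (R / ‖y - x‖) - T) := by
                  gcongr; linarith [Real.add_one_le_exp (a * Real.log (R / ‖y - x‖) - T)]
              _ = _ := by unfold kr; rw [← Real.exp_add]; congr 1; ring
          have := mul_le_mul_of_nonneg_right h5 (S.f0 y hy.1)
          simp only [Pi.add_apply]
          linarith
        rw [integral_add (fE.const_mul _) (hIntg.const_mul _), integral_const_mul,
          integral_const_mul] at h4
        have h6 := mul_le_mul_of_nonneg_left h4 (show 0 ≤ 1 / m by positivity)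
        refine le_trans (le_of_eq ?_) h6
        rw [mul_add, mul_add]
        congr 1
        · ring
        · rw [hT, ha, hm]; field_simp
    calc Real.exp (p * u x) ≤ Real.exp (p * c + T) := Real.exp_le_exp.2 h2
      _ = Real.exp (p * c) * Real.exp T := Real.exp_add _ _
      _ ≤ _ := by gcongr
  -- Tonelli
  have hfm : AEMeasurable f (volume.restrict E) := fE.aestronglyMeasurable.aemeasurable
  have hI0 : ∀ x ∈ D, 0 ≤ ∫ y in E, kr R a x y * f y := fun x _ =>
    setIntegral_nonneg hEm fun y hy => mul_nonneg (kr_nonneg _ _ _ _) (S.f0 y hy.1)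
  have ton : ∫⁻ x in D, ∫⁻ y in E, ENNReal.ofReal (kr R a x y * f y) ≤ ENNReal.ofReal (m * Ka) := by
    rw [lintegral_lintegral_swap]
    · calc ∫⁻ y in E, ∫⁻ x in D, ENNReal.ofReal (kr R a x y * f y)
          ≤ ∫⁻ y in E, ENNReal.ofReal (f y) * ENNReal.ofReal Ka := by
            apply setLIntegral_mono_ae' hEm
            refine ae_of_all _ fun y hy => ?_
            have e : ∀ x, ENNReal.ofReal (kr R a x y * f y) =
                ENNReal.ofReal (f y) * ENNReal.ofReal (kr R a y x) := fun x => by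
              rw [← ENNReal.ofReal_mul (S.f0 y hy.1), kr_symm, mul_comm]
            simp_rw [e]
            rw [lintegral_const_mul' _ _ ENNReal.ofReal_ne_top]
            gcongr
            obtain ⟨k1, k2⟩ := kr_int hR hpα y
            calc ∫⁻ x in D, ENNReal.ofReal (kr R a y x)
                ≤ ∫⁻ x in ball y (2 * R), ENNReal.ofReal (kr R a y x) :=
                  lintegral_mono_set (inter_subset_left.trans (hsub y hy.1))
              _ = ENNReal.ofReal Ka := by
                  rw [← ofReal_integral_eq_lintegral_ofReal k1 (ae_of_all _ fun x => kr_nonneg _ _ _ _), k2]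
        _ = ENNReal.ofReal (∫ y in E, f y) * ENNReal.ofReal Ka := by
            rw [lintegral_mul_const' _ _ ENNReal.ofReal_ne_top,
              ofReal_integral_eq_lintegral_ofReal fE]
            rw [EventuallyLE, ae_restrict_iff' hEm]
            exact ae_of_all _ fun y hy => S.f0 y hy.1
        _ ≤ ENNReal.ofReal m * ENNReal.ofReal Ka := by gcongr
        _ = _ := (ENNReal.ofReal_mul hm0.le).symm
    · apply AEMeasurable.ennreal_ofReal
      apply AEMeasurable.mul
      · exact (kr_meas R a).aemeasurable
      · exact hfm.comp_snd
  have eI : IntegrableOn (fun x => Real.exp (p * u x)) D :=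
    (Sol1.exp_int G S.toFn p).mono_set inter_subset_left
  rw [← ENNReal.ofReal_le_ofReal_iff (by positivity),
    ofReal_integral_eq_lintegral_ofReal eI (ae_of_all _ fun x => (Real.exp_pos _).le)]
  calc ∫⁻ x in D, ENNReal.ofReal (Real.exp (p * u x))
      ≤ ∫⁻ x in D, ENNReal.ofReal (Real.exp (p * c)) * (1 + ENNReal.ofReal (1 / m) *
          ∫⁻ y in E, ENNReal.ofReal (kr R a x y * f y)) := by
        apply setLIntegral_mono_ae' hDm
        refine ae_of_all _ fun x hx => ?_
        rw [← ofReal_integral_eq_lintegral_ofReal (kf x hx.1),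
          ← ENNReal.ofReal_mul (by positivity), ← ENNReal.ofReal_one,
          ← ENNReal.ofReal_add (by norm_num) (mul_nonneg (by positivity) (hI0 x hx)),
          ← ENNReal.ofReal_mul (Real.exp_pos _).le]
        · exact ENNReal.ofReal_le_ofReal (hpt x hx)
        · rw [EventuallyLE, ae_restrict_iff' hEm]
          exact ae_of_all _ fun y hy => mul_nonneg (kr_nonneg _ _ _ _) (S.f0 y hy.1)
    _ = ENNReal.ofReal (Real.exp (p * c)) * (volume D + ENNReal.ofReal (1 / m) *
          ∫⁻ x in D, ∫⁻ y in E, ENNReal.ofReal (kr R a x y * f y)) := by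
        rw [lintegral_const_mul' _ _ ENNReal.ofReal_ne_top, lintegral_add_left measurable_const,
          lintegral_const_mul' _ _ ENNReal.ofReal_ne_top]
        simp
    _ ≤ ENNReal.ofReal (Real.exp (p * c)) * (ENNReal.ofReal (volume (ball (0:E2) (s / 2))).toReal +
          ENNReal.ofReal (1 / m) * ENNReal.ofReal (m * Ka)) := by
        gcongr
        rw [ENNReal.ofReal_toReal measure_ball_lt_top.ne, ← Measure.addHaar_ball_center volume x0]
        exact measure_mono inter_subset_right
    _ = _ := by
        rw [← ENNReal.ofReal_mul (by positivity), ← ENNReal.ofReal_add (by positivity) (by positivity),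
          ← ENNReal.ofReal_mul (Real.exp_pos _).le]
        congr 3
        field_simp

lemma exp_young {t x : ℝ} {N : ℕ} (hN : 0 < N) (ht : 0 ≤ t) :
    t * Real.exp x ≤ Real.exp ((1 + 1 / N) * x) + t ^ (N + 1) := by
  have hN' : (0:ℝ) < N := by exact_mod_cast hN
  rcases le_total t (Real.exp (x / N)) with h | h
  · have : t * Real.exp x ≤ Real.exp (x / N) * Real.exp x := by gcongr
    rw [← Real.exp_add] at this
    have e : x / N + x = (1 + 1 / N) * x := by ring
    rw [e] at this
    have : 0 ≤ t ^ (N + 1) := by positivity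
    linarith
  · have h1 : Real.exp x ≤ t ^ N := by
      calc Real.exp x = Real.exp (x / N) ^ N := by
            rw [← Real.exp_nat_mul]; congr 1; field_simp
        _ ≤ t ^ N := by gcongr
    have : t * Real.exp x ≤ t * t ^ N := by gcongr
    rw [← pow_succ'] at this
    linarith [Real.exp_pos ((1 + 1 / (N:ℝ)) * x)]

lemma bm_sup {R s b B K1 : ℝ} {N : ℕ} (hR : 0 < R) (hs : 0 < s) (hb : 0 ≤ b) (hN : 0 < N) :
    ∃ K : ℝ, ∀ (Ω : Set E2) (w u v g : E2 → ℝ), GoodDom Ω w → Fn Ω w u → Sol1 Ω w v g →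
      (∀ x ∈ Ω, g x ≤ b * Real.exp (u x)) →
      (∀ x ∈ Ω, ∀ y ∈ closure Ω, ‖y - x‖ ≤ R) → ∫ x in Ω, g x ≤ B → ∀ x0,
      ∫ x in Ω ∩ ball x0 (s / 2), Real.exp ((1 + 1 / N) * u x) ≤ K1 →
      ∀ x ∈ Ω ∩ ball x0 (s / 2 / 2), v x ≤ K := by
  set Ka := R ^ (1:ℝ) * (2 * π * ((2 * R) ^ (2 - 1 : ℝ) / (2 - 1))) with hKa
  refine ⟨(b * (K1 + (N + 1).factorial * Ka) + |Real.log (2 * R / (s / 2))| * B) / (2 * π), ?_⟩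
  intro Ω w u v g G U S hgb hd hB x0 hK1 x hx
  rw [le_div_iff₀ (by positivity)]
  have h1 := pot_split G S hR (s := s / 2) (by linarith) hd hB hx.1 hx.2
  set D := Ω ∩ ball x0 (s / 2) with hD
  have hDm : MeasurableSet D := G.measurable.inter measurableSet_ball
  obtain ⟨Mg, hMg⟩ := S.f_bdd
  have hIntg : IntegrableOn (fun y => Real.log (R / ‖y - x‖) * g y) D :=
    (log_int G hR (x := x) (fun y hy => hd x hx.1 y (subset_closure hy)) S.fc hMg).mono_set
      inter_subset_left
  have eI : IntegrableOn (fun x => Real.exp ((1 + 1 / N) * u x)) D :=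
    (Sol1.exp_int G U _).mono_set inter_subset_left
  have hsub : Ω ⊆ ball x (2 * R) := fun y hy => by
    rw [mem_ball, dist_eq_norm]
    have := hd x hx.1 y (subset_closure hy); linarith
  obtain ⟨k1, k2⟩ := kr_int hR (a := 1) (by norm_num) x
  have k1D : IntegrableOn (fun y => kr R 1 x y) D := k1.mono_set (inter_subset_left.trans hsub)
  have h2 : ∫ y in D, Real.log (R / ‖y - x‖) * g y ≤
      ∫ y in D, (b * Real.exp ((1 + 1 / N) * u y) + b * (N + 1).factorial * kr R 1 x y) := by
    apply setIntegral_mono_on hIntg ((eI.const_mul _).add (k1D.const_mul _)) hDm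
    intro y hy
    have hL : 0 ≤ Real.log (R / ‖y - x‖) := by
      by_cases hyx : y = x
      · simp [hyx]
      · exact (log_bound hR (norm_pos_iff.2 (sub_ne_zero.2 hyx)) (hd x hx.1 y (subset_closure hy.1))).1
    have h3 := exp_young (x := u y) hN hL
    have h4 : Real.log (R / ‖y - x‖) ^ (N + 1) ≤ (N + 1).factorial * kr R 1 x y := by
      have := Real.pow_div_factorial_le_exp _ hL (N + 1)
      rw [div_le_iff₀ (by positivity)] at this
      unfold kr; rw [one_mul]; linarith
    have h5 : Real.log (R / ‖y - x‖) * g y ≤ Real.log (R / ‖y - x‖) * (b * Real.exp (u y)) :=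
      mul_le_mul_of_nonneg_left (hgb y hy.1) hL
    have h6 := mul_le_mul_of_nonneg_left (h3.trans (add_le_add_right h4 _)) hb
    simp only [Pi.add_apply]
    linarith
  rw [integral_add (eI.const_mul _) (k1D.const_mul _), integral_const_mul, integral_const_mul] at h2
  have h7 : ∫ y in D, kr R 1 x y ≤ Ka := by
    rw [hKa, ← k2]
    exact setIntegral_mono_set k1 (ae_of_all _ fun y => kr_nonneg _ _ _ _)
      (ae_of_all _ (inter_subset_left.trans hsub))
  have h8 := mul_le_mul_of_nonneg_left hK1 hb
  have h9 := mul_le_mul_of_nonneg_left h7 (show 0 ≤ b * ((N + 1).factorial : ℝ) by positivity)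
  linarith

/-- local sup bound from subcritical masses -/
theorem bm {R s α b B : ℝ} (hR : 0 < R) (hs : 0 < s) (hα : 0 < α) (hα2 : α < 2) (hb : 0 ≤ b) :
    ∃ K : ℝ, ∀ (Ω : Set E2) (w u v f g : E2 → ℝ), GoodDom Ω w → Sol1 Ω w u f → Sol1 Ω w v g →
      (∀ x ∈ Ω, f x ≤ b * Real.exp (v x)) → (∀ x ∈ Ω, g x ≤ b * Real.exp (u x)) →
      (∀ x ∈ Ω, ∀ y ∈ closure Ω, ‖y - x‖ ≤ R) → ∫ x in Ω, f x ≤ B → ∫ x in Ω, g x ≤ B → ∀ x0,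
      ∫ y in Ω ∩ ball x0 s, f y ≤ 2 * π * α → ∫ y in Ω ∩ ball x0 s, g y ≤ 2 * π * α →
      ∀ x ∈ Ω ∩ ball x0 (s / 2 / 2), u x ≤ K ∧ v x ≤ K := by
  obtain ⟨N, hN⟩ := exists_nat_gt (α / (2 - α))
  have h2 : 0 < 2 - α := by linarith
  have hN0 : (0:ℝ) < N := lt_of_le_of_lt (by positivity) hN
  rw [div_lt_iff₀ h2] at hN
  have hN0' : 0 < N := by exact_mod_cast hN0
  have hp : (1 + 1 / (N:ℝ)) * α < 2 := by
    have : 1 / (N:ℝ) * α < 2 - α := by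
      rw [one_div, inv_mul_lt_iff₀ hN0]; exact hN
    linarith
  obtain ⟨K1, hK1⟩ := bm_exp (B := B) hR hs hα (p := 1 + 1 / (N:ℝ)) (by positivity) hp
  obtain ⟨K, hK⟩ := bm_sup (B := B) (K1 := K1) hR hs hb hN0'
  refine ⟨K, ?_⟩
  intro Ω w u v f g G S1 S2 hf hg hd hB1 hB2 x0 hm1 hm2 x hx
  exact ⟨hK Ω w v u f G S2.toFn S1 hf hd hB1 x0 (hK1 Ω w v g G S2 hd hB2 x0 hm2) x hx,
    hK Ω w u v g G S1.toFn S2 hg hd hB2 x0 (hK1 Ω w u f G S1 hd hB1 x0 hm1) x hx⟩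



/-! ### The system, interior bounds -/

structure Sys (Ω : Set E2) (w : E2 → ℝ) (b C : ℝ) (A : ℝ≥0) (V W u v : E2 → ℝ) : Prop where
  S1 : Sol1 Ω w u (fun x => V x * Real.exp (v x))
  S2 : Sol1 Ω w v (fun x => W x * Real.exp (u x))
  V0 : ∀ x ∈ Ω, 0 ≤ V x
  Vb : ∀ x ∈ Ω, V x ≤ b
  W0 : ∀ x ∈ Ω, 0 ≤ W x
  Wb : ∀ x ∈ Ω, W x ≤ b
  LV : LipschitzOnWith A V (closure Ω)
  LW : LipschitzOnWith A W (closure Ω)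
  EU : ∫ x in Ω, Real.exp (u x) ≤ C
  EV : ∫ x in Ω, Real.exp (v x) ≤ C

lemma Sys.symm {Ω : Set E2} {w : E2 → ℝ} {b C : ℝ} {A : ℝ≥0} {V W u v : E2 → ℝ}
    (S : Sys Ω w b C A V W u v) : Sys Ω w b C A W V v u :=
  ⟨S.S2, S.S1, S.W0, S.Wb, S.V0, S.Vb, S.LW, S.LV, S.EV, S.EU⟩

lemma Fn.exp_int1 {Ω : Set E2} {w u : E2 → ℝ} (G : GoodDom Ω w) (S : Fn Ω w u) :
    IntegrableOn (fun x => Real.exp (u x)) Ω := by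
  simpa using Sol1.exp_int G S 1

lemma Sys.mass {Ω : Set E2} {w : E2 → ℝ} {b C : ℝ} {A : ℝ≥0} {V W u v : E2 → ℝ}
    (G : GoodDom Ω w) (hb : 0 ≤ b) (S : Sys Ω w b C A V W u v) :
    ∫ x in Ω, V x * Real.exp (v x) ≤ b * C := by
  calc _ ≤ ∫ x in Ω, b * Real.exp (v x) := by
        apply setIntegral_mono_on (S.S1.f_int G) ((S.S2.toFn.exp_int1 G).const_mul b) G.measurable
        intro x hx
        have := S.Vb x hx
        gcongr
    _ ≤ b * C := by
        rw [integral_const_mul]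
        exact mul_le_mul_of_nonneg_left S.EV hb

theorem int_sup {Ω : Set E2} {w : E2 → ℝ} (G : GoodDom Ω w) {R b : ℝ} (hR : 0 < R) (hb : 0 ≤ b)
    (hd : ∀ x ∈ Ω, ∀ y ∈ closure Ω, ‖y - x‖ ≤ R) (C : ℝ) (A : ℝ≥0) {ρ : ℝ} (hρ : 0 < ρ) :
    ∃ K, ∀ V W u v, Sys Ω w b C A V W u v → ∀ x, closedBall x ρ ⊆ Ω → u x ≤ K ∧ v x ≤ K := by
  obtain ⟨s, α, hs, hsρ, hα, hα2, hm⟩ := interior_mass C hρ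
  obtain ⟨K, hK⟩ := bm (B := b * C) hR hs hα hα2 hb
  refine ⟨K, fun V W u v S x hx => ?_⟩
  have e : Ω ∩ ball x s = ball x s :=
    inter_eq_right.2 ((ball_subset_closedBall.trans (closedBall_subset_closedBall hsρ)).trans hx)
  refine hK Ω w u v _ _ G S.S1 S.S2 ?_ ?_ hd (S.mass G hb) (S.symm.mass G hb) x ?_ ?_ x
    ⟨hx (mem_closedBall_self hρ.le), mem_ball_self (by linarith)⟩
  · intro x hx; have := S.Vb x hx; gcongr
  · intro x hx; have := S.Wb x hx; gcongr
  · rw [e]; exact hm Ω w u _ G S.S1 x hx S.EU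
  · rw [e]; exact hm Ω w v _ G S.S2 x hx S.EV

theorem cpt_sup {Ω : Set E2} {w : E2 → ℝ} (G : GoodDom Ω w) {R b : ℝ} (hR : 0 < R) (hb : 0 ≤ b)
    (hd : ∀ x ∈ Ω, ∀ y ∈ closure Ω, ‖y - x‖ ≤ R) (C : ℝ) (A : ℝ≥0) {Q : Set E2} (hQ : IsCompact Q)
    (hQΩ : Q ⊆ Ω) :
    ∃ K, 0 ≤ K ∧ ∀ V W u v, Sys Ω w b C A V W u v → ∀ x ∈ Q, u x ≤ K ∧ v x ≤ K := by
  obtain ⟨δ, hδ, hδ2⟩ := hQ.exists_cthickening_subset_open G.isOpen hQΩ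
  obtain ⟨K, hK⟩ := int_sup G hR hb hd C A hδ
  refine ⟨|K|, abs_nonneg _, fun V W u v S x hx => ?_⟩
  have := hK V W u v S x ((closedBall_subset_cthickening hx δ).trans hδ2)
  exact ⟨this.1.trans (le_abs_self _), this.2.trans (le_abs_self _)⟩

lemma exists_bump {s t : Set E2} (hs : IsClosed s) (ht : IsClosed t) (hd : Disjoint s t) :
    ∃ χ : E2 → ℝ, ContDiff ℝ (⊤ : ℕ∞) χ ∧ (∀ x, 0 ≤ χ x ∧ χ x ≤ 1) ∧
      (∀ᶠ x in 𝓝ˢ s, χ x = 0) ∧ (∀ᶠ x in 𝓝ˢ t, χ x = 1) := by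
  obtain ⟨f, h0, h1, h2⟩ := exists_contMDiffMap_zero_one_nhds_of_isClosed (n := (⊤ : ℕ∞))
    (modelWithCornersSelf ℝ E2) hs ht hd
  exact ⟨f, contMDiff_iff_contDiff.1 f.contMDiff, fun x => h2 x, h0, h1⟩

lemma pd_sq {u : E2 → ℝ} {x : E2} (i : Fin 2) (hu : DifferentiableAt ℝ u x) :
    pd i (fun y => u y * u y) x = 2 * (u x * pd i u x) := by
  rw [pd_mul i hu hu]; ring

/-- interior energy bound -/
theorem int_energy {Ω : Set E2} {w : E2 → ℝ} (G : GoodDom Ω w) {R b : ℝ} (hR : 0 < R) (hb : 0 ≤ b)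
    (hd : ∀ x ∈ Ω, ∀ y ∈ closure Ω, ‖y - x‖ ≤ R) (C : ℝ) (A : ℝ≥0) {Q : Set E2} (hQ : IsCompact Q)
    (hQΩ : Q ⊆ Ω) :
    ∃ K, ∀ V W u v, Sys Ω w b C A V W u v →
      IntegrableOn (fun x => pd 0 u x ^ 2 + pd 1 u x ^ 2) Q ∧
      ∫ x in Q, (pd 0 u x ^ 2 + pd 1 u x ^ 2) ≤ K := by
  have hO := G.isOpen
  obtain ⟨χ, hχ, hχ01, hχ0, hχ1⟩ := exists_bump hO.isClosed_compl hQ.isClosed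
    (disjoint_compl_left_iff_subset.2 hQΩ)
  have hts : tsupport χ ⊆ Ω := by
    intro x hx
    by_contra hc
    have h1 : ∀ᶠ y in 𝓝 x, χ y = 0 := hχ0.filter_mono (nhds_le_nhdsSet hc)
    exact (notMem_tsupport_iff_eventuallyEq.2 h1) hx
  have hcs : HasCompactSupport χ :=
    G.isCompact_closure.of_isClosed_subset (isClosed_tsupport _) (hts.trans subset_closure)
  have hχ2 : ContDiff ℝ 2 χ := contDiff_infty.1 hχ 2
  obtain ⟨K, hK0, hK⟩ := cpt_sup G hR hb hd C A hcs.isCompact hts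
  have ppχ : ∀ i, Continuous (pd i (pd i χ)) := fun i =>
    (contDiff_pd (contDiff_pd hχ2 (m := 1) (by norm_num) i) (m := 0) (by norm_num) i).continuous
  have csχ : ∀ i, HasCompactSupport (pd i (pd i χ)) := fun i =>
    hasCompactSupport_pd i (hasCompactSupport_pd i hcs)
  have tsχ : ∀ i, tsupport (pd i (pd i χ)) ⊆ tsupport χ := fun i =>
    (tsupport_pd_subset i _).trans (tsupport_pd_subset i _)
  have iχ : ∀ i, Integrable (pd i (pd i χ)) := fun i =>
    (ppχ i).integrable_of_hasCompactSupport (csχ i)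
  refine ⟨K ^ 2 / 2 * ((∫ x, |pd 0 (pd 0 χ) x|) + ∫ x, |pd 1 (pd 1 χ) x|) + K * (b * C), ?_⟩
  intro V W u v S
  have hu := S.S1.C2
  have hcu : ContinuousOn u Ω := S.S1.cont.mono subset_closure
  have u0 : ∀ x ∈ Ω, 0 ≤ u x := fun x hx => S.S1.nonneg x (subset_closure hx)
  have cpd : ∀ i, ContDiffOn ℝ 1 (pd i u) Ω := fun i => contDiffOn_pd hO hu (by norm_num) i
  have cg : ContinuousOn (fun x => pd 0 u x ^ 2 + pd 1 u x ^ 2) Ω :=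
    ((cpd 0).continuousOn.pow 2).add ((cpd 1).continuousOn.pow 2)
  have IQ : IntegrableOn (fun x => pd 0 u x ^ 2 + pd 1 u x ^ 2) Q :=
    (cg.mono hQΩ).integrableOn_compact hQ
  refine ⟨IQ, ?_⟩
  have Ig : Integrable (fun x => χ x * (pd 0 u x ^ 2 + pd 1 u x ^ 2)) :=
    integrable_mul_of_tsupport hO hχ2.continuous hcs hts cg
  have Iuf : Integrable (fun x => χ x * (u x * (V x * Real.exp (v x)))) :=
    integrable_mul_of_tsupport hO hχ2.continuous hcs hts (hcu.mul S.S1.fc)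
  have hU : ContDiffOn ℝ 2 (fun x => u x * u x) Ω := hu.mul hu
  have hg := fun i => green hO hχ2 hcs hts hU i
  have cU : ∀ i, ContinuousOn (pd i (pd i (fun x => u x * u x))) Ω := fun i =>
    (contDiffOn_pd hO (contDiffOn_pd hO hU (m := 1) (by norm_num) i) (m := 0) (by norm_num) i).continuousOn
  have IU : ∀ i, Integrable (fun x => χ x * pd i (pd i (fun x => u x * u x)) x) := fun i =>
    integrable_mul_of_tsupport hO hχ2.continuous hcs hts (cU i)
  have IU2 : ∀ i, Integrable (fun x => pd i (pd i χ) x * (u x * u x)) := fun i =>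
    integrable_mul_of_tsupport hO (ppχ i) (csχ i) ((tsχ i).trans hts) hU.continuousOn
  have dd : ∀ x ∈ Ω, ∀ i, pd i (pd i (fun x => u x * u x)) x = 2 * (pd i u x ^ 2 + u x * pd i (pd i u) x) := by
    intro x hx i
    have e : pd i (fun x => u x * u x) =ᶠ[𝓝 x] fun x => 2 * (u x * pd i u x) := by
      filter_upwards [hO.mem_nhds hx] with y hy
      exact pd_sq i ((hu.differentiableOn (by simp)).differentiableAt (hO.mem_nhds hy))
    have d1 : DifferentiableAt ℝ u x := (hu.differentiableOn (by simp)).differentiableAt (hO.mem_nhds hx)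
    have d2 : DifferentiableAt ℝ (pd i u) x :=
      ((cpd i).differentiableOn (by simp)).differentiableAt (hO.mem_nhds hx)
    rw [pd_congr i e, pd_const_mul i 2 (d1.fun_mul d2), pd_mul i d1 d2]; ring
  have key : 2 * ∫ x, χ x * (pd 0 u x ^ 2 + pd 1 u x ^ 2) =
      (∫ x, pd 0 (pd 0 χ) x * (u x * u x)) + (∫ x, pd 1 (pd 1 χ) x * (u x * u x)) +
      2 * ∫ x, χ x * (u x * (V x * Real.exp (v x))) := by
    rw [← hg 0, ← hg 1, ← integral_add (IU 0) (IU 1), ← integral_const_mul, ← integral_const_mul,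
      ← integral_add (f := fun a => χ a * pd 0 (pd 0 fun x => u x * u x) a +
        χ a * pd 1 (pd 1 fun x => u x * u x) a) ((IU 0).add (IU 1)) (Iuf.const_mul 2)]
    congr 1; ext x
    by_cases hx : x ∈ Ω
    · have := S.S1.eq x hx
      rw [lap_eq] at this
      rw [dd x hx, dd x hx]
      have e2 : pd 1 (pd 1 u) x = - (V x * Real.exp (v x)) - pd 0 (pd 0 u) x := by linarith
      rw [e2]; ring
    · have : χ x = 0 := by
        by_contra h; exact hx (hts (subset_tsupport χ h))
      simp [this]
  have b1 : ∀ i, ∫ x, pd i (pd i χ) x * (u x * u x) ≤ K ^ 2 * ∫ x, |pd i (pd i χ) x| := by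
    intro i
    rw [← integral_const_mul]
    apply integral_mono (IU2 i) ((iχ i).abs.const_mul _)
    intro x
    simp only
    by_cases hx : x ∈ tsupport χ
    · have h1 := (hK V W u v S x hx).1
      have h2 := u0 x (hts hx)
      calc pd i (pd i χ) x * (u x * u x) ≤ |pd i (pd i χ) x| * (u x * u x) := by
            gcongr; exact le_abs_self _
        _ ≤ |pd i (pd i χ) x| * (K * K) := by gcongr
        _ = _ := by ring
    · have : pd i (pd i χ) x = 0 := by
        by_contra h; exact hx (tsχ i (subset_tsupport _ h))
      simp [this]
  have b2 : ∫ x, χ x * (u x * (V x * Real.exp (v x))) ≤ K * (b * C) := by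
    rw [integral_eq_setIntegral_of_tsupport hts]
    calc _ ≤ ∫ x in Ω, K * (V x * Real.exp (v x)) := by
          apply setIntegral_mono_on Iuf.integrableOn ((S.S1.f_int G).const_mul K) G.measurable
          intro x hx
          have h0 := S.S1.f0 x hx
          by_cases hxt : x ∈ tsupport χ
          · have h1 := (hK V W u v S x hxt).1
            have h2 := u0 x hx
            calc χ x * (u x * (V x * Real.exp (v x))) ≤ 1 * (u x * (V x * Real.exp (v x))) := by
                  gcongr; exact (hχ01 x).2
              _ ≤ _ := by rw [one_mul]; gcongr
          · have : χ x = 0 := by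
              by_contra h; exact hxt (subset_tsupport χ h)
            rw [this, zero_mul]; positivity
      _ ≤ _ := by
          rw [integral_const_mul]
          exact mul_le_mul_of_nonneg_left (S.mass G hb) hK0
  have b3 : ∫ x in Q, (pd 0 u x ^ 2 + pd 1 u x ^ 2) ≤ ∫ x, χ x * (pd 0 u x ^ 2 + pd 1 u x ^ 2) := by
    have e : ∫ x in Q, (pd 0 u x ^ 2 + pd 1 u x ^ 2) = ∫ x in Q, χ x * (pd 0 u x ^ 2 + pd 1 u x ^ 2) := by
      apply setIntegral_congr_fun hQ.measurableSet
      intro x hx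
      have : χ x = 1 := hχ1.self_of_nhdsSet x hx
      simp [this]
    rw [e]
    apply setIntegral_le_integral Ig
    filter_upwards with x
    exact mul_nonneg (hχ01 x).1 (by positivity)
  have := b1 0
  have := b1 1
  linarith



/-! ### Pohozaev identity -/

/-- continuous and bounded on `Ω` -/
def CB (Ω : Set E2) (h : E2 → ℝ) : Prop := ContinuousOn h Ω ∧ ∃ M, ∀ x ∈ Ω, |h x| ≤ M

lemma CB.add {Ω : Set E2} {f g : E2 → ℝ} (hf : CB Ω f) (hg : CB Ω g) : CB Ω (fun x => f x + g x) := by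
  obtain ⟨c1, M1, h1⟩ := hf
  obtain ⟨c2, M2, h2⟩ := hg
  exact ⟨c1.add c2, M1 + M2, fun x hx => (abs_add_le _ _).trans (add_le_add (h1 x hx) (h2 x hx))⟩

lemma CB.neg {Ω : Set E2} {f : E2 → ℝ} (hf : CB Ω f) : CB Ω (fun x => - f x) := by
  obtain ⟨c1, M1, h1⟩ := hf
  exact ⟨c1.neg, M1, fun x hx => by rw [abs_neg]; exact h1 x hx⟩

lemma CB.sub {Ω : Set E2} {f g : E2 → ℝ} (hf : CB Ω f) (hg : CB Ω g) : CB Ω (fun x => f x - g x) := by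
  simpa only [sub_eq_add_neg] using hf.add hg.neg

lemma CB.abs {Ω : Set E2} {f : E2 → ℝ} (hf : CB Ω f) : CB Ω (fun x => |f x|) := by
  obtain ⟨c1, M1, h1⟩ := hf
  exact ⟨c1.abs, M1, fun x hx => by rw [abs_abs]; exact h1 x hx⟩

lemma CB.mul {Ω : Set E2} {f g : E2 → ℝ} (hf : CB Ω f) (hg : CB Ω g) : CB Ω (fun x => f x * g x) := by
  obtain ⟨c1, M1, h1⟩ := hf
  obtain ⟨c2, M2, h2⟩ := hg
  exact ⟨c1.mul c2, M1 * M2, fun x hx => by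
    rw [abs_mul]; exact mul_le_mul (h1 x hx) (h2 x hx) (abs_nonneg _) ((abs_nonneg _).trans (h1 x hx))⟩

lemma CB.const (Ω : Set E2) (c : ℝ) : CB Ω (fun _ => c) := ⟨continuousOn_const, |c|, fun _ _ => le_rfl⟩

lemma CB.int {Ω : Set E2} {w f : E2 → ℝ} (G : GoodDom Ω w) (hf : CB Ω f) : IntegrableOn f Ω := by
  obtain ⟨c1, M1, h1⟩ := hf
  exact G.integrableOn_of_bounded c1 h1

lemma CB.congr {Ω : Set E2} {f g : E2 → ℝ} (hf : CB Ω f) (h : ∀ x ∈ Ω, f x = g x) : CB Ω g := by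
  obtain ⟨c1, M1, h1⟩ := hf
  exact ⟨c1.congr fun x hx => (h x hx).symm, M1, fun x hx => by rw [← h x hx]; exact h1 x hx⟩

lemma CB.of_closure {Ω : Set E2} {w f : E2 → ℝ} (G : GoodDom Ω w) (hf : ContinuousOn f (closure Ω)) :
    CB Ω f := by
  obtain ⟨M, hM⟩ := G.isCompact_closure.exists_bound_of_continuousOn hf
  exact ⟨hf.mono subset_closure, M, fun x hx => hM x (subset_closure hx)⟩

lemma pd_comm' {Ω : Set E2} (hO : IsOpen Ω) {u : E2 → ℝ} (hu : ContDiffOn ℝ 2 u Ω) {x : E2} (hx : x ∈ Ω)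
    (i j : Fin 2) : pd i (pd j u) x = pd j (pd i u) x := by
  have hc : ContDiffAt ℝ 2 u x := hu.contDiffAt (hO.mem_nhds hx)
  have hs : IsSymmSndFDerivAt ℝ u x := hc.isSymmSndFDerivAt (by simp)
  have hd : DifferentiableAt ℝ (fderiv ℝ u) x :=
    (hc.fderiv_right (m := 1) (by norm_num)).differentiableAt (by simp)
  have e : ∀ i j : Fin 2, pd i (pd j u) x = fderiv ℝ (fderiv ℝ u) x (ee i) (ee j) := by
    intro i j
    unfold pd
    rw [fderiv_clm_apply hd (by fun_prop)]
    simp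
  rw [e, e]; exact hs.eq _ _

theorem pohozaev {Ω : Set E2} {w : E2 → ℝ} (G : GoodDom Ω w) {b C : ℝ} {A : ℝ≥0}
    {V W u v : E2 → ℝ} (S : Sys Ω w b C A V W u v) {O : Set E2} (hO : IsOpen O)
    (hcl : closure Ω ⊆ O) {Y0 Y1 : E2 → ℝ} (h0 : ContDiffOn ℝ 1 Y0 O) (h1 : ContDiffOn ℝ 1 Y1 O)
    (hbd : ∀ x ∈ frontier Ω, 0 ≤ Y0 x * pd 0 w x + Y1 x * pd 1 w x) :
    ∫ x in Ω, (pd 0 Y0 x + pd 1 Y1 x) *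
      (V x * (Real.exp (v x) - 1) + W x * (Real.exp (u x) - 1)) ≤
    A * (∫ x in Ω, (|Y0 x| + |Y1 x|) * (Real.exp (v x) - 1)) +
    A * (∫ x in Ω, (|Y0 x| + |Y1 x|) * (Real.exp (u x) - 1)) -
    ∫ x in Ω, ((pd 0 u x * pd 0 v x - pd 1 u x * pd 1 v x) * (pd 0 Y0 x - pd 1 Y1 x) +
      (pd 0 u x * pd 1 v x + pd 1 u x * pd 0 v x) * (pd 0 Y1 x + pd 1 Y0 x)) := by
  have hΩ := G.isOpen
  have hΩO : Ω ⊆ O := subset_closure.trans hcl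
  -- regularity collection
  have gen : ∀ {u : E2 → ℝ}, Fn Ω w u → CB Ω u ∧ (∀ i, CB Ω (pd i u)) ∧ CB Ω (fun x => Real.exp (u x)) ∧
      (∀ i, ContDiffOn ℝ 1 (pd i u) Ω) ∧ (∀ x ∈ Ω, DifferentiableAt ℝ u x) ∧
      (∀ x ∈ Ω, ∀ i, DifferentiableAt ℝ (pd i u) x) := by
    intro u F
    have c1 : ∀ i, ContDiffOn ℝ 1 (pd i u) Ω := fun i => contDiffOn_pd hΩ F.C2 (by norm_num) i
    refine ⟨CB.of_closure G F.cont, fun i => ⟨(c1 i).continuousOn, ?_⟩,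
      CB.of_closure G (Real.continuous_exp.comp_continuousOn F.cont), c1,
      fun x hx => (F.C2.differentiableOn (by simp)).differentiableAt (hΩ.mem_nhds hx),
      fun x hx i => ((c1 i).differentiableOn (by simp)).differentiableAt (hΩ.mem_nhds hx)⟩
    obtain ⟨M, hM⟩ := F.grad
    exact ⟨M, fun x hx => hM x hx i⟩
  obtain ⟨bu, bpu, beu, cpu, du, dpu⟩ := gen S.S1.toFn
  obtain ⟨bv, bpv, bev, cpv, dv, dpv⟩ := gen S.S2.toFn
  have genY : ∀ {Y : E2 → ℝ}, ContDiffOn ℝ 1 Y O → CB Ω Y ∧ (∀ i, CB Ω (pd i Y)) ∧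
      (∀ x ∈ Ω, DifferentiableAt ℝ Y x) ∧ ContDiffOn ℝ 1 Y Ω := by
    intro Y hY
    exact ⟨CB.of_closure G (hY.continuousOn.mono hcl), fun i => CB.of_closure G ((continuousOn_pd hO hY i).mono hcl),
      fun x hx => (hY.differentiableOn (by simp)).differentiableAt (hO.mem_nhds (hΩO hx)), hY.mono hΩO⟩
  obtain ⟨bY0, bpY0, dY0, cY0⟩ := genY h0
  obtain ⟨bY1, bpY1, dY1, cY1⟩ := genY h1
  have bV : CB Ω V := CB.of_closure G S.LV.continuousOn
  have bW : CB Ω W := CB.of_closure G S.LW.continuousOn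
  -- the Lipschitz terms
  have lip : ∀ {V v : E2 → ℝ}, LipschitzOnWith A V (closure Ω) → Fn Ω w v →
      CB Ω V → (∀ x ∈ Ω, DifferentiableAt ℝ v x) → (∀ i, CB Ω (pd i v)) → CB Ω (fun x => Real.exp (v x)) →
      ∫ x in Ω, V x * ((pd 0 Y0 x + pd 1 Y1 x) * (Real.exp (v x) - 1) +
        Real.exp (v x) * (Y0 x * pd 0 v x + Y1 x * pd 1 v x)) ≤
      A * ∫ x in Ω, (|Y0 x| + |Y1 x|) * (Real.exp (v x) - 1) := by
    intro V v LV F bV dv bpv bev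
    have be1 : CB Ω (fun x => Real.exp (v x) - 1) := bev.sub (CB.const Ω 1)
    have ce1 : ContDiffOn ℝ 1 (fun x => Real.exp (v x) - 1) Ω :=
      ((F.C2.of_le (by norm_num)).exp).sub contDiffOn_const
    have de1 : ∀ x ∈ Ω, DifferentiableAt ℝ (fun x => Real.exp (v x) - 1) x := fun x hx =>
      ((dv x hx).exp).sub_const 1
    have pde1 : ∀ x ∈ Ω, ∀ i, pd i (fun x => Real.exp (v x) - 1) x = Real.exp (v x) * pd i v x := by
      intro x hx i
      have := pd_comp i (φ := fun t => Real.exp t - 1) (f := v) (x := x) (by fun_prop) (dv x hx)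
      rw [this]; simp
    have bZ : ∀ {Y : E2 → ℝ}, CB Ω Y → CB Ω (fun x => Y x * (Real.exp (v x) - 1)) := fun hY => hY.mul be1
    have ediv : ∀ x ∈ Ω, pd 0 (fun x => Y0 x * (Real.exp (v x) - 1)) x +
        pd 1 (fun x => Y1 x * (Real.exp (v x) - 1)) x =
        (pd 0 Y0 x + pd 1 Y1 x) * (Real.exp (v x) - 1) +
        Real.exp (v x) * (Y0 x * pd 0 v x + Y1 x * pd 1 v x) := by
      intro x hx
      rw [pd_mul 0 (dY0 x hx) (de1 x hx), pd_mul 1 (dY1 x hx) (de1 x hx), pde1 x hx, pde1 x hx]; ring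
    have bdiv : CB Ω (fun x => (pd 0 Y0 x + pd 1 Y1 x) * (Real.exp (v x) - 1) +
        Real.exp (v x) * (Y0 x * pd 0 v x + Y1 x * pd 1 v x)) :=
      (((bpY0 0).add (bpY1 1)).mul be1).add (bev.mul ((bY0.mul (bpv 0)).add (bY1.mul (bpv 1))))
    obtain ⟨-, M0, hM0⟩ := bZ bY0
    obtain ⟨-, M1, hM1⟩ := bZ bY1
    obtain ⟨-, M2, hM2⟩ := bdiv
    obtain ⟨-, Mv, hMv⟩ := bV
    have := G.lip_div LV hMv (cY0.mul ce1) (cY1.mul ce1) (M := max M0 (max M1 M2))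
      (fun x hx => (hM0 x hx).trans (le_max_left _ _))
      (fun x hx => (hM1 x hx).trans ((le_max_left _ _).trans (le_max_right _ _)))
      (fun x hx => by
        have h := ediv x hx
        have h' := hM2 x hx
        simp only at h'
        rw [← h] at h'
        exact h'.trans ((le_max_right _ _).trans (le_max_right _ _)))
      (by
        intro x0 hx0 ε hε
        have t1 : Tendsto (fun x => Real.exp (v x) - 1) (𝓝[Ω] x0) (𝓝 0) := by
          have := ((Real.continuous_exp.tendsto 0).comp (F.tend0 hx0)).sub_const 1
          simpa using this
        have tY : ∀ {Y : E2 → ℝ}, ContDiffOn ℝ 1 Y O → Tendsto Y (𝓝[Ω] x0) (𝓝 (Y x0)) := fun hY =>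
          ((hY.continuousOn.continuousAt (hO.mem_nhds (hcl (frontier_subset_closure hx0)))).tendsto).mono_left
            nhdsWithin_le_nhds
        have tw : ∀ i, Tendsto (pd i w) (𝓝[Ω] x0) (𝓝 (pd i w x0)) := fun i =>
          ((G.cont_pd i).tendsto x0).mono_left nhdsWithin_le_nhds
        have t2 := ((((tY h0).mul t1).mul (tw 0)).add (((tY h1).mul t1).mul (tw 1))).abs
        simp only [mul_zero, zero_mul, add_zero, abs_zero] at t2
        filter_upwards [t2.eventually (gt_mem_nhds hε)] with x hx
        exact hx.le)
    have h2 := (le_abs_self _).trans this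
    refine le_trans (le_of_eq ?_) (h2.trans (le_of_eq ?_))
    · apply setIntegral_congr_fun G.measurable
      intro x hx
      simp only
      rw [← ediv x hx]
    · congr 1
      apply setIntegral_congr_fun G.measurable
      intro x hx
      simp only [Pi.mul_apply]
      have : 0 ≤ Real.exp (v x) - 1 := by
        have := Real.one_le_exp (F.nonneg x (subset_closure hx)); linarith
      rw [abs_mul, abs_mul, abs_of_nonneg this]; ring
  have L1 := lip S.LV S.S2.toFn bV dv bpv bev
  have L2 := lip S.LW S.S1.toFn bW du bpu beu
  -- the stress tensor
  have T0 : ContDiffOn ℝ 1 (fun x => pd 0 u x * pd 0 v x - pd 1 u x * pd 1 v x) Ω :=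
    ((cpu 0).mul (cpv 0)).sub ((cpu 1).mul (cpv 1))
  have T1 : ContDiffOn ℝ 1 (fun x => pd 0 u x * pd 1 v x + pd 1 u x * pd 0 v x) Ω :=
    ((cpu 0).mul (cpv 1)).add ((cpu 1).mul (cpv 0))
  set t0 : E2 → ℝ := fun x => pd 0 u x * pd 0 v x - pd 1 u x * pd 1 v x with ht0
  set t1 : E2 → ℝ := fun x => pd 0 u x * pd 1 v x + pd 1 u x * pd 0 v x with ht1
  have bt0 : CB Ω t0 := ((bpu 0).mul (bpv 0)).sub ((bpu 1).mul (bpv 1))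
  have bt1 : CB Ω t1 := ((bpu 0).mul (bpv 1)).add ((bpu 1).mul (bpv 0))
  have dt0 : ∀ x ∈ Ω, DifferentiableAt ℝ t0 x := fun x hx =>
    (T0.differentiableOn (by simp)).differentiableAt (hΩ.mem_nhds hx)
  have dt1 : ∀ x ∈ Ω, DifferentiableAt ℝ t1 x := fun x hx =>
    (T1.differentiableOn (by simp)).differentiableAt (hΩ.mem_nhds hx)
  have cF0 : ContDiffOn ℝ 1 (fun x => t0 x * Y0 x + t1 x * Y1 x) Ω := (T0.mul cY0).add (T1.mul cY1)
  have cF1 : ContDiffOn ℝ 1 (fun x => t1 x * Y0 x - t0 x * Y1 x) Ω := (T1.mul cY0).sub (T0.mul cY1)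
  set td : E2 → ℝ := fun x => t0 x * (pd 0 Y0 x - pd 1 Y1 x) + t1 x * (pd 0 Y1 x + pd 1 Y0 x) with htd
  have btd : CB Ω td := (bt0.mul ((bpY0 0).sub (bpY1 1))).add (bt1.mul ((bpY1 0).add (bpY0 1)))
  set fv : E2 → ℝ := fun x => V x * (Real.exp (v x) * (Y0 x * pd 0 v x + Y1 x * pd 1 v x)) with hfv
  set gu : E2 → ℝ := fun x => W x * (Real.exp (u x) * (Y0 x * pd 0 u x + Y1 x * pd 1 u x)) with hgu
  have bfv : CB Ω fv := bV.mul (bev.mul ((bY0.mul (bpv 0)).add (bY1.mul (bpv 1))))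
  have bgu : CB Ω gu := bW.mul (beu.mul ((bY0.mul (bpu 0)).add (bY1.mul (bpu 1))))
  have ediv : ∀ x ∈ Ω, pd 0 (fun x => t0 x * Y0 x + t1 x * Y1 x) x +
      pd 1 (fun x => t1 x * Y0 x - t0 x * Y1 x) x = td x - fv x - gu x := by
    intro x hx
    have p0 : ∀ i, pd i t0 x = (pd 0 u x * pd i (pd 0 v) x + pd 0 v x * pd i (pd 0 u) x) -
        (pd 1 u x * pd i (pd 1 v) x + pd 1 v x * pd i (pd 1 u) x) := by
      intro i
      rw [ht0, pd_sub i (f := fun x => pd 0 u x * pd 0 v x) (g := fun x => pd 1 u x * pd 1 v x)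
        ((dpu x hx 0).fun_mul (dpv x hx 0)) ((dpu x hx 1).fun_mul (dpv x hx 1)),
        pd_mul i (dpu x hx 0) (dpv x hx 0), pd_mul i (dpu x hx 1) (dpv x hx 1)]
    have p1 : ∀ i, pd i t1 x = (pd 0 u x * pd i (pd 1 v) x + pd 1 v x * pd i (pd 0 u) x) +
        (pd 1 u x * pd i (pd 0 v) x + pd 0 v x * pd i (pd 1 u) x) := by
      intro i
      rw [ht1, pd_add i (f := fun x => pd 0 u x * pd 1 v x) (g := fun x => pd 1 u x * pd 0 v x)
        ((dpu x hx 0).fun_mul (dpv x hx 1)) ((dpu x hx 1).fun_mul (dpv x hx 0)),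
        pd_mul i (dpu x hx 0) (dpv x hx 1), pd_mul i (dpu x hx 1) (dpv x hx 0)]
    rw [pd_add 0 (f := fun x => t0 x * Y0 x) (g := fun x => t1 x * Y1 x)
      ((dt0 x hx).fun_mul (dY0 x hx)) ((dt1 x hx).fun_mul (dY1 x hx)),
      pd_sub 1 (f := fun x => t1 x * Y0 x) (g := fun x => t0 x * Y1 x)
      ((dt1 x hx).fun_mul (dY0 x hx)) ((dt0 x hx).fun_mul (dY1 x hx)),
      pd_mul 0 (dt0 x hx) (dY0 x hx), pd_mul 0 (dt1 x hx) (dY1 x hx),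
      pd_mul 1 (dt1 x hx) (dY0 x hx), pd_mul 1 (dt0 x hx) (dY1 x hx), p0, p0, p1, p1]
    have cu := pd_comm' hΩ S.S1.C2 hx 0 1
    have cv := pd_comm' hΩ S.S2.C2 hx 0 1
    have eu := S.S1.eq x hx
    have ev := S.S2.eq x hx
    rw [lap_eq] at eu ev
    have eu' : pd 1 (pd 1 u) x = -(V x * Real.exp (v x)) - pd 0 (pd 0 u) x := by linarith
    have ev' : pd 1 (pd 1 v) x = -(W x * Real.exp (u x)) - pd 0 (pd 0 v) x := by linarith
    simp only [htd, hfv, hgu]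
    rw [cu, cv, eu', ev']
    ring
  have bd : CB Ω (fun x => td x - fv x - gu x) := (btd.sub bfv).sub bgu
  obtain ⟨-, M, hM⟩ := bd
  have D := G.div_le cF0 cF1 (M := M) (fun x hx => by rw [ediv x hx]; exact hM x hx) (by
    intro x0 hx0 ε hε
    obtain ⟨l, hl, tu⟩ := S.S1.tend x0 hx0
    obtain ⟨l', hl', tv⟩ := S.S2.tend x0 hx0
    have tY : ∀ {Y : E2 → ℝ}, ContDiffOn ℝ 1 Y O → Tendsto Y (𝓝[Ω] x0) (𝓝 (Y x0)) := fun hY =>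
      ((hY.continuousOn.continuousAt (hO.mem_nhds (hcl (frontier_subset_closure hx0)))).tendsto).mono_left
        nhdsWithin_le_nhds
    have tw : ∀ i, Tendsto (pd i w) (𝓝[Ω] x0) (𝓝 (pd i w x0)) := fun i =>
      ((G.cont_pd i).tendsto x0).mono_left nhdsWithin_le_nhds
    have tt0 := ((tu 0).mul (tv 0)).sub ((tu 1).mul (tv 1))
    have tt1 := ((tu 0).mul (tv 1)).add ((tu 1).mul (tv 0))
    have tt := (((tt0.mul (tY h0)).add (tt1.mul (tY h1))).mul (tw 0)).add
      (((tt1.mul (tY h0)).sub (tt0.mul (tY h1))).mul (tw 1))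
    have hpos : 0 ≤ l * l' * (pd 0 w x0 ^ 2 + pd 1 w x0 ^ 2) * (Y0 x0 * pd 0 w x0 + Y1 x0 * pd 1 w x0) :=
      mul_nonneg (mul_nonneg (mul_nonneg hl hl') (by positivity)) (hbd x0 hx0)
    filter_upwards [tt.eventually (lt_mem_nhds (a := -ε) (by nlinarith))] with x hx
    exact hx.le)
  rw [setIntegral_congr_fun G.measurable ediv] at D
  have I1 : CB Ω (fun x => V x * ((pd 0 Y0 x + pd 1 Y1 x) * (Real.exp (v x) - 1))) :=
    bV.mul (((bpY0 0).add (bpY1 1)).mul (bev.sub (CB.const Ω 1)))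
  have I2 : CB Ω (fun x => W x * ((pd 0 Y0 x + pd 1 Y1 x) * (Real.exp (u x) - 1))) :=
    bW.mul (((bpY0 0).add (bpY1 1)).mul (beu.sub (CB.const Ω 1)))
  have e1 : ∫ x in Ω, V x * ((pd 0 Y0 x + pd 1 Y1 x) * (Real.exp (v x) - 1) +
        Real.exp (v x) * (Y0 x * pd 0 v x + Y1 x * pd 1 v x)) =
      (∫ x in Ω, V x * ((pd 0 Y0 x + pd 1 Y1 x) * (Real.exp (v x) - 1))) + ∫ x in Ω, fv x := by
    rw [← integral_add (I1.int G) (bfv.int G)]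
    congr 1; ext x; simp only [hfv]; ring
  have e2 : ∫ x in Ω, W x * ((pd 0 Y0 x + pd 1 Y1 x) * (Real.exp (u x) - 1) +
        Real.exp (u x) * (Y0 x * pd 0 u x + Y1 x * pd 1 u x)) =
      (∫ x in Ω, W x * ((pd 0 Y0 x + pd 1 Y1 x) * (Real.exp (u x) - 1))) + ∫ x in Ω, gu x := by
    rw [← integral_add (I2.int G) (bgu.int G)]
    congr 1; ext x; simp only [hgu]; ring
  have e3 : ∫ x in Ω, (pd 0 Y0 x + pd 1 Y1 x) *
      (V x * (Real.exp (v x) - 1) + W x * (Real.exp (u x) - 1)) =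
      (∫ x in Ω, V x * ((pd 0 Y0 x + pd 1 Y1 x) * (Real.exp (v x) - 1))) +
      ∫ x in Ω, W x * ((pd 0 Y0 x + pd 1 Y1 x) * (Real.exp (u x) - 1)) := by
    rw [← integral_add (I1.int G) (I2.int G)]
    congr 1; ext x; ring
  have e4 : ∫ x in Ω, (td x - fv x - gu x) = (∫ x in Ω, td x) - (∫ x in Ω, fv x) - ∫ x in Ω, gu x := by
    rw [integral_sub ((btd.sub bfv).int G) (bgu.int G), integral_sub (btd.int G) (bfv.int G)]
  rw [e3]
  rw [e1] at L1
  rw [e2] at L2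
  rw [e4] at D
  linarith



lemma GoodDom.frontier_null {Ω : Set E2} {w : E2 → ℝ} (G : GoodDom Ω w) :
    volume (frontier Ω) = 0 := by
  have hm : MeasurableSet (frontier Ω) := isClosed_frontier.measurableSet
  have hA : ApproximatesLinearOn (fun x => w x • ee 0) (0 : E2 →L[ℝ] E2) (frontier Ω) (0 : ℝ≥0) := by
    intro x hx y hy
    simp [G.frontier_zero hx, G.frontier_zero hy]
  have h := hA.norm_fderiv_sub_le volume hm (fun x => (fderiv ℝ w x).smulRight (ee 0)) (by
    intro x hx
    exact ((((G.smooth' 1).differentiable (by simp)) x).hasFDerivAt.smul_const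
      (ee 0)).hasFDerivWithinAt)
  have h2 : ∀ᵐ x ∂(volume.restrict (frontier Ω)), False := by
    filter_upwards [h, ae_restrict_mem hm] with x hx hxm
    apply G.nz x hxm
    rw [sub_zero] at hx
    have hne : ee 0 ≠ 0 := by
      intro h; have := congrArg (fun z : E2 => z 0) h; simp [ee] at this
    have := le_antisymm hx (zero_le)
    simpa [hne] using this
  rw [ae_iff] at h2
  simpa using h2

def Cv (t : ℝ) (i : Fin 2) (H : E2 → ℝ) (z : E2) : ℝ := ∫ y, H (z + y) * pd i (lam t) y

lemma lam_pd_contDiff (t : ℝ) (i : Fin 2) : ContDiff ℝ 1 (pd i (lam t)) :=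
  contDiff_pd (lam_contDiff t) (by norm_num) i

lemma Cv_eq (t : ℝ) (i : Fin 2) (H : E2 → ℝ) :
    Cv t i H = convolution (fun y => pd i (lam t) (-y)) H (ContinuousLinearMap.mul ℝ ℝ) volume := by
  funext z
  unfold Cv convolution
  rw [← integral_neg_eq_self]
  apply integral_congr_ae
  filter_upwards with y
  simp only [ContinuousLinearMap.mul_apply', sub_eq_add_neg]
  ring

lemma lam_neg_loc (t : ℝ) (i : Fin 2) :
    LocallyIntegrable (fun y => pd i (lam t) (-y)) volume :=
  ((lam_pd_contDiff t i).continuous.comp continuous_neg).locallyIntegrable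

lemma Cv_contDiff (t : ℝ) (i : Fin 2) {H : E2 → ℝ} (hH : ContDiff ℝ 1 H)
    (hc : HasCompactSupport H) : ContDiff ℝ 1 (Cv t i H) := by
  rw [Cv_eq]
  exact hc.contDiff_convolution_right (n := 1) _ (lam_neg_loc t i) hH

lemma Cv_pd (t : ℝ) (i j : Fin 2) {H : E2 → ℝ} (hH : ContDiff ℝ 1 H)
    (hc : HasCompactSupport H) (z : E2) : pd j (Cv t i H) z = Cv t i (pd j H) z := by
  rw [Cv_eq, Cv_eq]
  change fderiv ℝ _ z (ee j) = convolution _ (fun x => fderiv ℝ H x (ee j)) _ _ z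
  rw [(hc.hasFDerivAt_convolution_right (ContinuousLinearMap.mul ℝ ℝ) (lam_neg_loc t i) hH z).fderiv]
  rw [convolution_precompR_apply _ (lam_neg_loc t i) (hc.fderiv ℝ) (hH.continuous_fderiv one_ne_zero)]

lemma Cv_supp {H : E2 → ℝ} (hc : HasCompactSupport H) (z : E2) :
    HasCompactSupport (fun y => H (z + y)) :=
  hc.comp_homeomorph (Homeomorph.addLeft z)

lemma Cv_int {H K : E2 → ℝ} (hH : Continuous H)
    (hc : HasCompactSupport H) (hK : Continuous K) (z : E2) :
    Integrable (fun y => H (z + y) * K y) := by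
  apply integrable_mul_of_tsupport isOpen_univ (hH.comp (by fun_prop)) (Cv_supp hc z) (subset_univ _)
    hK.continuousOn

lemma Cv_ibp (t : ℝ) (i j : Fin 2) {H : E2 → ℝ} (hH : ContDiff ℝ 1 H)
    (hc : HasCompactSupport H) (z : E2) :
    Cv t i (pd j H) z = - ∫ y, H (z + y) * pd j (pd i (lam t)) y := by
  have e : ∀ y, pd j H (z + y) = pd j (fun y => H (z + y)) y := by
    intro y; unfold pd; rw [fderiv_comp_add_left]
  have h := ibp (ψ := fun y => H (z + y)) isOpen_univ (hH.comp (by fun_prop)) (Cv_supp hc z)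
    (subset_univ _) (lam_pd_contDiff t i).contDiffOn j
  unfold Cv
  simp_rw [e]
  rw [h, neg_neg]

lemma Cv_cpt1 {H : E2 → ℝ} (hH : ContDiff ℝ 1 H) (j : Fin 2) : Continuous (pd j H) :=
  (contDiff_pd hH (m := 0) (by simp) j).continuous

/-- `∂₀F₀ + ∂₁F₁` type combination. -/
lemma Cv_lap (t : ℝ) {H : E2 → ℝ} (hH : Continuous H) (hc : HasCompactSupport H) (z : E2) :
    (∫ y, H (z + y) * pd 0 (pd 0 (lam t)) y) + (∫ y, H (z + y) * pd 1 (pd 1 (lam t)) y)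
      = ∫ y, H (z + y) * qt t y := by
  rw [← integral_add]
  · congr 1; funext y; rw [← lap_lam]; ring
  · exact Cv_int hH hc (Cv_cpt1 (lam_pd_contDiff t 0) 0) z
  · exact Cv_int hH hc (Cv_cpt1 (lam_pd_contDiff t 1) 1) z

lemma Cv_mixed (t : ℝ) {H : E2 → ℝ} (z : E2) :
    (∫ y, H (z + y) * pd 0 (pd 1 (lam t)) y) = (∫ y, H (z + y) * pd 1 (pd 0 (lam t)) y) := by
  congr 1; funext y; rw [pd_comm' isOpen_univ (lam_contDiff t).contDiffOn (mem_univ y) 0 1]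

lemma qt_avg {t : ℝ} (ht : 0 < t) {H : E2 → ℝ} (hH : Continuous H) (hc : HasCompactSupport H)
    (z : E2) {c ε : ℝ} (h : ∀ y, ‖y‖ ≤ t → |H (z + y) - c| ≤ ε) :
    |(∫ y, H (z + y) * qt t y) - 2 * π * c| ≤ 2 * π * ε := by
  have hi := qt_integral ht
  have hq := qt_integrable ht
  have h1 : (∫ y, H (z + y) * qt t y) - 2 * π * c = ∫ y, (H (z + y) - c) * qt t y := by
    rw [← hi, ← integral_mul_const, ← integral_sub (Cv_int hH hc (qt_cont t) z) (hq.mul_const c)]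
    congr 1; funext y; ring
  rw [h1, ← hi, ← integral_mul_const, ← Real.norm_eq_abs]
  apply norm_integral_le_of_norm_le (hq.mul_const ε)
  filter_upwards with y
  rw [Real.norm_eq_abs, abs_mul, abs_of_nonneg (qt_nonneg t y), mul_comm]
  rcases le_or_gt ‖y‖ t with hy | hy
  · exact mul_le_mul_of_nonneg_left (h y hy) (qt_nonneg t y)
  · simp [qt_zero_of_gt ht hy]

lemma Cv_small {t : ℝ} (ht : 0 < t) (i : Fin 2) {H : E2 → ℝ} {U : Set E2} {M ρ : ℝ} (hρ : 0 < ρ)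
    (hM : 0 ≤ M) (hU : MeasurableSet U) (hUv : volume U ≤ ENNReal.ofReal (ρ ^ 2))
    (hb : ∀ x, |H x| ≤ M) (h0 : ∀ x, x ∉ U → H x = 0) (z : E2) :
    |Cv t i H z| ≤ M * (8 * ρ) := by
  have hfin : volume U ≠ ⊤ := ne_top_of_le_ne_top ENNReal.ofReal_ne_top hUv
  obtain ⟨r1, r2⟩ := rpow_integral' (a := 1) (by norm_num) hρ (0 : E2)
  have r1' : Integrable ((ball (0:E2) ρ).indicator (fun y : E2 => ‖y - 0‖ ^ (-1:ℝ))) :=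
    (integrable_indicator_iff measurableSet_ball).2 r1
  have u1 : Integrable (U.indicator (fun _ => (1:ℝ))) :=
    (integrable_indicator_iff hU).2 (integrableOn_const hfin)
  have u2 : Integrable (fun y => U.indicator (fun _ => (1:ℝ)) (z + y)) := u1.comp_add_left z
  have u3 : ∫ y, U.indicator (fun _ => (1:ℝ)) (z + y) ≤ ρ ^ 2 := by
    rw [integral_add_left_eq_self, integral_indicator hU]
    simp only [integral_const, smul_eq_mul, mul_one, measureReal_restrict_apply_univ]
    exact ENNReal.toReal_le_of_le_ofReal (by positivity) hUv
  have key : |Cv t i H z| ≤ ∫ y, M * ((ball (0:E2) ρ).indicator (fun y : E2 => ‖y - 0‖ ^ (-1:ℝ)) y +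
      ρ⁻¹ * U.indicator (fun _ => (1:ℝ)) (z + y)) := by
    unfold Cv
    rw [← Real.norm_eq_abs]
    apply norm_integral_le_of_norm_le ((r1'.add (u2.const_mul _)).const_mul M)
    filter_upwards with y
    rw [Real.norm_eq_abs, abs_mul]
    have hk := abs_pd_lam_le ht i y
    have n1 : 0 ≤ (ball (0:E2) ρ).indicator (fun y : E2 => ‖y - 0‖ ^ (-1:ℝ)) y :=
      indicator_nonneg (fun y _ => by positivity) y
    have n2 : 0 ≤ ρ⁻¹ * U.indicator (fun _ => (1:ℝ)) (z + y) :=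
      mul_nonneg (by positivity) (indicator_nonneg (fun y _ => by positivity) _)
    by_cases hz : z + y ∈ U
    · refine mul_le_mul (hb _) (hk.trans ?_) (abs_nonneg _) hM
      simp only [Pi.add_apply]
      by_cases hy : y ∈ ball (0:E2) ρ
      · rw [indicator_of_mem hy] at n1 ⊢
        rw [sub_zero, Real.rpow_neg_one]
        linarith
      · have : ρ ≤ ‖y‖ := by simpa using hy
        rw [indicator_of_mem hz, mul_one]
        have h3 : ‖y‖⁻¹ ≤ ρ⁻¹ := by gcongr
        linarith
    · rw [h0 _ hz]; simp only [abs_zero, zero_mul]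
      exact mul_nonneg hM (add_nonneg n1 n2)
  refine key.trans ?_
  rw [integral_const_mul]
  apply mul_le_mul_of_nonneg_left _ hM
  rw [integral_add r1' (u2.const_mul _), integral_const_mul, integral_indicator measurableSet_ball, r2]
  have e1 : ρ ^ ((2:ℝ) - 1) / (2 - 1) = ρ := by norm_num
  rw [e1]
  have h5 : ρ⁻¹ * ∫ y, U.indicator (fun _ => (1:ℝ)) (z + y) ≤ ρ⁻¹ * ρ ^ 2 := by gcongr
  have h6 : ρ⁻¹ * ρ ^ 2 = ρ := by field_simp
  nlinarith [Real.pi_lt_d2]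

lemma Cv_sub (t : ℝ) (i : Fin 2) {H K : E2 → ℝ} (hH : Continuous H) (hK : Continuous K)
    (hc : HasCompactSupport H) (hc' : HasCompactSupport K) (z : E2) :
    Cv t i (fun x => H x - K x) z = Cv t i H z - Cv t i K z := by
  unfold Cv
  rw [← integral_sub (Cv_int hH hc (lam_pd_contDiff t i).continuous z)
    (Cv_int hK hc' (lam_pd_contDiff t i).continuous z)]
  congr 1; funext y; ring

lemma Cv_add (t : ℝ) (i : Fin 2) {H K : E2 → ℝ} (hH : Continuous H) (hK : Continuous K)
    (hc : HasCompactSupport H) (hc' : HasCompactSupport K) (z : E2) :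
    Cv t i (fun x => H x + K x) z = Cv t i H z + Cv t i K z := by
  unfold Cv
  rw [← integral_add (Cv_int hH hc (lam_pd_contDiff t i).continuous z)
    (Cv_int hK hc' (lam_pd_contDiff t i).continuous z)]
  congr 1; funext y; ring

lemma fieldX_pre {Ω : Set E2} {w : E2 → ℝ} (G : GoodDom Ω w) {ε : ℝ} (hε : 0 < ε) :
    ∃ X0 X1 : E2 → ℝ, ContDiff ℝ 1 X0 ∧ ContDiff ℝ 1 X1 ∧
      (∀ x ∈ frontier Ω, |X0 x - pd 0 w x| ≤ ε ∧ |X1 x - pd 1 w x| ≤ ε) ∧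
      ∃ Q, IsCompact Q ∧ Q ⊆ Ω ∧ ∀ x ∈ Ω \ Q, pd 0 X0 x = pd 1 X1 x ∧ pd 0 X1 x = - pd 1 X0 x := by
  set N : Fin 2 → E2 → ℝ := fun i => pd i w with hN
  have hN2 : ∀ i, ContDiff ℝ 2 (N i) := fun i => contDiff_pd (G.smooth' 3) (by norm_num) i
  have hN1 : ∀ i, ContDiff ℝ 1 (N i) := fun i => (hN2 i).of_le (by norm_num)
  have hNc : ∀ i, HasCompactSupport (N i) := fun i => hasCompactSupport_pd i G.cpt
  have hP1 : ∀ i j, ContDiff ℝ 1 (pd j (N i)) := fun i j => contDiff_pd (hN2 i) (by norm_num) j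
  have hPc : ∀ i j, HasCompactSupport (pd j (N i)) := fun i j => hasCompactSupport_pd j (hNc i)
  set a : E2 → ℝ := fun x => pd 0 (N 0) x - pd 1 (N 1) x with ha
  set b : E2 → ℝ := fun x => pd 0 (N 1) x + pd 1 (N 0) x with hb
  have a1 : ContDiff ℝ 1 a := (hP1 0 0).sub (hP1 1 1)
  have b1 : ContDiff ℝ 1 b := (hP1 1 0).add (hP1 0 1)
  have ac : HasCompactSupport a := (hPc 0 0).sub (hPc 1 1)
  have bc : HasCompactSupport b := (hPc 1 0).add (hPc 0 1)
  obtain ⟨Ma, hMa⟩ := ac.exists_bound_of_continuous a1.continuous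
  obtain ⟨Mb, hMb⟩ := bc.exists_bound_of_continuous b1.continuous
  set M := max (max Ma Mb) 1 with hMdef
  have hM1 : 1 ≤ M := le_max_right _ _
  have hMa' : ∀ x, |a x| ≤ M := fun x => (hMa x).trans ((le_max_left _ _).trans (le_max_left _ _))
  have hMb' : ∀ x, |b x| ≤ M := fun x => (hMb x).trans ((le_max_right _ _).trans (le_max_left _ _))
  set ρ := ε / (16 * M) with hρdef
  have hρ : 0 < ρ := by positivity
  obtain ⟨U, hUf, hUo, hUv⟩ := Set.exists_isOpen_lt_of_lt (μ := (volume : Measure E2)) (frontier Ω)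
    (ENNReal.ofReal (ρ ^ 2)) (by rw [G.frontier_null]; simpa using pow_pos hρ 2)
  obtain ⟨κ, κs, κ01, κ0, κ1⟩ := exists_bump (s := Uᶜ) (t := frontier Ω) hUo.isClosed_compl
    isClosed_frontier (disjoint_compl_left_iff_subset.2 hUf)
  have κc1 : ContDiff ℝ 1 κ := contDiff_infty.1 κs 1
  have κU : ∀ x, x ∉ U → κ x = 0 := fun x hx => subset_of_mem_nhdsSet κ0 hx
  obtain ⟨V, hVo, hVf, hV1⟩ := mem_nhdsSet_iff_exists.1 κ1
  obtain ⟨t1, ht1, ht1V⟩ := G.isCompact_frontier.exists_cthickening_subset_open hVo hVf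
  -- uniform continuity
  have huc : ∀ i, ∃ δ > 0, ∀ x y : E2, dist x y < δ → dist (N i x) (N i y) < ε / 2 := fun i =>
    Metric.uniformContinuous_iff.1
      ((hNc i).uniformContinuous_of_continuous (hN1 i).continuous) (ε / 2) (by positivity)
  obtain ⟨δ0, hδ0, hd0⟩ := huc 0
  obtain ⟨δ1, hδ1, hd1⟩ := huc 1
  set t := min (t1 / 2) (min (δ0 / 2) (δ1 / 2)) with htdef
  have ht : 0 < t := by positivity
  have htt1 : t ≤ t1 / 2 := min_le_left _ _
  have ht0 : t ≤ δ0 / 2 := (min_le_right _ _).trans (min_le_left _ _)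
  have ht1' : t ≤ δ1 / 2 := (min_le_right _ _).trans (min_le_right _ _)
  set Ha : E2 → ℝ := fun x => a x - κ x * a x with hHa
  set Hb : E2 → ℝ := fun x => b x - κ x * b x with hHb
  have κa1 : ContDiff ℝ 1 (fun x => κ x * a x) := κc1.mul a1
  have κb1 : ContDiff ℝ 1 (fun x => κ x * b x) := κc1.mul b1
  have κac : HasCompactSupport (fun x => κ x * a x) := ac.mul_left
  have κbc : HasCompactSupport (fun x => κ x * b x) := bc.mul_left
  have Ha1 : ContDiff ℝ 1 Ha := a1.sub κa1
  have Hb1 : ContDiff ℝ 1 Hb := b1.sub κb1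
  have Hac : HasCompactSupport Ha := ac.sub κac
  have Hbc : HasCompactSupport Hb := bc.sub κbc
  have c0a := Cv_contDiff t 0 Ha1 Hac
  have c1a := Cv_contDiff t 1 Ha1 Hac
  have c0b := Cv_contDiff t 0 Hb1 Hbc
  have c1b := Cv_contDiff t 1 Hb1 Hbc
  set k : ℝ := - (2 * π)⁻¹ with hk
  have hpi := Real.pi_pos
  refine ⟨fun z => k * (Cv t 0 Ha z + Cv t 1 Hb z), fun z => k * (Cv t 0 Hb z - Cv t 1 Ha z),
    contDiff_const.mul (c0a.add c1b), contDiff_const.mul (c0b.sub c1a), ?_,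
    closure Ω \ thickening t (frontier Ω), G.isCompact_closure.diff isOpen_thickening, ?_, ?_⟩
  · intro z hz
    have sm : ∀ i, |Cv t i (fun x => κ x * a x) z| ≤ M * (8 * ρ) := fun i =>
      Cv_small ht i hρ (by positivity) hUo.measurableSet hUv.le (fun x => by
        rw [abs_mul, abs_of_nonneg (κ01 x).1]
        exact (mul_le_of_le_one_left (abs_nonneg _) (κ01 x).2).trans (hMa' x))
        (fun x hx => by simp [κU x hx]) z
    have sm' : ∀ i, |Cv t i (fun x => κ x * b x) z| ≤ M * (8 * ρ) := fun i =>
      Cv_small ht i hρ (by positivity) hUo.measurableSet hUv.le (fun x => by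
        rw [abs_mul, abs_of_nonneg (κ01 x).1]
        exact (mul_le_of_le_one_left (abs_nonneg _) (κ01 x).2).trans (hMb' x))
        (fun x hx => by simp [κU x hx]) z
    have eM : M * (8 * ρ) = ε / 2 := by rw [hρdef]; field_simp; norm_num
    have q0 := qt_avg ht (hN1 0).continuous (hNc 0) z (c := N 0 z) (ε := ε / 2) (fun y hy => by
      have := (hd0 (z + y) z (by simp [dist_eq_norm]; linarith)).le
      rwa [Real.dist_eq] at this)
    have q1 := qt_avg ht (hN1 1).continuous (hNc 1) z (c := N 1 z) (ε := ε / 2) (fun y hy => by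
      have := (hd1 (z + y) z (by simp [dist_eq_norm]; linarith)).le
      rwa [Real.dist_eq] at this)
    have l0 := Cv_lap t (hN1 0).continuous (hNc 0) z
    have l1 := Cv_lap t (hN1 1).continuous (hNc 1) z
    have m0 := Cv_mixed t (H := N 0) z
    have m1 := Cv_mixed t (H := N 1) z
    have I := fun i j k => Cv_ibp t i j (hN1 k) (hNc k) z
    have ea : ∀ i, Cv t i Ha z = Cv t i (pd 0 (N 0)) z - Cv t i (pd 1 (N 1)) z
        - Cv t i (fun x => κ x * a x) z := fun i => by
      rw [hHa, Cv_sub t i a1.continuous κa1.continuous ac κac, ha,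
        Cv_sub t i (hP1 0 0).continuous (hP1 1 1).continuous (hPc 0 0) (hPc 1 1)]
    have eb : ∀ i, Cv t i Hb z = Cv t i (pd 0 (N 1)) z + Cv t i (pd 1 (N 0)) z
        - Cv t i (fun x => κ x * b x) z := fun i => by
      rw [hHb, Cv_sub t i b1.continuous κb1.continuous bc κbc, hb,
        Cv_add t i (hP1 1 0).continuous (hP1 0 1).continuous (hPc 1 0) (hPc 0 1)]
    have hk2 : k * (2 * π) = -1 := by rw [hk]; field_simp
    have hka : |k| = (2 * π)⁻¹ := by rw [hk, abs_neg, abs_of_pos (by positivity)]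
    have fin : ∀ S m1 m2 n : ℝ, |S - 2 * π * n| ≤ 2 * π * (ε / 2) → |m1| ≤ ε / 2 → |m2| ≤ ε / 2 →
        |k * (-S - m1 - m2) - n| ≤ ε := by
      intro S m1 m2 n hS h1 h2
      have e1 : k * (-S - m1 - m2) - n = k * (-(S - 2 * π * n) - m1 - m2) := by
        linear_combination (-n) * hk2
      rw [e1, abs_mul, hka, inv_mul_le_iff₀ (by positivity)]
      have : |-(S - 2 * π * n) - m1 - m2| ≤ |S - 2 * π * n| + |m1| + |m2| := by
        refine (abs_sub _ _).trans ?_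
        gcongr
        refine (abs_sub _ _).trans ?_
        rw [abs_neg]
      nlinarith [Real.pi_gt_three]
    constructor
    · have e : Cv t 0 Ha z + Cv t 1 Hb z = -(∫ y, N 0 (z + y) * qt t y)
          - Cv t 0 (fun x => κ x * a x) z - Cv t 1 (fun x => κ x * b x) z := by
        rw [ea, eb, I, I, I, I]; linarith
      simp only [e]
      exact fin _ _ _ _ q0 ((sm 0).trans eM.le) ((sm' 1).trans eM.le)
    · have e : Cv t 0 Hb z - Cv t 1 Ha z = -(∫ y, N 1 (z + y) * qt t y)
          - Cv t 0 (fun x => κ x * b x) z - (- Cv t 1 (fun x => κ x * a x) z) := by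
        rw [ea, eb, I, I, I, I]; linarith
      simp only [e]
      exact fin _ _ _ _ q1 ((sm' 0).trans eM.le) (by rw [abs_neg]; exact (sm 1).trans eM.le)
  · rintro x ⟨hx, hx2⟩
    rcases G.mem_or_frontier hx with h | h
    · exact h
    · exact absurd (self_subset_thickening ht _ h) hx2
  · rintro x ⟨hxΩ, hxQ⟩
    have hxt : x ∈ thickening t (frontier Ω) := by
      by_contra h; exact hxQ ⟨subset_closure hxΩ, h⟩
    obtain ⟨p, hp, hxp⟩ := mem_thickening_iff.1 hxt
    have κone : ∀ y, ‖y‖ ≤ t → κ (x + y) = 1 := by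
      intro y hy
      apply hV1
      apply ht1V
      apply mem_cthickening_of_dist_le _ p _ _ hp
      have : dist (x + y) p ≤ dist (x + y) x + dist x p := dist_triangle _ _ _
      have h2 : dist (x + y) x = ‖y‖ := by simp [dist_eq_norm]
      linarith
    have zero : ∀ {h : E2 → ℝ}, ∫ y, (h (x + y) - κ (x + y) * h (x + y)) * qt t y = 0 := by
      intro h
      rw [← integral_zero E2 ℝ]
      congr 1; funext y
      rcases le_or_gt ‖y‖ t with hy | hy
      · simp [κone y hy]
      · simp [qt_zero_of_gt ht hy]
    have za : ∫ y, Ha (x + y) * qt t y = 0 := zero (h := a)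
    have zb : ∫ y, Hb (x + y) * qt t y = 0 := zero (h := b)
    rw [← Cv_lap t Ha1.continuous Hac] at za
    rw [← Cv_lap t Hb1.continuous Hbc] at zb
    have m0 := Cv_mixed t (H := Ha) x
    have m1 := Cv_mixed t (H := Hb) x
    have d : ∀ {h : E2 → ℝ}, ContDiff ℝ 1 h → DifferentiableAt ℝ h x := fun h =>
      h.differentiable (by simp) x
    constructor
    · rw [pd_const_mul 0 k ((d c0a).fun_add (d c1b)), pd_const_mul 1 k ((d c0b).fun_sub (d c1a)),
        pd_add 0 (d c0a) (d c1b), pd_sub 1 (d c0b) (d c1a), Cv_pd t _ _ Ha1 Hac, Cv_pd t _ _ Ha1 Hac,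
        Cv_pd t _ _ Hb1 Hbc, Cv_pd t _ _ Hb1 Hbc, Cv_ibp t _ _ Ha1 Hac, Cv_ibp t _ _ Ha1 Hac,
        Cv_ibp t _ _ Hb1 Hbc, Cv_ibp t _ _ Hb1 Hbc]
      linear_combination (-k) * za - k * m1
    · rw [pd_const_mul 0 k ((d c0b).fun_sub (d c1a)), pd_const_mul 1 k ((d c0a).fun_add (d c1b)),
        pd_add 1 (d c0a) (d c1b), pd_sub 0 (d c0b) (d c1a), Cv_pd t _ _ Ha1 Hac, Cv_pd t _ _ Ha1 Hac,
        Cv_pd t _ _ Hb1 Hbc, Cv_pd t _ _ Hb1 Hbc, Cv_ibp t _ _ Ha1 Hac, Cv_ibp t _ _ Ha1 Hac,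
        Cv_ibp t _ _ Hb1 Hbc, Cv_ibp t _ _ Hb1 Hbc]
      linear_combination (-k) * zb + k * m0

lemma fieldX {Ω : Set E2} {w : E2 → ℝ} (G : GoodDom Ω w) :
    ∃ X0 X1 : E2 → ℝ, ContDiff ℝ 1 X0 ∧ ContDiff ℝ 1 X1 ∧
      (∃ c > 0, ∀ x ∈ frontier Ω, c ≤ X0 x * pd 0 w x + X1 x * pd 1 w x) ∧
      ∃ Q, IsCompact Q ∧ Q ⊆ Ω ∧ ∀ x ∈ Ω \ Q, pd 0 X0 x = pd 1 X1 x ∧ pd 0 X1 x = - pd 1 X0 x := by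
  obtain ⟨c, hc, hlow⟩ := G.exists_grad_lower
  obtain ⟨M0, hM0⟩ := (hasCompactSupport_pd 0 G.cpt).exists_bound_of_continuous (G.cont_pd 0)
  obtain ⟨M1, hM1⟩ := (hasCompactSupport_pd 1 G.cpt).exists_bound_of_continuous (G.cont_pd 1)
  set M := max (max M0 M1) 1 with hM
  have hM' : 1 ≤ M := le_max_right _ _
  have h0 : ∀ x, |pd 0 w x| ≤ M := fun x => (hM0 x).trans ((le_max_left _ _).trans (le_max_left _ _))
  have h1 : ∀ x, |pd 1 w x| ≤ M := fun x => (hM1 x).trans ((le_max_right _ _).trans (le_max_left _ _))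
  set ε := c / (4 * M) with hε
  have hε0 : 0 < ε := by positivity
  obtain ⟨X0, X1, hX0, hX1, hfr, hQ⟩ := fieldX_pre G hε0
  refine ⟨X0, X1, hX0, hX1, ⟨c / 2, by positivity, ?_⟩, hQ⟩
  intro x hx
  obtain ⟨f0, f1⟩ := hfr x hx
  have e : ε * M = c / 4 := by rw [hε]; field_simp
  have a0 : |(X0 x - pd 0 w x) * pd 0 w x| ≤ c / 4 := by
    rw [abs_mul, ← e]; exact mul_le_mul f0 (h0 x) (abs_nonneg _) hε0.le
  have a1 : |(X1 x - pd 1 w x) * pd 1 w x| ≤ c / 4 := by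
    rw [abs_mul, ← e]; exact mul_le_mul f1 (h1 x) (abs_nonneg _) hε0.le
  have := hlow x hx
  nlinarith [neg_abs_le ((X0 x - pd 0 w x) * pd 0 w x), neg_abs_le ((X1 x - pd 1 w x) * pd 1 w x)]



lemma pd_sum {ι : Type*} (s : Finset ι) {f : ι → E2 → ℝ} {x : E2} (i : Fin 2)
    (h : ∀ k ∈ s, DifferentiableAt ℝ (f k) x) :
    pd i (fun y => ∑ k ∈ s, f k y) x = ∑ k ∈ s, pd i (f k) x := by
  unfold pd; rw [fderiv_fun_sum h]; simp

lemma GoodDom.ext_cond {Ω : Set E2} {w : E2 → ℝ} (G : GoodDom Ω w) :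
    ∃ K > 0, ∀ x0 ∈ frontier Ω, ∃ n0 n1 : ℝ, n0 ^ 2 + n1 ^ 2 = 1 ∧ ∀ z ∈ closure Ω,
      - K * ((z 0 - x0 0) ^ 2 + (z 1 - x0 1) ^ 2) ≤ n0 * (z 0 - x0 0) + n1 * (z 1 - x0 1) := by
  obtain ⟨c, hc, hlow⟩ := G.exists_grad_lower
  have hw2 : ContDiff ℝ 1 (fderiv ℝ w) := (G.smooth' 2).fderiv_right (by norm_num)
  obtain ⟨L, hL⟩ := hw2.lipschitzWith_of_hasCompactSupport (G.cpt.fderiv ℝ) (by simp)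
  refine ⟨(L + 1) / √c, by positivity, ?_⟩
  intro x0 hx0
  have hg := hlow x0 hx0
  set g := √(pd 0 w x0 ^ 2 + pd 1 w x0 ^ 2) with hgdef
  have hgc : √c ≤ g := Real.sqrt_le_sqrt hg
  have hcs : 0 < √c := Real.sqrt_pos.2 hc
  have hg0 : 0 < g := hcs.trans_le hgc
  have hgsq : g ^ 2 = pd 0 w x0 ^ 2 + pd 1 w x0 ^ 2 := Real.sq_sqrt (by positivity)
  refine ⟨pd 0 w x0 / g, pd 1 w x0 / g, ?_, ?_⟩
  · rw [div_pow, div_pow, ← add_div, ← hgsq, div_self (by positivity)]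
  · intro z hz
    set r2 := (z 0 - x0 0) ^ 2 + (z 1 - x0 1) ^ 2 with hr2
    have hn : ‖z - x0‖ ^ 2 = r2 := by rw [E2_norm_sq]; simp [hr2]
    have hmv := (convex_closedBall x0 ‖z - x0‖).norm_image_sub_le_of_norm_hasFDerivWithin_le'
      (f := w) (f' := fderiv ℝ w) (φ := fderiv ℝ w x0) (C := L * ‖z - x0‖) (x := x0) (y := z)
      (fun x _ => (((G.smooth' 1).differentiable (by simp)) x).hasFDerivAt.hasFDerivWithinAt)
      (fun x hx => by
        have := hL.norm_sub_le x x0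
        have h2 : ‖x - x0‖ ≤ ‖z - x0‖ := by simpa [dist_eq_norm] using hx
        exact this.trans (by gcongr)) (by simp) (by simp [dist_eq_norm])
    have hwz : 0 ≤ w z := by
      rcases G.mem_or_frontier hz with h | h
      · exact ((G.pos z).1 h).le
      · exact (G.frontier_zero h).ge
    rw [G.frontier_zero hx0, sub_zero, fderiv_eq_pd] at hmv
    have h3 := (abs_le.1 hmv).2
    simp only [PiLp.sub_apply] at h3
    have h4 : (L:ℝ) * ‖z - x0‖ * ‖z - x0‖ = L * r2 := by rw [← hn]; ring
    have hr0 : 0 ≤ r2 := by positivity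
    have h5 : -((L + 1) * r2) ≤ pd 0 w x0 * (z 0 - x0 0) + pd 1 w x0 * (z 1 - x0 1) := by
      nlinarith
    have h6 : pd 0 w x0 / g * (z 0 - x0 0) + pd 1 w x0 / g * (z 1 - x0 1) =
      (pd 0 w x0 * (z 0 - x0 0) + pd 1 w x0 * (z 1 - x0 1)) / g := by ring
    rw [h6, le_div_iff₀ hg0]
    have h7 : 1 ≤ g / √c := by rw [one_le_div hcs]; exact hgc
    have h8 : -((L + 1) / √c) * r2 * g = -((L + 1) * r2) * (g / √c) := by ring
    have h9 : 0 ≤ ((L:ℝ) + 1) * r2 := by positivity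
    rw [h8]; nlinarith

def dA (l n0 : ℝ) (x0 z : E2) : ℝ := z 0 - x0 0 + l * n0
def dB (l n1 : ℝ) (x0 z : E2) : ℝ := z 1 - x0 1 + l * n1
def dS (l n0 n1 : ℝ) (x0 z : E2) : ℝ := dA l n0 x0 z * dA l n0 x0 z + dB l n1 x0 z * dB l n1 x0 z
def yA (l n0 n1 : ℝ) (x0 z : E2) : ℝ :=
  l * n0 - l ^ 2 * (((n0 ^ 2 - n1 ^ 2) * dA l n0 x0 z + 2 * n0 * n1 * dB l n1 x0 z) * (dS l n0 n1 x0 z)⁻¹)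
def yB (l n0 n1 : ℝ) (x0 z : E2) : ℝ :=
  l * n1 - l ^ 2 * ((2 * n0 * n1 * dA l n0 x0 z - (n0 ^ 2 - n1 ^ 2) * dB l n1 x0 z) * (dS l n0 n1 x0 z)⁻¹)

section yfield
variable (l n0 n1 : ℝ) (x0 : E2)

lemma dA_contDiff {n : WithTop ℕ∞} : ContDiff ℝ n (dA l n0 x0) :=
  (((contDiff_coord 0).sub contDiff_const).add contDiff_const)
lemma dB_contDiff {n : WithTop ℕ∞} : ContDiff ℝ n (dB l n1 x0) :=
  (((contDiff_coord 1).sub contDiff_const).add contDiff_const)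
lemma dS_contDiff {n : WithTop ℕ∞} : ContDiff ℝ n (dS l n0 n1 x0) :=
  ((dA_contDiff l n0 x0).mul (dA_contDiff l n0 x0)).add ((dB_contDiff l n1 x0).mul (dB_contDiff l n1 x0))

lemma yA_contDiffOn {n : WithTop ℕ∞} : ContDiffOn ℝ n (yA l n0 n1 x0) {z | 0 < dS l n0 n1 x0 z} := by
  unfold yA
  refine contDiffOn_const.sub (contDiffOn_const.mul (ContDiffOn.mul ?_
    ((dS_contDiff l n0 n1 x0).contDiffOn.inv (fun z hz => ne_of_gt hz))))
  exact (contDiff_const.mul (dA_contDiff l n0 x0)).add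
    (contDiff_const.mul (dB_contDiff l n1 x0)) |>.contDiffOn

lemma yB_contDiffOn {n : WithTop ℕ∞} : ContDiffOn ℝ n (yB l n0 n1 x0) {z | 0 < dS l n0 n1 x0 z} := by
  unfold yB
  refine contDiffOn_const.sub (contDiffOn_const.mul (ContDiffOn.mul ?_
    ((dS_contDiff l n0 n1 x0).contDiffOn.inv (fun z hz => ne_of_gt hz))))
  exact (contDiff_const.mul (dA_contDiff l n0 x0)).sub
    (contDiff_const.mul (dB_contDiff l n1 x0)) |>.contDiffOn

lemma pd_of_line {f : E2 → ℝ} {x : E2} (hf : DifferentiableAt ℝ f x) (i : Fin 2) {c : ℝ}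
    (h : HasDerivAt (fun t : ℝ => f (x + t • ee i)) c 0) : pd i f x = c := by
  have := hf.hasFDerivAt.hasLineDerivAt (ee i)
  exact this.unique h

lemma pd_y {z : E2} (hz : 0 < dS l n0 n1 x0 z) :
    let a := dA l n0 x0 z
    let b := dB l n1 x0 z
    let s := dS l n0 n1 x0 z
    let D := l ^ 2 * ((n0 ^ 2 - n1 ^ 2) * (a ^ 2 - b ^ 2) + 4 * n0 * n1 * a * b) / s ^ 2
    let D' := l ^ 2 * (2 * n0 * n1 * (a ^ 2 - b ^ 2) - 2 * (n0 ^ 2 - n1 ^ 2) * a * b) / s ^ 2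
    pd 0 (yA l n0 n1 x0) z = D ∧ pd 1 (yB l n0 n1 x0) z = D ∧
    pd 0 (yB l n0 n1 x0) z = D' ∧ pd 1 (yA l n0 n1 x0) z = - D' := by
  intro a b s D D'
  have ho : IsOpen {z | 0 < dS l n0 n1 x0 z} :=
    isOpen_lt continuous_const (dS_contDiff (n := 0) l n0 n1 x0).continuous
  have hA : DifferentiableAt ℝ (yA l n0 n1 x0) z :=
    ((yA_contDiffOn (n := 1) l n0 n1 x0).differentiableOn (by simp)).differentiableAt (ho.mem_nhds hz)
  have hB : DifferentiableAt ℝ (yB l n0 n1 x0) z :=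
    ((yB_contDiffOn (n := 1) l n0 n1 x0).differentiableOn (by simp)).differentiableAt (ho.mem_nhds hz)
  have eA0 : ∀ t : ℝ, dA l n0 x0 (z + t • ee 0) = a + t := fun t => by simp [dA, ee, a]; ring
  have eA1 : ∀ t : ℝ, dA l n0 x0 (z + t • ee 1) = a := fun t => by simp [dA, ee, a]
  have eB0 : ∀ t : ℝ, dB l n1 x0 (z + t • ee 0) = b := fun t => by simp [dB, ee, b]
  have eB1 : ∀ t : ℝ, dB l n1 x0 (z + t • ee 1) = b + t := fun t => by simp [dB, ee, b]; ring
  have hs : s = a * a + b * b := rfl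
  have hs0 : s ≠ 0 := ne_of_gt hz
  have hda : HasDerivAt (fun t : ℝ => a + t) 1 0 := (hasDerivAt_id (0:ℝ)).const_add a
  have hdb : HasDerivAt (fun t : ℝ => b + t) 1 0 := (hasDerivAt_id (0:ℝ)).const_add b
  have inv0 := ((hda.fun_mul hda).add_const (b * b)).fun_inv (by simpa [← hs] using hs0)
  have inv1 := ((hdb.fun_mul hdb).const_add (a * a)).fun_inv (by simpa [← hs] using hs0)
  refine ⟨?_, ?_, ?_, ?_⟩
  · apply pd_of_line hA 0
    unfold yA dS
    simp only [eA0, eB0]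
    refine ((((((hda.const_mul (n0 ^ 2 - n1 ^ 2)).add_const (2 * n0 * n1 * b)).fun_mul inv0).const_mul
      (l ^ 2)).const_sub (l * n0))).congr_deriv ?_
    simp only [add_zero, ← hs, D]
    field_simp
    rw [hs]; ring
  · apply pd_of_line hB 1
    unfold yB dS
    simp only [eA1, eB1]
    refine ((((((hdb.const_mul (n0 ^ 2 - n1 ^ 2)).const_sub (2 * n0 * n1 * a)).fun_mul inv1).const_mul
      (l ^ 2)).const_sub (l * n1))).congr_deriv ?_
    simp only [add_zero, ← hs, D]
    field_simp
    rw [hs]; ring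
  · apply pd_of_line hB 0
    unfold yB dS
    simp only [eA0, eB0]
    refine ((((((hda.const_mul (2 * n0 * n1)).sub_const ((n0 ^ 2 - n1 ^ 2) * b)).fun_mul inv0).const_mul
      (l ^ 2)).const_sub (l * n1))).congr_deriv ?_
    simp only [add_zero, ← hs, D']
    field_simp
    rw [hs]; ring
  · apply pd_of_line hA 1
    unfold yA dS
    simp only [eA1, eB1]
    refine ((((((hdb.const_mul (2 * n0 * n1)).const_add ((n0 ^ 2 - n1 ^ 2) * a)).fun_mul inv1).const_mul
      (l ^ 2)).const_sub (l * n0))).congr_deriv ?_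
    simp only [add_zero, ← hs, D']
    field_simp
    rw [hs]; ring

end yfield



set_option maxHeartbeats 2000000 in
lemma y_alg {l n0 n1 p q K : ℝ} (hl : 0 < l) (hn : n0 ^ 2 + n1 ^ 2 = 1) (hK : l * K ≤ 1 / 4)
    (hx : - K * (p ^ 2 + q ^ 2) ≤ n0 * p + n1 * q) :
    let a := p + l * n0
    let b := q + l * n1
    let s := a * a + b * b
    let D := l ^ 2 * ((n0 ^ 2 - n1 ^ 2) * (a ^ 2 - b ^ 2) + 4 * n0 * n1 * a * b) / s ^ 2
    (p ^ 2 + q ^ 2 + l ^ 2) / 2 ≤ s ∧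
    (-(2 * (p ^ 2 + q ^ 2)⁻¹ * if l ^ 2 < 4 * (p ^ 2 + q ^ 2) then l ^ 2 else 0) ≤ D) ∧
    (256 * (p ^ 2 + q ^ 2) ≤ l ^ 2 → 1 / 2 ≤ D) ∧
    |l * n0 - l ^ 2 * (((n0 ^ 2 - n1 ^ 2) * a + 2 * n0 * n1 * b) * s⁻¹)| ≤ 2 * l ∧
    |l * n1 - l ^ 2 * ((2 * n0 * n1 * a - (n0 ^ 2 - n1 ^ 2) * b) * s⁻¹)| ≤ 2 * l := by
  intro a b s D
  set r2 := p ^ 2 + q ^ 2 with hr2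
  have hr0 : 0 ≤ r2 := by positivity
  set ξ := n0 * p + n1 * q with hξ
  set Q := n1 * p - n0 * q with hQ
  have hxq : ξ ^ 2 + Q ^ 2 = r2 := by
    rw [hξ, hQ, hr2]; linear_combination (p ^ 2 + q ^ 2) * hn
  have hs1 : s = r2 + 2 * l * ξ + l ^ 2 := by
    simp only [s, a, b, hξ, hr2]; linear_combination (l ^ 2) * hn
  have hs2 : s = (ξ + l) ^ 2 + Q ^ 2 := by rw [hs1, ← hxq]; ring
  have hnum : (n0 ^ 2 - n1 ^ 2) * (a ^ 2 - b ^ 2) + 4 * n0 * n1 * a * b = (ξ + l) ^ 2 - Q ^ 2 := by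
    have e1 : ξ + l = n0 * a + n1 * b := by
      simp only [a, b, hξ]; linear_combination (-l) * hn
    have e2 : Q = n1 * a - n0 * b := by simp only [a, b, hQ]; ring
    rw [e1, e2]; ring
  have hsl : (r2 + l ^ 2) / 2 ≤ s := by
    rw [hs1]
    nlinarith [mul_le_mul_of_nonneg_left hx hl.le, mul_le_mul_of_nonneg_right hK hr0]
  have hs0 : 0 < s := lt_of_lt_of_le (by positivity) hsl
  have hD : D = l ^ 2 * ((ξ + l) ^ 2 - Q ^ 2) / s ^ 2 := by simp only [D, hnum]
  have hQ2 : Q ^ 2 ≤ r2 := by nlinarith [sq_nonneg ξ]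
  have hξ2 : ξ ^ 2 ≤ r2 := by nlinarith [sq_nonneg Q]
  have hpq : ∀ c : ℝ, 0 < c → c ^ 2 * r2 ≤ l ^ 2 → |c * ξ| ≤ l := fun c hc h =>
    abs_le_of_sq_le_sq (by nlinarith [mul_le_mul_of_nonneg_left hξ2 (sq_nonneg c)]) hl.le
  have hY : ∀ X Z : ℝ, (X * s) ^ 2 + (Z * s) ^ 2 = l ^ 2 * (r2 * s) → |X| ≤ 2 * l := by
    intro X Z h
    apply abs_le_of_sq_le_sq _ (by positivity)
    have h1 : X ^ 2 * s ^ 2 ≤ (2 * l) ^ 2 * s ^ 2 := by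
      have h4 : r2 ≤ 4 * s := by linarith [sq_nonneg l]
      have : r2 * s ≤ 4 * s * s := mul_le_mul_of_nonneg_right h4 hs0.le
      have h5 := mul_le_mul_of_nonneg_left this (sq_nonneg l)
      have h6 : (2 * l) ^ 2 * s ^ 2 = l ^ 2 * (4 * s * s) := by ring
      have h7 : (X * s) ^ 2 = X ^ 2 * s ^ 2 := by ring
      linarith [sq_nonneg (Z * s)]
    exact le_of_mul_le_mul_right h1 (by positivity)
  set X := l * n0 - l ^ 2 * (((n0 ^ 2 - n1 ^ 2) * a + 2 * n0 * n1 * b) * s⁻¹) with hXd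
  set Z := l * n1 - l ^ 2 * ((2 * n0 * n1 * a - (n0 ^ 2 - n1 ^ 2) * b) * s⁻¹) with hZd
  have hXs : X * s = l * ((n0 * p - n1 * q) * a + (n0 * q + n1 * p) * b) := by
    rw [hXd, sub_mul, show l ^ 2 * (((n0 ^ 2 - n1 ^ 2) * a + 2 * n0 * n1 * b) * s⁻¹) * s =
      l ^ 2 * ((n0 ^ 2 - n1 ^ 2) * a + 2 * n0 * n1 * b) by field_simp]
    simp only [s, a, b]; ring
  have hZs : Z * s = l * ((n0 * q + n1 * p) * a - (n0 * p - n1 * q) * b) := by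
    rw [hZd, sub_mul, show l ^ 2 * ((2 * n0 * n1 * a - (n0 ^ 2 - n1 ^ 2) * b) * s⁻¹) * s =
      l ^ 2 * (2 * n0 * n1 * a - (n0 ^ 2 - n1 ^ 2) * b) by field_simp]
    simp only [s, a, b]; ring
  have hXZ : (X * s) ^ 2 + (Z * s) ^ 2 = l ^ 2 * (r2 * s) := by
    rw [hXs, hZs]
    have : (n0 * p - n1 * q) ^ 2 + (n0 * q + n1 * p) ^ 2 = r2 := by
      rw [hr2]; linear_combination (p ^ 2 + q ^ 2) * hn
    rw [← this]
    simp only [s]; ring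
  refine ⟨hsl, ?_, ?_, hY X Z hXZ, hY Z X (by linarith)⟩
  · rw [hD]
    split_ifs with h
    · have hr0' : 0 < r2 := by
        have : 0 < l ^ 2 := by positivity
        linarith
      rw [le_div_iff₀ (by positivity)]
      have h1 : - (l ^ 2 * s) ≤ l ^ 2 * ((ξ + l) ^ 2 - Q ^ 2) := by
        have : -s ≤ (ξ + l) ^ 2 - Q ^ 2 := by linarith [sq_nonneg (ξ + l)]
        linarith [mul_le_mul_of_nonneg_left this (sq_nonneg l)]
      refine le_trans ?_ h1
      have h2 : s ≤ 2 * r2⁻¹ * s ^ 2 := by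
        have : r2 ≤ 2 * s := by linarith [sq_nonneg l]
        have h3 : 2 * r2⁻¹ * s ^ 2 = (2 * s) * s / r2 := by field_simp
        rw [h3, le_div_iff₀ hr0', mul_comm]; exact mul_le_mul_of_nonneg_right this hs0.le
      have h8 := mul_le_mul_of_nonneg_left h2 (sq_nonneg l)
      have h9 : -(2 * r2⁻¹ * l ^ 2) * s ^ 2 = - (l ^ 2 * (2 * r2⁻¹ * s ^ 2)) := by ring
      linarith
    · simp only [mul_zero, neg_zero]
      have h1 := hpq 2 (by norm_num) (by linarith)
      have h2 := (abs_le.1 h1).1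
      have h3 : (l / 2) ^ 2 ≤ (ξ + l) ^ 2 := by gcongr; linarith
      have : 0 ≤ (ξ + l) ^ 2 - Q ^ 2 := by
        have : (l / 2) ^ 2 = l ^ 2 / 4 := by ring
        linarith
      positivity
  · intro h
    rw [hD, le_div_iff₀ (by positivity)]
    have h1 := hpq 16 (by norm_num) (by linarith)
    obtain ⟨h2, h3⟩ := abs_le.1 h1
    have h4 : (15 / 16 * l) ^ 2 ≤ (ξ + l) ^ 2 := by gcongr; linarith
    have h5 : (ξ + l) ^ 2 ≤ (17 / 16 * l) ^ 2 := by
      apply pow_le_pow_left₀ <;> linarith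
    have h6 : Q ^ 2 ≤ l ^ 2 / 256 := by linarith
    have h7 : s ≤ 290 / 256 * l ^ 2 := by
      have : (17 / 16 * l) ^ 2 = 289 / 256 * l ^ 2 := by ring
      rw [hs2]; linarith
    have h8 : s ^ 2 ≤ (290 / 256 * l ^ 2) ^ 2 := by gcongr
    have h9 : 224 / 256 * l ^ 2 ≤ (ξ + l) ^ 2 - Q ^ 2 := by
      have : (15 / 16 * l) ^ 2 = 225 / 256 * l ^ 2 := by ring
      linarith
    have h10 := mul_le_mul_of_nonneg_left h9 (sq_nonneg l)
    have h11 := pow_pos hl 4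
    have h12 : l ^ 2 * (224 / 256 * l ^ 2) = 224 / 256 * l ^ 4 := by ring
    have h13 : (290 / 256 * l ^ 2) ^ 2 = (290 / 256) ^ 2 * l ^ 4 := by ring
    linarith

lemma dyadic_sum (ρ B : ℝ) (m : ℕ) (hB : 0 ≤ B) :
    (∑ k ∈ Finset.range m, if (ρ * 2 ^ k) ^ 2 < B then (ρ * 2 ^ k) ^ 2 else 0) ≤ 4 / 3 * B ∧
    (∑ k ∈ Finset.range m, if (ρ * 2 ^ k) ^ 2 < B then (ρ * 2 ^ k) ^ 2 else 0) ≤ 1 / 3 * (ρ * 2 ^ m) ^ 2 := by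
  induction m with
  | zero => simp; constructor <;> positivity
  | succ m ih =>
    rw [Finset.sum_range_succ]
    have e : (ρ * 2 ^ (m + 1)) ^ 2 = 4 * (ρ * 2 ^ m) ^ 2 := by ring
    rw [e]
    have : 0 ≤ (ρ * 2 ^ m) ^ 2 := sq_nonneg _
    split_ifs with h
    · constructor <;> linarith [ih.1, ih.2]
    · constructor <;> linarith [ih.1, ih.2]

lemma fieldy {Ω : Set E2} {w : E2 → ℝ} (G : GoodDom Ω w) {η : ℝ} (hη : 0 < η) :
    ∃ s0 > 0, ∀ x0 ∈ frontier Ω, ∃ (O : Set E2) (y0 y1 : E2 → ℝ), IsOpen O ∧ closure Ω ⊆ O ∧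
      ContDiffOn ℝ 1 y0 O ∧ ContDiffOn ℝ 1 y1 O ∧
      (∀ x ∈ closure Ω, |y0 x| ≤ η ∧ |y1 x| ≤ η) ∧
      (∀ x ∈ Ω, pd 0 y0 x = pd 1 y1 x ∧ pd 0 y1 x = - pd 1 y0 x) ∧
      (∀ x ∈ Ω, -η ≤ pd 0 y0 x + pd 1 y1 x) ∧
      (∀ x ∈ Ω ∩ ball x0 s0, 1 ≤ pd 0 y0 x + pd 1 y1 x) := by
  obtain ⟨K, hK, hext⟩ := G.ext_cond
  obtain ⟨m', hm'⟩ := exists_nat_gt (22 / η)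
  have hm0 : (0:ℝ) < m' := lt_trans (by positivity) hm'
  set m := m' with hm
  have hm22 : 22 / (m:ℝ) ≤ η := by
    rw [div_le_iff₀ hm0]; rw [div_lt_iff₀ hη] at hm'; linarith
  set ρ := min (η / 2) (1 / (4 * K)) / 2 ^ m with hρ
  have hρ0 : 0 < ρ := by positivity
  have hρm : ρ * 2 ^ m = min (η / 2) (1 / (4 * K)) := by rw [hρ]; field_simp
  set L : ℕ → ℝ := fun k => ρ * 2 ^ k with hL
  have hL0 : ∀ k, 0 < L k := fun k => by positivity
  have hLm : ∀ k < m, L k ≤ ρ * 2 ^ m := fun k hk => by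
    simp only [hL]; gcongr; norm_num
  have hLη : ∀ k < m, 2 * L k ≤ η := fun k hk => by
    have := (hLm k hk).trans (hρm.le.trans (min_le_left _ _)); linarith
  have hLK : ∀ k < m, L k * K ≤ 1 / 4 := fun k hk => by
    have := (hLm k hk).trans (hρm.le.trans (min_le_right _ _))
    calc L k * K ≤ 1 / (4 * K) * K := by gcongr
      _ = 1 / 4 := by field_simp
  have hLρ : ∀ k, ρ ≤ L k := fun k => by
    simp only [hL]; exact le_mul_of_one_le_right hρ0.le (one_le_pow₀ (by norm_num))
  refine ⟨ρ / 16, by positivity, ?_⟩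
  intro x0 hx0
  obtain ⟨n0, n1, hn, hz⟩ := hext x0 hx0
  have alg := fun (k : ℕ) (hk : k < m) (z : E2) (hzc : z ∈ closure Ω) =>
    y_alg (hL0 k) hn (hLK k hk) (hz z hzc)
  have hdS : ∀ k < m, ∀ z ∈ closure Ω, 0 < dS (L k) n0 n1 x0 z := fun k hk z hzc => by
    have h1 := (alg k hk z hzc).1
    have h2 : 0 < (L k) ^ 2 := pow_pos (hL0 k) 2
    refine lt_of_lt_of_le ?_ h1
    positivity
  set O : Set E2 := ⋂ k ∈ Finset.range m, {z | 0 < dS (L k) n0 n1 x0 z} with hO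
  have hOo : IsOpen O := isOpen_biInter_finset fun k _ =>
    isOpen_lt continuous_const (dS_contDiff (n := 0) (L k) n0 n1 x0).continuous
  have hcl : closure Ω ⊆ O := fun z hzc => by
    simp only [hO, mem_iInter]
    exact fun k hk => hdS k (Finset.mem_range.1 hk) z hzc
  have hOk : ∀ k < m, O ⊆ {z | 0 < dS (L k) n0 n1 x0 z} := fun k hk z hzO => by
    simp only [hO, mem_iInter] at hzO
    exact hzO k (Finset.mem_range.2 hk)
  have cA : ∀ k < m, ContDiffOn ℝ 1 (yA (L k) n0 n1 x0) O := fun k hk =>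
    (yA_contDiffOn (L k) n0 n1 x0).mono (hOk k hk)
  have cB : ∀ k < m, ContDiffOn ℝ 1 (yB (L k) n0 n1 x0) O := fun k hk =>
    (yB_contDiffOn (L k) n0 n1 x0).mono (hOk k hk)
  set y0 : E2 → ℝ := fun z => (m:ℝ)⁻¹ * ∑ k ∈ Finset.range m, yA (L k) n0 n1 x0 z with hy0
  set y1 : E2 → ℝ := fun z => (m:ℝ)⁻¹ * ∑ k ∈ Finset.range m, yB (L k) n0 n1 x0 z with hy1
  have mm : (m:ℝ)⁻¹ * ∑ _k ∈ Finset.range m, η = η := by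
    simp; field_simp
  have pdA : ∀ i, ∀ x ∈ Ω, pd i y0 x = (m:ℝ)⁻¹ * ∑ k ∈ Finset.range m, pd i (yA (L k) n0 n1 x0) x := by
    intro i x hx
    have hd : ∀ k ∈ Finset.range m, DifferentiableAt ℝ (yA (L k) n0 n1 x0) x := fun k hk =>
      ((cA k (Finset.mem_range.1 hk)).differentiableOn (by simp)).differentiableAt
        (hOo.mem_nhds (hcl (subset_closure hx)))
    rw [hy0, pd_const_mul i _ (DifferentiableAt.fun_sum hd), pd_sum _ i hd]
  have pdB : ∀ i, ∀ x ∈ Ω, pd i y1 x = (m:ℝ)⁻¹ * ∑ k ∈ Finset.range m, pd i (yB (L k) n0 n1 x0) x := by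
    intro i x hx
    have hd : ∀ k ∈ Finset.range m, DifferentiableAt ℝ (yB (L k) n0 n1 x0) x := fun k hk =>
      ((cB k (Finset.mem_range.1 hk)).differentiableOn (by simp)).differentiableAt
        (hOo.mem_nhds (hcl (subset_closure hx)))
    rw [hy1, pd_const_mul i _ (DifferentiableAt.fun_sum hd), pd_sum _ i hd]
  have PY := fun (k : ℕ) (hk : k < m) (z : E2) (hzc : z ∈ closure Ω) => pd_y (L k) n0 n1 x0 (hdS k hk z hzc)
  refine ⟨O, y0, y1, hOo, hcl, ?_, ?_, ?_, ?_, ?_, ?_⟩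
  · exact contDiffOn_const.mul (ContDiffOn.sum fun k hk => cA k (Finset.mem_range.1 hk))
  · exact contDiffOn_const.mul (ContDiffOn.sum fun k hk => cB k (Finset.mem_range.1 hk))
  · intro x hx
    constructor
    · rw [hy0]; simp only
      rw [abs_mul, abs_of_pos (inv_pos.2 hm0), ← mm]
      gcongr
      refine (Finset.abs_sum_le_sum_abs _ _).trans (Finset.sum_le_sum fun k hk => ?_)
      have hk' := Finset.mem_range.1 hk
      exact ((alg k hk' x hx).2.2.2.1).trans (hLη k hk')
    · rw [hy1]; simp only
      rw [abs_mul, abs_of_pos (inv_pos.2 hm0), ← mm]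
      gcongr
      refine (Finset.abs_sum_le_sum_abs _ _).trans (Finset.sum_le_sum fun k hk => ?_)
      have hk' := Finset.mem_range.1 hk
      exact ((alg k hk' x hx).2.2.2.2).trans (hLη k hk')
  · intro x hx
    have hxc := subset_closure hx
    rw [pdA 0 x hx, pdA 1 x hx, pdB 0 x hx, pdB 1 x hx, ← mul_neg, ← Finset.sum_neg_distrib]
    constructor
    · congr 1
      apply Finset.sum_congr rfl fun k hk => ?_
      obtain ⟨h1, h2, h3, h4⟩ := PY k (Finset.mem_range.1 hk) x hxc
      rw [h1, h2]
    · congr 1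
      apply Finset.sum_congr rfl fun k hk => ?_
      obtain ⟨h1, h2, h3, h4⟩ := PY k (Finset.mem_range.1 hk) x hxc
      rw [h3, h4, neg_neg]
  · intro x hx
    have hxc := subset_closure hx
    set r2 := (x 0 - x0 0) ^ 2 + (x 1 - x0 1) ^ 2 with hr2
    have hr0 : 0 ≤ r2 := by positivity
    rw [pdA 0 x hx, pdB 1 x hx, ← mul_add, ← Finset.sum_add_distrib]
    have hsum := (dyadic_sum ρ (4 * r2) m (by positivity)).1
    have h1 : ∑ k ∈ Finset.range m, -(4 * r2⁻¹ * if (ρ * 2 ^ k) ^ 2 < 4 * r2 then (ρ * 2 ^ k) ^ 2 else 0) ≤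
        ∑ k ∈ Finset.range m, (pd 0 (yA (L k) n0 n1 x0) x + pd 1 (yB (L k) n0 n1 x0) x) := by
      refine Finset.sum_le_sum fun k hk => ?_
      have hk' := Finset.mem_range.1 hk
      obtain ⟨h1, h2, h3, h4⟩ := PY k hk' x hxc
      rw [h1, h2]
      have h5 := (alg k hk' x hxc).2.1
      simp only [dA, dB, dS]
      simp only [← hr2] at h5
      linarith
    rw [Finset.sum_neg_distrib, ← Finset.mul_sum] at h1
    have h2 : 4 * r2⁻¹ * (∑ k ∈ Finset.range m, if (ρ * 2 ^ k) ^ 2 < 4 * r2 then (ρ * 2 ^ k) ^ 2 else 0) ≤ 22 := by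
      refine (mul_le_mul_of_nonneg_left hsum (by positivity)).trans ?_
      have : r2⁻¹ * r2 ≤ 1 := inv_mul_le_one
      nlinarith
    have h3 : -22 ≤ ∑ k ∈ Finset.range m, (pd 0 (yA (L k) n0 n1 x0) x + pd 1 (yB (L k) n0 n1 x0) x) := by
      linarith
    have h4 := mul_le_mul_of_nonneg_left h3 (inv_pos.2 hm0).le
    have h5 : (m:ℝ)⁻¹ * -22 = - (22 / m) := by ring
    linarith
  · rintro x ⟨hx, hxb⟩
    have hxc := subset_closure hx
    rw [pdA 0 x hx, pdB 1 x hx, ← mul_add, ← Finset.sum_add_distrib]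
    have m1 : (1:ℝ) = (m:ℝ)⁻¹ * ∑ _k ∈ Finset.range m, (1:ℝ) := by simp; field_simp
    rw [m1]
    gcongr with k hk
    have hk' := Finset.mem_range.1 hk
    obtain ⟨h1, h2, h3, h4⟩ := PY k hk' x hxc
    rw [h1, h2]
    have hd : ‖x - x0‖ < ρ / 16 := by simpa [dist_eq_norm] using hxb
    have hd2 : (x 0 - x0 0) ^ 2 + (x 1 - x0 1) ^ 2 ≤ (ρ / 16) ^ 2 := by
      have := E2_norm_sq (x - x0)
      simp only [PiLp.sub_apply] at this
      rw [← this]; gcongr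
    have h5 := (alg k hk' x hxc).2.2.1 (by
      have : ρ ^ 2 ≤ (L k) ^ 2 := by gcongr; exact hLρ k
      nlinarith)
    simp only [dA, dB, dS]
    linarith



lemma Fn.exp_CB {Ω : Set E2} {w u : E2 → ℝ} (G : GoodDom Ω w) (F : Fn Ω w u) :
    CB Ω (fun x => Real.exp (u x) - 1) :=
  CB.of_closure G ((Real.continuous_exp.comp_continuousOn F.cont).sub continuousOn_const)

lemma Fn.exp_sub_int {Ω : Set E2} {w u : E2 → ℝ} (G : GoodDom Ω w) (F : Fn Ω w u) {C : ℝ}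
    (h : ∫ x in Ω, Real.exp (u x) ≤ C) : ∫ x in Ω, (Real.exp (u x) - 1) ≤ C := by
  refine (setIntegral_mono ((F.exp_CB G).int G) (F.exp_int1 G) fun x => ?_).trans h
  simp

lemma Fn.exp_nonneg {Ω : Set E2} {w u : E2 → ℝ} (F : Fn Ω w u) {x : E2} (hx : x ∈ Ω) :
    0 ≤ Real.exp (u x) - 1 := by
  have := Real.one_le_exp (F.nonneg x (subset_closure hx)); linarith

lemma quad1 (p q p' q' : ℝ) : |p * p' - q * q'| ≤ (p ^ 2 + q ^ 2) + (p' ^ 2 + q' ^ 2) := by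
  rw [abs_le]; constructor <;> nlinarith [sq_nonneg (p + p'), sq_nonneg (p - p'), sq_nonneg (q + q'), sq_nonneg (q - q')]

lemma quad2 (p q p' q' : ℝ) : |p * q' + q * p'| ≤ (p ^ 2 + q ^ 2) + (p' ^ 2 + q' ^ 2) := by
  rw [abs_le]; constructor <;> nlinarith [sq_nonneg (p + q'), sq_nonneg (p - q'), sq_nonneg (q + p'), sq_nonneg (q - p')]

set_option maxHeartbeats 4000000 in
theorem bdry_mass {Ω : Set E2} {w : E2 → ℝ} (G : GoodDom Ω w) {R b : ℝ} (hR : 0 < R) (hb : 0 ≤ b)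
    (hd : ∀ x ∈ Ω, ∀ y ∈ closure Ω, ‖y - x‖ ≤ R) (C : ℝ) (A : ℝ≥0) :
    ∃ s > 0, ∀ V W u v, Sys Ω w b C A V W u v → ∀ x0 ∈ frontier Ω,
      ∫ x in Ω ∩ ball x0 s, (V x * (Real.exp (v x) - 1) + W x * (Real.exp (u x) - 1)) ≤ 1 := by
  obtain ⟨X0, X1, hX0, hX1, ⟨c, hc, hcX⟩, Q, hQ, hQΩ, hCR⟩ := fieldX G
  obtain ⟨K', hK'⟩ := int_energy G hR hb hd C A hQ hQΩ
  set K := |K'| with hKdef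
  have hK : ∀ V W u v, Sys Ω w b C A V W u v →
      IntegrableOn (fun x => pd 0 u x ^ 2 + pd 1 u x ^ 2) Q ∧
      ∫ x in Q, (pd 0 u x ^ 2 + pd 1 u x ^ 2) ≤ K := fun V W u v S =>
    ⟨(hK' V W u v S).1, (hK' V W u v S).2.trans (le_abs_self _)⟩
  have bdc : ∀ {f : E2 → ℝ}, Continuous f → ∃ M, 0 ≤ M ∧ ∀ x ∈ closure Ω, |f x| ≤ M := by
    intro f hf
    obtain ⟨M, hM⟩ := G.isCompact_closure.exists_bound_of_continuousOn hf.continuousOn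
    exact ⟨|M|, abs_nonneg _, fun x hx => (hM x hx).trans (le_abs_self _)⟩
  obtain ⟨M0, m0, hM0⟩ := bdc (f := fun x => |X0 x| + |X1 x| + |pd 0 X0 x| + |pd 1 X0 x| + |pd 0 X1 x|
    + |pd 1 X1 x|) (by
      have := hX0.continuous
      have := hX1.continuous
      have := Cv_cpt1 hX0 0
      have := Cv_cpt1 hX0 1
      have := Cv_cpt1 hX1 0
      have := Cv_cpt1 hX1 1
      fun_prop)
  obtain ⟨Mw, mw, hMw⟩ := bdc (f := fun x => |pd 0 w x| + |pd 1 w x|) (by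
      have := G.cont_pd 0
      have := G.cont_pd 1
      fun_prop)
  set B0 := (1 + 2 * M0) * (2 * (b * |C|)) + 4 * A * (1 + M0) * |C| + 8 * M0 * K with hB0
  have hB0' : 0 ≤ B0 := by positivity
  set ε := 1 / (B0 + 1) with hε
  have hε0 : 0 < ε := by positivity
  have hεB : ε * B0 ≤ 1 := by
    rw [hε, one_div, inv_mul_le_iff₀ (by positivity)]; linarith
  set η := min ε (ε * c / (Mw + 1)) with hη
  have hη0 : 0 < η := by positivity
  have hηε : η ≤ ε := min_le_left _ _
  have hηM : η * Mw ≤ ε * c := by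
    have h1 : η ≤ ε * c / (Mw + 1) := min_le_right _ _
    rw [le_div_iff₀ (by positivity)] at h1
    nlinarith
  obtain ⟨s0, hs0, hy⟩ := fieldy G hη0
  refine ⟨s0, hs0, ?_⟩
  intro V W u v S x0 hx0
  obtain ⟨O, y0, y1, hO, hcl, cy0, cy1, hyb, hyCR, hydiv, hydiv1⟩ := hy x0 hx0
  have hC0 : 0 ≤ C := le_trans (setIntegral_nonneg G.measurable fun x _ => (Real.exp_pos _).le) S.EU
  have hCa : |C| = C := abs_of_nonneg hC0
  have hΩO : Ω ⊆ O := subset_closure.trans hcl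
  set Y0 : E2 → ℝ := fun x => y0 x + ε * X0 x with hY0
  set Y1 : E2 → ℝ := fun x => y1 x + ε * X1 x with hY1
  have cY0 : ContDiffOn ℝ 1 Y0 O := cy0.add (contDiffOn_const.mul hX0.contDiffOn)
  have cY1 : ContDiffOn ℝ 1 Y1 O := cy1.add (contDiffOn_const.mul hX1.contDiffOn)
  have dX : ∀ {X : E2 → ℝ}, ContDiff ℝ 1 X → ∀ x, DifferentiableAt ℝ X x := fun h x =>
    h.differentiable (by simp) x
  have pdY : ∀ {y X : E2 → ℝ}, ContDiffOn ℝ 1 y O → ContDiff ℝ 1 X → ∀ i, ∀ x ∈ Ω,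
      pd i (fun x => y x + ε * X x) x = pd i y x + ε * pd i X x := by
    intro y X hyy hX i x hx
    have h1 : DifferentiableAt ℝ y x :=
      (hyy.differentiableOn (by simp)).differentiableAt (hO.mem_nhds (hΩO hx))
    rw [pd_add (f := y) (g := fun x => ε * X x) i h1 ((dX hX x).const_mul ε), pd_const_mul i ε (dX hX x)]
  have sixX : ∀ x ∈ closure Ω, |X0 x| + |X1 x| + |pd 0 X0 x| + |pd 1 X0 x| + |pd 0 X1 x|
      + |pd 1 X1 x| ≤ M0 := fun x hx => (le_abs_self _).trans (hM0 x hx)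
  have poh := pohozaev G S hO hcl cY0 cY1 (by
    intro x hx
    obtain ⟨h1, h2⟩ := hyb x (frontier_subset_closure hx)
    have h3 := (le_abs_self _).trans (hMw x (frontier_subset_closure hx))
    have h4 := hcX x hx
    have h5 : |y0 x * pd 0 w x| ≤ η * |pd 0 w x| := by rw [abs_mul]; gcongr
    have h6 : |y1 x * pd 1 w x| ≤ η * |pd 1 w x| := by rw [abs_mul]; gcongr
    have h7 := neg_abs_le (y0 x * pd 0 w x)
    have h8 := neg_abs_le (y1 x * pd 1 w x)
    have h9 := mul_le_mul_of_nonneg_left h3 hη0.le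
    have h10 := mul_le_mul_of_nonneg_left h4 hε0.le
    simp only [hY0, hY1]
    nlinarith)
  -- integrability
  have F1 := S.S1.toFn
  have F2 := S.S2.toFn
  have cbV : CB Ω V := CB.of_closure G S.LV.continuousOn
  have cbW : CB Ω W := CB.of_closure G S.LW.continuousOn
  set Φ : E2 → ℝ := fun x => V x * (Real.exp (v x) - 1) + W x * (Real.exp (u x) - 1) with hΦ
  have cbΦ : CB Ω Φ := (cbV.mul (F2.exp_CB G)).add (cbW.mul (F1.exp_CB G))
  have Φ0 : ∀ x ∈ Ω, 0 ≤ Φ x := fun x hx =>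
    add_nonneg (mul_nonneg (S.V0 x hx) (F2.exp_nonneg hx)) (mul_nonneg (S.W0 x hx) (F1.exp_nonneg hx))
  have ΦI : ∫ x in Ω, Φ x ≤ 2 * (b * C) := by
    have h1 : ∫ x in Ω, Φ x ≤ ∫ x in Ω, (V x * Real.exp (v x) + W x * Real.exp (u x)) := by
      refine setIntegral_mono_on (cbΦ.int G) ((S.S1.f_int G).add (S.S2.f_int G)) G.measurable fun x hx => ?_
      simp only [hΦ]
      linarith [S.V0 x hx, S.W0 x hx]
    rw [integral_add (S.S1.f_int G) (S.S2.f_int G)] at h1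
    linarith [S.mass G hb, S.symm.mass G hb]
  have cbp : ∀ {Y : E2 → ℝ}, ContDiffOn ℝ 1 Y O → ∀ i, CB Ω (pd i Y) := fun hY i =>
    CB.of_closure G ((continuousOn_pd hO hY i).mono hcl)
  have cbY : ∀ {Y : E2 → ℝ}, ContDiffOn ℝ 1 Y O → CB Ω Y := fun hY =>
    CB.of_closure G (hY.continuousOn.mono hcl)
  have eb : ∀ {z : E2 → ℝ}, Fn Ω w z → ∫ x in Ω, Real.exp (z x) ≤ C →
      ∫ x in Ω, (|Y0 x| + |Y1 x|) * (Real.exp (z x) - 1) ≤ 2 * (η + ε * M0) * C := by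
    intro z Fz hz
    have h1 : ∫ x in Ω, (|Y0 x| + |Y1 x|) * (Real.exp (z x) - 1) ≤
        ∫ x in Ω, 2 * (η + ε * M0) * (Real.exp (z x) - 1) := by
      refine setIntegral_mono_on ((((cbY cY0).abs.add (cbY cY1).abs).mul (Fz.exp_CB G)).int G)
        (((CB.const Ω _).mul (Fz.exp_CB G)).int G) G.measurable fun x hx => ?_
      apply mul_le_mul_of_nonneg_right _ (Fz.exp_nonneg hx)
      obtain ⟨h1, h2⟩ := hyb x (subset_closure hx)
      have h3 := sixX x (subset_closure hx)
      have h4 : |Y0 x| ≤ |y0 x| + ε * |X0 x| := by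
        simp only [hY0]; refine (abs_add_le _ _).trans ?_
        rw [abs_mul, abs_of_pos hε0]
      have h5 : |Y1 x| ≤ |y1 x| + ε * |X1 x| := by
        simp only [hY1]; refine (abs_add_le _ _).trans ?_
        rw [abs_mul, abs_of_pos hε0]
      have h6 : |X0 x| + |X1 x| ≤ M0 := by
        linarith [abs_nonneg (pd 0 X0 x), abs_nonneg (pd 1 X0 x), abs_nonneg (pd 0 X1 x), abs_nonneg (pd 1 X1 x)]
      have h7 := mul_le_mul_of_nonneg_left h6 hε0.le
      have h8 : 0 ≤ ε * M0 := by positivity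
      linarith
    rw [integral_const_mul] at h1
    exact h1.trans (mul_le_mul_of_nonneg_left (Fz.exp_sub_int G hz) (by positivity))
  -- the tensor term
  have tens : |∫ x in Ω, ((pd 0 u x * pd 0 v x - pd 1 u x * pd 1 v x) * (pd 0 Y0 x - pd 1 Y1 x) +
      (pd 0 u x * pd 1 v x + pd 1 u x * pd 0 v x) * (pd 0 Y1 x + pd 1 Y0 x))| ≤ ε * (8 * M0 * K) := by
    obtain ⟨iu, hu⟩ := hK V W u v S
    obtain ⟨iv, hv⟩ := hK W V v u S.symm
    rw [setIntegral_eq_of_subset_of_forall_sdiff_eq_zero G.measurable hQΩ]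
    · have h1 : |∫ x in Q, ((pd 0 u x * pd 0 v x - pd 1 u x * pd 1 v x) * (pd 0 Y0 x - pd 1 Y1 x) +
        (pd 0 u x * pd 1 v x + pd 1 u x * pd 0 v x) * (pd 0 Y1 x + pd 1 Y0 x))| ≤
        ∫ x in Q, ε * (4 * M0) * ((pd 0 u x ^ 2 + pd 1 u x ^ 2) + (pd 0 v x ^ 2 + pd 1 v x ^ 2)) := by
        rw [← Real.norm_eq_abs]
        apply norm_integral_le_of_norm_le ((iu.add iv).const_mul _)
        filter_upwards [ae_restrict_mem hQ.measurableSet] with x hxQ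
        have hx := hQΩ hxQ
        obtain ⟨c1, c2⟩ := hyCR x hx
        have h3 := sixX x (subset_closure hx)
        simp only [hY0, hY1]
        rw [pdY cy0 hX0 0 x hx, pdY cy0 hX0 1 x hx, pdY cy1 hX1 0 x hx, pdY cy1 hX1 1 x hx, c1, c2]
        simp only [Pi.add_apply]
        set p := pd 0 u x
        set q := pd 1 u x
        set p' := pd 0 v x
        set q' := pd 1 v x
        set E := (p ^ 2 + q ^ 2) + (p' ^ 2 + q' ^ 2) with hE
        have hE0 : 0 ≤ E := by positivity
        have t0 : |p * p' - q * q'| ≤ E := quad1 p q p' q'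
        have t1 : |p * q' + q * p'| ≤ E := quad2 p q p' q'
        have d0 : |pd 0 X0 x - pd 1 X1 x| ≤ 2 * M0 := by
          refine (abs_sub _ _).trans ?_
          linarith [abs_nonneg (X0 x), abs_nonneg (X1 x), abs_nonneg (pd 0 X0 x), abs_nonneg (pd 1 X0 x), abs_nonneg (pd 0 X1 x), abs_nonneg (pd 1 X1 x)]
        have d1 : |pd 0 X1 x + pd 1 X0 x| ≤ 2 * M0 := by
          refine (abs_add_le _ _).trans ?_
          linarith [abs_nonneg (X0 x), abs_nonneg (X1 x), abs_nonneg (pd 0 X0 x), abs_nonneg (pd 1 X0 x), abs_nonneg (pd 0 X1 x), abs_nonneg (pd 1 X1 x)]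
        have e : (p * p' - q * q') * (pd 1 y1 x + ε * pd 0 X0 x - (pd 1 y1 x + ε * pd 1 X1 x)) +
            (p * q' + q * p') * (-pd 1 y0 x + ε * pd 0 X1 x + (pd 1 y0 x + ε * pd 1 X0 x)) =
            ε * ((p * p' - q * q') * (pd 0 X0 x - pd 1 X1 x) + (p * q' + q * p') * (pd 0 X1 x + pd 1 X0 x)) := by
          ring
        rw [e, Real.norm_eq_abs, abs_mul, abs_of_pos hε0, mul_assoc]
        apply mul_le_mul_of_nonneg_left _ hε0.le
        refine (abs_add_le _ _).trans ?_
        rw [abs_mul, abs_mul]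
        have g0 := mul_le_mul t0 d0 (abs_nonneg _) hE0
        have g1 := mul_le_mul t1 d1 (abs_nonneg _) hE0
        linarith
      refine h1.trans ?_
      rw [integral_const_mul, integral_add iu iv]
      have : ε * (4 * M0) * ((∫ x in Q, (pd 0 u x ^ 2 + pd 1 u x ^ 2)) +
        ∫ x in Q, (pd 0 v x ^ 2 + pd 1 v x ^ 2)) ≤ ε * (4 * M0) * (K + K) := by gcongr
      linarith
    · intro x hx
      obtain ⟨c1, c2⟩ := hyCR x hx.1
      obtain ⟨c3, c4⟩ := hCR x hx
      simp only [hY0, hY1]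
      rw [pdY cy0 hX0 0 x hx.1, pdY cy0 hX0 1 x hx.1, pdY cy1 hX1 0 x hx.1, pdY cy1 hX1 1 x hx.1, c1, c2, c3, c4]
      ring
  -- lower bound
  have low : (∫ x in Ω ∩ ball x0 s0, Φ x) - (η + 2 * ε * M0) * (2 * (b * C)) ≤
      ∫ x in Ω, (pd 0 Y0 x + pd 1 Y1 x) * Φ x := by
    have hI : IntegrableOn ((ball x0 s0).indicator Φ) Ω := (cbΦ.int G).indicator measurableSet_ball
    have h1 : ∫ x in Ω ∩ ball x0 s0, Φ x = ∫ x in Ω, (ball x0 s0).indicator Φ x := by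
      rw [setIntegral_indicator measurableSet_ball]
    have h2 : ∫ x in Ω, ((ball x0 s0).indicator Φ x - (η + 2 * ε * M0) * Φ x) ≤
        ∫ x in Ω, (pd 0 Y0 x + pd 1 Y1 x) * Φ x := by
      refine setIntegral_mono_on (hI.sub ((cbΦ.int G).const_mul _))
        ((((cbp cY0 0).add (cbp cY1 1)).mul cbΦ).int G) G.measurable fun x hx => ?_
      have h3 := sixX x (subset_closure hx)
      have hΦx := Φ0 x hx
      have e : pd 0 Y0 x + pd 1 Y1 x = (pd 0 y0 x + pd 1 y1 x) + ε * (pd 0 X0 x + pd 1 X1 x) := by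
        simp only [hY0, hY1]
        rw [pdY cy0 hX0 0 x hx, pdY cy1 hX1 1 x hx]; ring
      have h4 : -(2 * M0) ≤ pd 0 X0 x + pd 1 X1 x := by
        linarith [abs_nonneg (X0 x), abs_nonneg (X1 x), abs_nonneg (pd 0 X0 x), abs_nonneg (pd 1 X0 x), abs_nonneg (pd 0 X1 x), abs_nonneg (pd 1 X1 x), neg_abs_le (pd 0 X0 x), neg_abs_le (pd 1 X1 x)]
      have h5 := mul_le_mul_of_nonneg_left h4 hε0.le
      rw [e]
      by_cases hxb : x ∈ ball x0 s0
      · rw [indicator_of_mem hxb]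
        have h6 := hydiv1 x ⟨hx, hxb⟩
        have h7 : 1 - (η + 2 * ε * M0) ≤ (pd 0 y0 x + pd 1 y1 x) + ε * (pd 0 X0 x + pd 1 X1 x) := by
          linarith
        have := mul_le_mul_of_nonneg_right h7 hΦx
        linarith
      · rw [indicator_of_notMem hxb]
        have h6 := hydiv x hx
        have h7 : - (η + 2 * ε * M0) ≤ (pd 0 y0 x + pd 1 y1 x) + ε * (pd 0 X0 x + pd 1 X1 x) := by
          linarith
        have := mul_le_mul_of_nonneg_right h7 hΦx
        linarith
    rw [integral_sub hI ((cbΦ.int G).const_mul _), integral_const_mul, ← h1] at h2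
    have := mul_le_mul_of_nonneg_left ΦI (show 0 ≤ η + 2 * ε * M0 by positivity)
    linarith
  have p1 := mul_le_mul_of_nonneg_left (eb F2 S.EV) A.coe_nonneg
  have p2 := mul_le_mul_of_nonneg_left (eb F1 S.EU) A.coe_nonneg
  have p3 := (abs_le.1 tens).1
  have q1 : (η + 2 * ε * M0) * (2 * (b * C)) ≤ ε * ((1 + 2 * M0) * (2 * (b * C))) := by
    have : η + 2 * ε * M0 ≤ ε * (1 + 2 * M0) := by linarith
    have := mul_le_mul_of_nonneg_right this (show 0 ≤ 2 * (b * C) by positivity)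
    linarith
  have q2 : (A:ℝ) * (2 * (η + ε * M0) * C) ≤ ε * (2 * A * (1 + M0) * C) := by
    have : η + ε * M0 ≤ ε * (1 + M0) := by linarith
    have := mul_le_mul_of_nonneg_right this (show 0 ≤ 2 * A * C by positivity)
    linarith
  have hB : ε * B0 = ε * ((1 + 2 * M0) * (2 * (b * C))) + 2 * (ε * (2 * A * (1 + M0) * C)) +
      ε * (8 * M0 * K) := by rw [hB0, hCa]; ring
  linarith



lemma Sys.half_mass {Ω : Set E2} {w : E2 → ℝ} {b C : ℝ} {A : ℝ≥0} {V W u v : E2 → ℝ}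
    (G : GoodDom Ω w) (hb : 0 ≤ b) (S : Sys Ω w b C A V W u v) {x0 : E2} {s s' : ℝ} (hs0 : 0 < s')
    (hs : s' ≤ s) (hbs : b * s' ^ 2 ≤ 1)
    (h : ∫ x in Ω ∩ ball x0 s, (V x * (Real.exp (v x) - 1) + W x * (Real.exp (u x) - 1)) ≤ 1) :
    ∫ x in Ω ∩ ball x0 s', V x * Real.exp (v x) ≤ 2 * π * 1 := by
  have iV : IntegrableOn V Ω := by
    refine Integrable.mono' (integrableOn_const (C := b) G.finite.ne) ?_ ?_
    · exact (S.LV.continuousOn.mono subset_closure).aestronglyMeasurable G.measurable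
    · filter_upwards [ae_restrict_mem G.measurable] with x hx
      rw [Real.norm_eq_abs, abs_of_nonneg (S.V0 x hx)]; exact S.Vb x hx
  have iW : IntegrableOn W Ω := by
    refine Integrable.mono' (integrableOn_const (C := b) G.finite.ne) ?_ ?_
    · exact (S.LW.continuousOn.mono subset_closure).aestronglyMeasurable G.measurable
    · filter_upwards [ae_restrict_mem G.measurable] with x hx
      rw [Real.norm_eq_abs, abs_of_nonneg (S.W0 x hx)]; exact S.Wb x hx
  have iΦ : IntegrableOn (fun x => V x * (Real.exp (v x) - 1) + W x * (Real.exp (u x) - 1)) Ω := by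
    have := ((S.S1.f_int G).sub iV).add ((S.S2.f_int G).sub iW)
    refine this.congr (ae_of_all _ fun x => ?_)
    simp only [Pi.add_apply, Pi.sub_apply]; ring
  have hm : MeasurableSet (Ω ∩ ball x0 s') := G.measurable.inter measurableSet_ball
  have hfin : volume (Ω ∩ ball x0 s') ≠ ⊤ := ((measure_mono inter_subset_left).trans_lt G.finite).ne
  have ic : IntegrableOn (fun _ : E2 => b) (Ω ∩ ball x0 s') := integrableOn_const hfin
  have hsub : Ω ∩ ball x0 s' ⊆ Ω ∩ ball x0 s := inter_subset_inter_right _ (ball_subset_ball hs)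
  have p1 : ∀ x ∈ Ω, 0 ≤ V x * (Real.exp (v x) - 1) := fun x hx =>
    mul_nonneg (S.V0 x hx) (S.S2.toFn.exp_nonneg hx)
  have p2 : ∀ x ∈ Ω, 0 ≤ W x * (Real.exp (u x) - 1) := fun x hx =>
    mul_nonneg (S.W0 x hx) (S.S1.toFn.exp_nonneg hx)
  have h1 : ∫ x in Ω ∩ ball x0 s', V x * Real.exp (v x) ≤
      ∫ x in Ω ∩ ball x0 s', ((V x * (Real.exp (v x) - 1) + W x * (Real.exp (u x) - 1)) + b) := by
    refine setIntegral_mono_on ((S.S1.f_int G).mono_set inter_subset_left)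
      ((iΦ.mono_set inter_subset_left).add ic) hm fun x hx => ?_
    have := p2 x hx.1
    have := S.Vb x hx.1
    linarith
  rw [integral_add (iΦ.mono_set inter_subset_left) ic, setIntegral_const, smul_eq_mul] at h1
  have h2 : ∫ x in Ω ∩ ball x0 s', (V x * (Real.exp (v x) - 1) + W x * (Real.exp (u x) - 1)) ≤
      ∫ x in Ω ∩ ball x0 s, (V x * (Real.exp (v x) - 1) + W x * (Real.exp (u x) - 1)) := by
    refine setIntegral_mono_set (iΦ.mono_set inter_subset_left) ?_ hsub.eventuallyLE
    filter_upwards [ae_restrict_mem (G.measurable.inter measurableSet_ball)] with x hx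
    exact add_nonneg (p1 x hx.1) (p2 x hx.1)
  have h3 : volume.real (Ω ∩ ball x0 s') ≤ π * s' ^ 2 := by
    refine (measureReal_mono inter_subset_right measure_ball_lt_top.ne).trans ?_
    rw [Measure.real, EuclideanSpace.volume_ball_fin_two]
    simp [hs0.le, mul_comm, ENNReal.toReal_ofReal Real.pi_pos.le]
  have h4 := mul_le_mul_of_nonneg_right h3 hb
  have h5 := mul_le_mul_of_nonneg_left hbs Real.pi_pos.le
  have := Real.pi_gt_three
  linarith

lemma closedBall_sub_of_frontier {Ω : Set E2} (hO : IsOpen Ω) {x : E2} (hx : x ∈ Ω) {ρ : ℝ} (hρ : 0 ≤ ρ)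
    (h : ∀ y ∈ frontier Ω, y ∉ closedBall x ρ) : closedBall x ρ ⊆ Ω := by
  have hc : IsPreconnected (closedBall x ρ) := (convex_closedBall x ρ).isPreconnected
  by_contra hn
  obtain ⟨y, hy, hyΩ⟩ := not_subset.1 hn
  have hfr : ∀ z ∈ closedBall x ρ, z ∈ Ω ∨ z ∈ (closure Ω)ᶜ := fun z hz => by
    by_contra hcon
    rw [not_or, notMem_compl_iff] at hcon
    exact h z (by rw [hO.frontier_eq]; exact ⟨hcon.2, hcon.1⟩) hz
  obtain ⟨z, -, hz1, hz2⟩ := hc Ω (closure Ω)ᶜ hO isClosed_closure.isOpen_compl hfr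
    ⟨x, mem_closedBall_self hρ, hx⟩ ⟨y, hy, (hfr y hy).resolve_left hyΩ⟩
  exact hz2 (subset_closure hz1)

theorem sys_bound {Ω : Set E2} {w : E2 → ℝ} (G : GoodDom Ω w) {R b : ℝ} (hR : 0 < R) (hb : 0 ≤ b)
    (hd : ∀ x ∈ Ω, ∀ y ∈ closure Ω, ‖y - x‖ ≤ R) (C : ℝ) (A : ℝ≥0) :
    ∃ K, ∀ V W u v, Sys Ω w b C A V W u v → ∀ x ∈ Ω, u x ≤ K ∧ v x ≤ K := by
  obtain ⟨s, hs, hm⟩ := bdry_mass G hR hb hd C A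
  set s' := min s (1 / (b + 1)) with hs'
  have hs0 : 0 < s' := lt_min hs (by positivity)
  have hle : s' ≤ 1 / (b + 1) := min_le_right _ _
  have hbs : b * s' ^ 2 ≤ 1 := by
    rw [le_div_iff₀ (by positivity)] at hle
    have h1 : s' ≤ 1 := by linarith [mul_nonneg hs0.le hb]
    have h2 : s' * s' ≤ s' * 1 := mul_le_mul_of_nonneg_left h1 hs0.le
    have := mul_le_mul_of_nonneg_left h2 hb
    linarith
  obtain ⟨K1, hK1⟩ := bm (B := b * C) hR hs0 one_pos one_lt_two hb
  obtain ⟨K2, hK2⟩ := int_sup G hR hb hd C A (show 0 < s' / 8 by positivity)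
  refine ⟨max K1 K2, fun V W u v S x hx => ?_⟩
  by_cases h : ∃ x0 ∈ frontier Ω, x0 ∈ closedBall x (s' / 8)
  · obtain ⟨x0, h0, hx0⟩ := h
    have m1 := hm V W u v S x0 h0
    have m2 := hm W V v u S.symm x0 h0
    have := hK1 Ω w u v _ _ G S.S1 S.S2
      (fun x hx => mul_le_mul_of_nonneg_right (S.Vb x hx) (Real.exp_pos _).le)
      (fun x hx => mul_le_mul_of_nonneg_right (S.Wb x hx) (Real.exp_pos _).le)
      hd (S.mass G hb) (S.symm.mass G hb) x0
      (S.half_mass G hb hs0 (min_le_left _ _) hbs m1)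
      (S.symm.half_mass G hb hs0 (min_le_left _ _) hbs m2) x
      ⟨hx, by rw [mem_ball, dist_comm]; rw [mem_closedBall] at hx0; linarith⟩
    exact ⟨this.1.trans (le_max_left _ _), this.2.trans (le_max_left _ _)⟩
  · push Not at h
    have := hK2 V W u v S x (closedBall_sub_of_frontier G.isOpen hx (by positivity) h)
    exact ⟨this.1.trans (le_max_right _ _), this.2.trans (le_max_right _ _)⟩

lemma mk_sol1 {Ω : Set E2} {w : E2 → ℝ} (G : GoodDom Ω w) {V u v : E2 → ℝ} {b : ℝ}
    (hu : ContDiffOn ℝ 2 u (closure Ω)) (hv : ContDiffOn ℝ 2 v (closure Ω))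
    (he : ∀ x ∈ Ω, -lap u x = V x * Real.exp (v x)) (hz : ∀ x ∈ frontier Ω, u x = 0)
    (hV : ∀ x ∈ Ω, 0 ≤ V x ∧ V x ≤ b) (hVc : ContinuousOn V (closure Ω)) :
    Sol1 Ω w u (fun x => V x * Real.exp (v x)) := by
  have f0 : ∀ x ∈ Ω, 0 ≤ V x * Real.exp (v x) := fun x hx => mul_nonneg (hV x hx).1 (Real.exp_pos _).le
  have hc : ContinuousOn (fun x => V x * Real.exp (v x)) (closure Ω) :=
    hVc.mul hv.continuousOn.rexp
  have F := G.fn hu (fun x hx => by have := he x hx; have := f0 x hx; linarith) hz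
  refine { F with
    eq := fun x hx => by have := he x hx; linarith
    fc := hc.mono subset_closure
    f0 := f0
    fb := ?_ }
  obtain ⟨M, hM⟩ := G.isCompact_closure.bddAbove_image hc
  exact ⟨M, fun x hx => hM (mem_image_of_mem _ (subset_closure hx))⟩

/-- **Theorem 1.2: global a priori bound for the Gelfand–Liouville system under a Lipschitz
condition on the potentials.** The uniform Lipschitz bounds `‖∇V‖_∞ ≤ A₁`, `‖∇W‖_∞ ≤ A₂`
are expressed by `V`, `W` being Lipschitz on `Ω̄` with constants `A₁`, `A₂`. -/
theorem global_bound_system_lipschitz (Ω : Set E2) (hΩo : IsOpen Ω)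
    (hΩb : Bornology.IsBounded Ω) (hΩs : SmoothBoundary Ω)
    (b₁ b₂ A₁ A₂ C₁ C₂ : ℝ) :
    ∃ C₃ C₄ : ℝ, ∀ (V W u v : E2 → ℝ),
      ContDiffOn ℝ 2 u (closure Ω) →
      ContDiffOn ℝ 2 v (closure Ω) →
      (∀ x ∈ Ω, -lap u x = V x * Real.exp (v x)) →
      (∀ x ∈ Ω, -lap v x = W x * Real.exp (u x)) →
      (∀ x ∈ frontier Ω, u x = 0) →
      (∀ x ∈ frontier Ω, v x = 0) →
      (∀ x ∈ Ω, 0 ≤ V x ∧ V x ≤ b₁) →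
      (∀ x ∈ Ω, 0 ≤ W x ∧ W x ≤ b₂) →
      LipschitzOnWith (Real.toNNReal A₁) V (closure Ω) →
      LipschitzOnWith (Real.toNNReal A₂) W (closure Ω) →
      (∫ x in Ω, Real.exp (u x)) ≤ C₁ →
      (∫ x in Ω, Real.exp (v x)) ≤ C₂ →
      (∀ x ∈ Ω, |u x| ≤ C₃) ∧ (∀ x ∈ Ω, |v x| ≤ C₄) := by
  obtain ⟨w, G⟩ := exists_goodDom hΩo hΩb hΩs
  obtain ⟨R0, hR0⟩ := Metric.isBounded_iff.1 hΩb.closure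
  set R := max R0 1
  have hR : 0 < R := lt_max_of_lt_right one_pos
  have hd : ∀ x ∈ Ω, ∀ y ∈ closure Ω, ‖y - x‖ ≤ R := fun x hx y hy => by
    rw [← dist_eq_norm]
    exact (hR0 hy (subset_closure hx)).trans (le_max_left _ _)
  set b := max (max b₁ b₂) 0
  have hb : 0 ≤ b := le_max_right _ _
  have hb1 : b₁ ≤ b := (le_max_left _ _).trans (le_max_left _ _)
  have hb2 : b₂ ≤ b := (le_max_right _ _).trans (le_max_left _ _)
  obtain ⟨K, hK⟩ := sys_bound G hR hb hd (max C₁ C₂) (max A₁.toNNReal A₂.toNNReal)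
  refine ⟨K, K, fun V W u v hu hv eu ev zu zv hV hW LV LW EU EV => ?_⟩
  have S1 := mk_sol1 G hu hv eu zu hV LV.continuousOn
  have S2 := mk_sol1 G hv hu ev zv hW LW.continuousOn
  have S : Sys Ω w b (max C₁ C₂) (max A₁.toNNReal A₂.toNNReal) V W u v :=
    ⟨S1, S2, fun x hx => (hV x hx).1, fun x hx => (hV x hx).2.trans hb1,
      fun x hx => (hW x hx).1, fun x hx => (hW x hx).2.trans hb2,
      LV.weaken (le_max_left _ _), LW.weaken (le_max_right _ _),
      EU.trans (le_max_left _ _), EV.trans (le_max_right _ _)⟩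
  have h := hK V W u v S
  refine ⟨fun x hx => ?_, fun x hx => ?_⟩
  · rw [abs_of_nonneg (S1.nonneg x (subset_closure hx))]; exact (h x hx).1
  · rw [abs_of_nonneg (S2.nonneg x (subset_closure hx))]; exact (h x hx).2
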